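/- arXiv:1912.10415 — 4 statements merged into one kernel-verified Lean document; each statement's English description precedes it below -/
import Mathlib

section
/- Let V be a real Hilbert space, p a positive even integer, T > 0, and π = (π_n) a sequence of finite partitions of [0,T] with mesh tending to 0. Let ω : [0,T] → ℝ be continuous with finite p-th variation along π, and assume (h1) [ω]_p^π is continuously differentiable on [0,T]. Let B be the infinitesimal generator of a strongly continuous group G_B of bounded linear operators on V with (h3) ‖G_B(x)‖_{L(V)} ≤ 1 for every x ∈ ℝ. Let Y be a Hilbert space continuously and densely embedded in V such that (h4) G_B(x)Y ⊆ Y and (h5) ‖G_B(x)‖_{L(Y)} ≤ 1 for every x ∈ ℝ. Let A : Dom A ⊆ V → V be linear, set Dom C := Dom A ∩ Dom B^p and C(t) := A − (1/p!)(d[ω]_p^π/dt)(t) B^p on Dom C, and assume: (h6) Y ⊆ Dom C and C(t) is a closed operator for every t ∈ [0,T]; (h7) there exists λ₁ ∈ ℝ such that every real λ > λ₁ belongs to the resolvent set of C(t) for every t ∈ [0,T] and ‖(λ − C(t))^{-1}‖_{L(V)} ≤ 1/(λ − λ₁); (h8) there exists an isomorphism Q : Y → V (a bounded linear bijection with bounded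 inverse) such that (a) C(t)Q^{-1}(Dom C) ⊆ Y for every t ∈ [0,T], (b) Q G_B(x) y = G_B(x) Q y for every x ∈ ℝ and y ∈ Y, and there exists a strongly continuous map L : [0,T] → L(V) such that Q C(t) Q^{-1} v = C(t) v + L(t) v for every t ∈ [0,T] and v ∈ Dom C. Then for every s ∈ [0,T) and every x₀ ∈ Y there exists a strong solution X : [s,T] → V of dX_t = A X_t dt + B X_t d^π ω_t with X(s) = x₀ which takes values in Y. -/
open MeasureTheory Filter Set Topology

/-- A finite partition `a = t 0 < t 1 < ... < t N = b` of the interval `[a, b]`. -/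
structure IntervalPartition (a b : ℝ) where
  N : ℕ
  hN : 0 < N
  t : ℕ → ℝ
  mono : ∀ i, i < N → t i < t (i + 1)
  first : t 0 = a
  last : t N = b

/-- The class `C^{1,p}([a,b] × ℝ; V)`: `f1` is the partial derivative of `f` in the first
variable, existing on `(a,b) × ℝ` and extending continuously to `[a,b] × ℝ`, and `f2 k` is
the `k`-th partial derivative of `f` in the second variable, with `f2 p` continuous. -/
structure C1p (a b : ℝ) (p : ℕ) (V : Type*) [NormedAddCommGroup V] [NormedSpace ℝ V] where
  f : ℝ → ℝ → V
  f1 : ℝ → ℝ → V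
  f2 : ℕ → ℝ → ℝ → V
  f2_zero : f2 0 = f
  hf1 : ∀ t ∈ Set.Ioo a b, ∀ x : ℝ, HasDerivAt (fun s => f s x) (f1 t x) t
  hf1c : ContinuousOn (fun q : ℝ × ℝ => f1 q.1 q.2) (Set.Icc a b ×ˢ (Set.univ : Set ℝ))
  hf2 : ∀ k, k < p → ∀ t ∈ Set.Icc a b, ∀ x : ℝ,
    HasDerivAt (fun y => f2 k t y) (f2 (k + 1) t x) x
  hf2c : ContinuousOn (fun q : ℝ × ℝ => f2 p q.1 q.2) (Set.Icc a b ×ˢ (Set.univ : Set ℝ))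

/-- The domain of the `p`-th power of the operator `B` (with domain `domB`),
defined iteratively. -/
def iterDom {V : Type*} (B : V → V) (domB : Set V) (p : ℕ) : Set V :=
  {x | ∀ j, j < p → B^[j] x ∈ domB}

open MeasureTheory Filter Set Topology

/-- Truncation of a real number to `[a, b]`. -/
def ktClamp (a b t : ℝ) : ℝ := max a (min b t)

theorem ktClamp_cont (a b : ℝ) : Continuous (ktClamp a b) := by
  unfold ktClamp; fun_prop

theorem ktClamp_mem {a b : ℝ} (h : a ≤ b) (t : ℝ) : ktClamp a b t ∈ Icc a b :=
  ⟨le_max_left _ _, max_le h (min_le_left _ _)⟩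

theorem ktClamp_eq {a b t : ℝ} (h : t ∈ Icc a b) : ktClamp a b t = t := by
  unfold ktClamp; rw [min_eq_right h.2, max_eq_right h.1]

section basics

set_option linter.unusedSectionVars false
set_option linter.unusedVariables false

variable {V : Type*} [NormedAddCommGroup V] [InnerProductSpace ℝ V]

/-- A strongly continuous bounded family applied to a continuous function. -/
theorem kt_strong_apply {W : Type*} [NormedAddCommGroup W] [NormedSpace ℝ W]
    {V : Type*} [NormedAddCommGroup V] [NormedSpace ℝ V]
    {α : Type*} [TopologicalSpace α]
    (P : α → W →L[ℝ] V) (M : ℝ) (hM : ∀ t v, ‖P t v‖ ≤ M * ‖v‖)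
    (hc : ∀ v, Continuous fun t => P t v) {f : α → W} (hf : Continuous f) :
    Continuous fun t => P t (f t) := by
  rw [continuous_iff_continuousAt]
  intro t₀
  have h1 : Tendsto (fun t => P t (f t₀)) (𝓝 t₀) (𝓝 (P t₀ (f t₀))) := (hc (f t₀)).tendsto t₀
  have h2 : Tendsto (fun t => P t (f t - f t₀)) (𝓝 t₀) (𝓝 0) := by
    refine squeeze_zero_norm (fun t => hM t _) ?_
    have : Tendsto (fun t => M * ‖f t - f t₀‖) (𝓝 t₀) (𝓝 (M * ‖f t₀ - f t₀‖)) :=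
      (((hf.tendsto t₀).sub_const _).norm).const_mul M
    simpa using this
  have h3 := h1.add h2
  simp only [add_zero, map_sub, add_sub_cancel] at h3
  exact h3

theorem kt_gronwall {s T c : ℝ} (hc : 0 ≤ c) {φ φ' ψ : ℝ → ℝ}
    (hφ : ∀ t ∈ Icc s T, HasDerivAt φ (φ' t) t) (hψ : Continuous ψ) (hψ0 : ∀ t, 0 ≤ ψ t)
    (hle : ∀ t ∈ Icc s T, φ' t ≤ c * φ t + ψ t) {t : ℝ} (ht : t ∈ Icc s T) :
    φ t ≤ Real.exp (c * (t - s)) * (φ s + ∫ r in s..t, ψ r) := by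
  let h : ℝ → ℝ := fun t => Real.exp (-(c * (t - s))) * φ t - ∫ r in s..t, ψ r
  have hexp : ∀ t, HasDerivAt (fun t => Real.exp (-(c * (t - s))))
      (Real.exp (-(c * (t - s))) * (-c)) t := by
    intro t
    have h0 : HasDerivAt (fun t : ℝ => -(c * (t - s))) (-c) t := by
      have := ((hasDerivAt_id t).sub_const s).const_mul (-c)
      simpa using this
    exact h0.exp
  have hIntg : ∀ t, HasDerivAt (fun t => ∫ r in s..t, ψ r) (ψ t) t := fun t =>
    intervalIntegral.integral_hasDerivAt_right (hψ.intervalIntegrable _ _)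
      (hψ.stronglyMeasurableAtFilter _ _) hψ.continuousAt
  have hh : ∀ t ∈ Icc s T, HasDerivAt h
      (Real.exp (-(c * (t - s))) * (-c) * φ t + Real.exp (-(c * (t - s))) * φ' t - ψ t) t :=
    fun t ht => ((hexp t).mul (hφ t ht)).sub (hIntg t)
  have hanti : AntitoneOn h (Icc s T) := by
    refine antitoneOn_of_deriv_nonpos (convex_Icc s T)
      (fun t ht => (hh t ht).continuousAt.continuousWithinAt) ?_ ?_
    · intro t ht
      exact (hh t (interior_subset ht)).differentiableAt.differentiableWithinAt
    · intro t ht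
      have ht := interior_subset ht
      rw [(hh t ht).deriv]
      have e1 : Real.exp (-(c * (t - s))) ≤ 1 := by
        rw [Real.exp_le_one_iff]
        have := mul_nonneg hc (sub_nonneg.2 ht.1)
        linarith
      have e0 := Real.exp_pos (-(c * (t - s)))
      have h1 := hle t ht
      have h2 := mul_le_mul_of_nonneg_left h1 e0.le
      have h3 := mul_le_mul_of_nonneg_right e1 (hψ0 t)
      nlinarith
  have h1 := hanti (left_mem_Icc.2 (ht.1.trans ht.2)) ht ht.1
  simp only [h, sub_self, mul_zero, neg_zero, Real.exp_zero, one_mul,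
    intervalIntegral.integral_same, sub_zero] at h1
  have h2 : Real.exp (-(c * (t - s))) * φ t ≤ φ s + ∫ r in s..t, ψ r := by linarith
  have h3 := mul_le_mul_of_nonneg_left h2 (Real.exp_pos (c * (t - s))).le
  rwa [← mul_assoc, ← Real.exp_add, add_neg_cancel, Real.exp_zero, one_mul] at h3

/-- Energy estimate. -/
theorem kt_energy {s T β : ℝ} (hβ : 0 ≤ β) {P : ℝ → V →L[ℝ] V}
    (hP : ∀ t x, inner ℝ (P t x) x ≤ β * ‖x‖ ^ 2) {v f : ℝ → V} (hf : Continuous f)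
    (hv : ∀ t ∈ Icc s T, HasDerivAt v (P t (v t) + f t) t) {t : ℝ} (ht : t ∈ Icc s T) :
    ‖v t‖ ^ 2 ≤ Real.exp ((2 * β + 1) * (T - s)) * (‖v s‖ ^ 2 + ∫ r in s..t, ‖f r‖ ^ 2) := by
  have hd : ∀ t ∈ Icc s T, HasDerivAt (fun t => ‖v t‖ ^ 2)
      (2 * inner ℝ (v t) (P t (v t) + f t)) t := fun t ht => (hv t ht).norm_sq
  have h1 := kt_gronwall (c := 2 * β + 1) (by linarith) hd
    (ψ := fun r => ‖f r‖ ^ 2) (by fun_prop) (fun _ => by positivity) (fun t ht => by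
      rw [inner_add_right, real_inner_comm]
      have a1 := hP t (v t)
      have a2 := real_inner_le_norm (v t) (f t)
      nlinarith [sq_nonneg (‖v t‖ - ‖f t‖)]) ht
  refine h1.trans ?_
  have h2 : 0 ≤ ∫ r in s..t, ‖f r‖ ^ 2 :=
    intervalIntegral.integral_nonneg ht.1 (fun _ _ => by positivity)
  have h3 : Real.exp ((2 * β + 1) * (t - s)) ≤ Real.exp ((2 * β + 1) * (T - s)) := by
    apply Real.exp_le_exp.2
    have := ht.2
    nlinarith
  exact mul_le_mul_of_nonneg_right h3 (by positivity)

variable [CompleteSpace V]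

/-- Uniformly Cauchy sequences of continuous functions have a continuous limit. -/
theorem kt_unif_limit {s T : ℝ} (hsT : s ≤ T) (f : ℕ → ℝ → V) (hf : ∀ n, Continuous (f n))
    (hC : ∀ ε > 0, ∃ N, ∀ n ≥ N, ∀ m ≥ N, ∀ t ∈ Icc s T, ‖f n t - f m t‖ ≤ ε) :
    ∃ g : ℝ → V, Continuous g ∧
      ∀ ε > 0, ∃ N, ∀ n ≥ N, ∀ t ∈ Icc s T, ‖f n t - g t‖ ≤ ε := by
  have hc : ∀ t, CauchySeq (fun n => f n (ktClamp s T t)) := by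
    intro t
    rw [Metric.cauchySeq_iff]
    intro ε hε
    obtain ⟨N, hN⟩ := hC (ε / 2) (by positivity)
    refine ⟨N, fun m hm n hn => ?_⟩
    rw [dist_eq_norm]
    have := hN m hm n hn _ (ktClamp_mem hsT t)
    linarith
  choose g hg using fun t => cauchySeq_tendsto_of_complete (hc t)
  have key : ∀ ε > 0, ∃ N, ∀ n ≥ N, ∀ t, ‖f n (ktClamp s T t) - g t‖ ≤ ε := by
    intro ε hε
    obtain ⟨N, hN⟩ := hC ε hε
    refine ⟨N, fun n hn t => ?_⟩
    have h1 : Tendsto (fun m => ‖f n (ktClamp s T t) - f m (ktClamp s T t)‖) atTop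
        (𝓝 ‖f n (ktClamp s T t) - g t‖) := (tendsto_const_nhds.sub (hg t)).norm
    refine le_of_tendsto h1 ?_
    filter_upwards [eventually_ge_atTop N] with m hm
    exact hN n hn m hm _ (ktClamp_mem hsT t)
  refine ⟨g, ?_, ?_⟩
  · have hu : TendstoUniformly (fun n t => f n (ktClamp s T t)) g atTop := by
      rw [Metric.tendstoUniformly_iff]
      intro ε hε
      obtain ⟨N, hN⟩ := key (ε / 2) (by positivity)
      filter_upwards [eventually_ge_atTop N] with n hn t
      rw [dist_comm, dist_eq_norm]
      have := hN n hn t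
      linarith
    exact hu.continuous (Frequently.of_forall fun n => (hf n).comp (ktClamp_cont s T))
  · intro ε hε
    obtain ⟨N, hN⟩ := key ε hε
    refine ⟨N, fun n hn t ht => ?_⟩
    have := hN n hn t
    rwa [ktClamp_eq ht] at this

/-- Volterra fixed points. -/
theorem kt_volterra {s T M : ℝ} (hsT : s ≤ T) (hM : 0 < M) (Φ : (ℝ → V) → ℝ → V)
    (hΦc : ∀ f, Continuous f → Continuous (Φ f))
    (hΦ : ∀ f g, Continuous f → Continuous g → ∀ t ∈ Icc s T,
      ‖Φ f t - Φ g t‖ ^ 2 ≤ M * ∫ r in s..t, ‖f r - g r‖ ^ 2) :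
    ∃ f : ℝ → V, Continuous f ∧ ∀ t ∈ Icc s T, Φ f t = f t := by
  let f : ℕ → ℝ → V := fun k => Φ^[k] 0
  have hfs : ∀ k, f (k + 1) = Φ (f k) := fun k => Function.iterate_succ_apply' Φ k 0
  have hfc : ∀ k, Continuous (f k) := by
    intro k
    induction k with
    | zero => exact continuous_zero
    | succ k ih => rw [hfs]; exact hΦc _ ih
  obtain ⟨D, hD⟩ : ∃ D, ∀ t ∈ Icc s T, ‖f 1 t - f 0 t‖ ^ 2 ≤ D := by
    obtain ⟨D, hD⟩ := (isCompact_Icc (a := s) (b := T)).bddAbove_image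
      (f := fun t => ‖f 1 t - f 0 t‖ ^ 2)
      (by have := hfc 1; have := hfc 0; fun_prop)
    exact ⟨D, fun t ht => hD (mem_image_of_mem _ ht)⟩
  have hD0 : 0 ≤ D := le_trans (by positivity) (hD s (left_mem_Icc.2 hsT))
  have hstep : ∀ k, ∀ t ∈ Icc s T,
      ‖f (k + 1) t - f k t‖ ^ 2 ≤ D * (1 / 4) ^ k * Real.exp (4 * M * (t - s)) := by
    intro k
    induction k with
    | zero =>
      intro t ht
      have e1 : 1 ≤ Real.exp (4 * M * (t - s)) :=
        Real.one_le_exp (mul_nonneg (by linarith) (sub_nonneg.2 ht.1))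
      have := hD t ht
      simp only [pow_zero, mul_one, zero_add]
      nlinarith
    | succ k ih =>
      intro t ht
      rw [hfs (k + 1)]
      nth_rewrite 2 [hfs k]
      refine (hΦ _ _ (hfc _) (hfc _) t ht).trans ?_
      have hexp : ∀ r, HasDerivAt (fun r => D * (1 / 4) ^ k / (4 * M) * Real.exp (4 * M * (r - s)))
          (D * (1 / 4) ^ k * Real.exp (4 * M * (r - s))) r := by
        intro r
        have h0 : HasDerivAt (fun t : ℝ => (4 * M * (t - s))) (4 * M) r := by
          simpa using (((hasDerivAt_id r).sub_const s).const_mul (4 * M))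
        have := (h0.exp).const_mul (D * (1 / 4) ^ k / (4 * M))
        refine this.congr_deriv ?_
        field_simp
      have hci : Continuous fun r => D * (1 / 4) ^ k * Real.exp (4 * M * (r - s)) := by fun_prop
      have h1 : ∫ r in s..t, ‖f (k + 1) r - f k r‖ ^ 2 ≤
          ∫ r in s..t, D * (1 / 4) ^ k * Real.exp (4 * M * (r - s)) := by
        refine intervalIntegral.integral_mono_on ht.1 ?_ (hci.intervalIntegrable _ _) ?_
        · have := hfc (k + 1)
          have := hfc k
          exact Continuous.intervalIntegrable (by fun_prop) _ _
        · intro r hr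
          exact ih r ⟨hr.1, hr.2.trans ht.2⟩
      rw [intervalIntegral.integral_eq_sub_of_hasDerivAt (fun r _ => hexp r)
        (hci.intervalIntegrable _ _)] at h1
      have h2 := mul_le_mul_of_nonneg_left h1 hM.le
      refine h2.trans ?_
      have h3 : 0 ≤ D * (1 / 4) ^ k := by positivity
      rw [sub_self, mul_zero, Real.exp_zero, pow_succ]
      have : M * (D * (1 / 4) ^ k / (4 * M) * Real.exp (4 * M * (t - s)) -
        D * (1 / 4) ^ k / (4 * M) * 1) = D * (1 / 4) ^ k * (1 / 4) * Real.exp (4 * M * (t - s)) -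
          D * (1 / 4) ^ k * (1 / 4) := by
        field_simp
      rw [this]
      nlinarith
  set C := Real.sqrt (D * Real.exp (4 * M * (T - s))) with hCdef
  have hstep' : ∀ k, ∀ t ∈ Icc s T, dist (f k t) (f (k + 1) t) ≤ C * (1 / 2) ^ k := by
    intro k t ht
    rw [dist_comm, dist_eq_norm]
    apply le_of_sq_le_sq _ (by positivity)
    rw [mul_pow, hCdef, Real.sq_sqrt (by positivity), ← pow_mul, mul_comm k 2, pow_mul]
    refine (hstep k t ht).trans ?_
    have e : Real.exp (4 * M * (t - s)) ≤ Real.exp (4 * M * (T - s)) := by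
      apply Real.exp_le_exp.2
      have := ht.2
      nlinarith
    have h3 : 0 ≤ D * (1 / 4) ^ k := by positivity
    have := mul_le_mul_of_nonneg_left e h3
    norm_num at this ⊢
    nlinarith
  have hCt : Tendsto (fun k : ℕ => C * (1 / 2) ^ k / (1 - 1 / 2)) atTop (𝓝 0) := by
    have := ((tendsto_pow_atTop_nhds_zero_of_lt_one (r := (1 / 2 : ℝ))
      (by norm_num) (by norm_num)).const_mul C).div_const (1 - 1 / 2)
    simpa using this
  have hlim : ∃ g : ℝ → V, Continuous g ∧
      ∀ ε > 0, ∃ N, ∀ n ≥ N, ∀ t ∈ Icc s T, ‖f n t - g t‖ ≤ ε := by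
    apply kt_unif_limit hsT f hfc
    intro ε hε
    obtain ⟨N, hN⟩ := (Metric.tendsto_atTop.1 hCt) (ε / 2) (by positivity)
    refine ⟨N, fun n hn m hm t ht => ?_⟩
    obtain ⟨a, ha⟩ := cauchySeq_tendsto_of_complete (cauchySeq_of_le_geometric (1 / 2) C
      (by norm_num) (fun k => hstep' k t ht))
    have b1 := dist_le_of_le_geometric_of_tendsto (1 / 2) C (by norm_num)
      (fun k => hstep' k t ht) ha n
    have b2 := dist_le_of_le_geometric_of_tendsto (1 / 2) C (by norm_num)
      (fun k => hstep' k t ht) ha m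
    have c1 := (abs_lt.1 (by simpa only [Real.dist_eq, sub_zero] using hN n hn)).2
    have c2 := (abs_lt.1 (by simpa only [Real.dist_eq, sub_zero] using hN m hm)).2
    rw [← dist_eq_norm]
    have := dist_triangle_right (f n t) (f m t) a
    linarith
  obtain ⟨g, hgc, hg⟩ := hlim
  refine ⟨g, hgc, fun t ht => ?_⟩
  have hgt : Tendsto (fun n => f (n + 1) t) atTop (𝓝 (g t)) := by
    have : Tendsto (fun n => f n t) atTop (𝓝 (g t)) := by
      rw [Metric.tendsto_atTop]
      intro ε hε
      obtain ⟨N, hN⟩ := hg (ε / 2) (by positivity)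
      refine ⟨N, fun n hn => ?_⟩
      rw [dist_eq_norm]
      have := hN n hn t ht
      linarith
    exact (tendsto_add_atTop_iff_nat 1).2 this
  have hgt2 : Tendsto (fun n => f (n + 1) t) atTop (𝓝 (Φ g t)) := by
    rw [Metric.tendsto_atTop]
    intro ε hε
    have hK : 0 < M * (T - s) + 1 := by
      have := mul_nonneg hM.le (sub_nonneg.2 hsT)
      linarith
    obtain ⟨N, hN⟩ := hg (ε / 2 / (M * (T - s) + 1)) (by positivity)
    have hK1 : ε / 2 / (M * (T - s) + 1) ≤ ε / 2 := by
      apply div_le_self (by positivity)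
      have := mul_nonneg hM.le (sub_nonneg.2 hsT)
      linarith
    refine ⟨N, fun n hn => ?_⟩
    rw [dist_eq_norm, hfs]
    have h1 := hΦ (f n) g (hfc n) hgc t ht
    have h2 : ∫ r in s..t, ‖f n r - g r‖ ^ 2 ≤
        ∫ r in s..t, ε / 2 / (M * (T - s) + 1) * (ε / 2) := by
      refine intervalIntegral.integral_mono_on ht.1 ?_ (by simp) ?_
      · have := hfc n
        exact Continuous.intervalIntegrable (by fun_prop) _ _
      · intro r hr
        have h3 := hN n hn r ⟨hr.1, hr.2.trans ht.2⟩
        rw [pow_two]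
        exact mul_le_mul h3 (h3.trans hK1) (norm_nonneg _) (by positivity)
    rw [intervalIntegral.integral_const, smul_eq_mul] at h2
    have h4 : ‖Φ (f n) t - Φ g t‖ ^ 2 < ε ^ 2 := by
      refine lt_of_le_of_lt (h1.trans (mul_le_mul_of_nonneg_left h2 hM.le)) ?_
      have h5 : M * (t - s) ≤ M * (T - s) + 1 := by
        have := mul_le_mul_of_nonneg_left (sub_le_sub_right ht.2 s) hM.le
        linarith
      have h6 : M * ((t - s) * (ε / 2 / (M * (T - s) + 1) * (ε / 2))) ≤
          (M * (T - s) + 1) * (ε / 2 / (M * (T - s) + 1) * (ε / 2)) := by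
        rw [← mul_assoc]
        exact mul_le_mul_of_nonneg_right h5 (by positivity)
      have h7 : (M * (T - s) + 1) * (ε / 2 / (M * (T - s) + 1) * (ε / 2)) = ε ^ 2 / 4 := by
        field_simp; norm_num
      have : 0 < ε ^ 2 := by positivity
      linarith
    exact lt_of_pow_lt_pow_left₀ 2 hε.le h4
  exact tendsto_nhds_unique hgt2 hgt

/-- Linear ODEs with strongly continuous coefficients. -/
theorem kt_ode {s T M : ℝ} (hsT : s ≤ T) (hM : 0 ≤ M) (P : ℝ → V →L[ℝ] V)
    (hPM : ∀ t v, ‖P t v‖ ≤ M * ‖v‖) (hPc : ∀ v, Continuous fun t => P t v)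
    {b : ℝ → V} (hb : Continuous b) (z : V) :
    ∃ y : ℝ → V, Continuous y ∧ y s = z ∧
      ∀ t ∈ Icc s T, HasDerivAt y (P t (y t) + b t) t := by
  let Φ : (ℝ → V) → ℝ → V := fun f t => z + ∫ r in s..t, (P r (f r) + b r)
  have hcont : ∀ f, Continuous f → Continuous fun r => P r (f r) + b r := fun f hf =>
    (kt_strong_apply P M hPM hPc hf).add hb
  have hderiv : ∀ f, Continuous f → ∀ t, HasDerivAt (Φ f) (P t (f t) + b t) t := fun f hf t =>
    (intervalIntegral.integral_hasDerivAt_right ((hcont f hf).intervalIntegrable _ _)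
      ((hcont f hf).stronglyMeasurableAtFilter _ _) (hcont f hf).continuousAt).const_add z
  have hΦc : ∀ f, Continuous f → Continuous (Φ f) := fun f hf =>
    continuous_iff_continuousAt.2 fun t => (hderiv f hf t).continuousAt
  obtain ⟨f, hfc, hf⟩ := kt_volterra hsT (M := (T - s) * M ^ 2 + 1)
      (by have := sub_nonneg.2 hsT; positivity) Φ hΦc (by
    intro f g hf hg t ht
    have h0 : Φ f t - Φ g t = ∫ r in s..t, P r (f r - g r) := by
      simp only [Φ, add_sub_add_left_eq_sub]
      rw [← intervalIntegral.integral_sub ((hcont f hf).intervalIntegrable _ _)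
        ((hcont g hg).intervalIntegrable _ _)]
      congr 1; ext r; simp
    have hfg : Continuous fun r => f r - g r := hf.sub hg
    have h1 : ‖Φ f t - Φ g t‖ ≤ ∫ r in s..t, M * ‖f r - g r‖ := by
      rw [h0]
      refine (intervalIntegral.norm_integral_le_integral_norm ht.1).trans ?_
      refine intervalIntegral.integral_mono_on ht.1 ?_ ?_ (fun r _ => hPM r _)
      · exact (kt_strong_apply P M hPM hPc hfg).norm.intervalIntegrable _ _
      · exact Continuous.intervalIntegrable (by fun_prop) _ _
    set I := ∫ r in s..t, ‖f r - g r‖ with hI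
    set J := ∫ r in s..t, ‖f r - g r‖ ^ 2 with hJ
    have hJ0 : 0 ≤ J := intervalIntegral.integral_nonneg ht.1 (fun _ _ => by positivity)
    rw [intervalIntegral.integral_const_mul] at h1
    have hI0 : 0 ≤ I := intervalIntegral.integral_nonneg ht.1 (fun _ _ => by positivity)
    -- Cauchy-Schwarz
    have hCS : I ^ 2 ≤ (t - s) * J := by
      have hq : ∀ x : ℝ, 0 ≤ J - 2 * x * I + x ^ 2 * (t - s) := by
        intro x
        have : J - 2 * x * I + x ^ 2 * (t - s) = ∫ r in s..t, (‖f r - g r‖ - x) ^ 2 := by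
          have e : (fun r => (‖f r - g r‖ - x) ^ 2) =
              fun r => ‖f r - g r‖ ^ 2 - (2 * x) * ‖f r - g r‖ + x ^ 2 := by
            ext r; ring
          rw [e, intervalIntegral.integral_add, intervalIntegral.integral_sub,
            intervalIntegral.integral_const_mul, intervalIntegral.integral_const, smul_eq_mul]
          · ring
          all_goals exact Continuous.intervalIntegrable (by fun_prop) _ _
        rw [this]
        exact intervalIntegral.integral_nonneg ht.1 (fun _ _ => by positivity)
      rcases eq_or_lt_of_le ht.1 with h | h
      · have : I = 0 := by rw [hI, ← h]; simp
        rw [this, ← h]; simp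
      · have h' : 0 < t - s := sub_pos.2 h
        have := hq (I / (t - s))
        have e : J - 2 * (I / (t - s)) * I + (I / (t - s)) ^ 2 * (t - s) = J - I ^ 2 / (t - s) := by
          field_simp; ring
        rw [e, sub_nonneg, div_le_iff₀ h'] at this
        linarith
    have h2 : ‖Φ f t - Φ g t‖ ^ 2 ≤ (M * I) ^ 2 := by
      exact pow_le_pow_left₀ (norm_nonneg _) h1 2
    have h3 : (t - s) * J ≤ (T - s) * J := mul_le_mul_of_nonneg_right (by linarith [ht.2]) hJ0
    have h4 := mul_le_mul_of_nonneg_left (hCS.trans h3) (sq_nonneg M)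
    nlinarith)
  refine ⟨Φ f, hΦc f hfc, by simp [Φ], fun t ht => ?_⟩
  have := hderiv f hfc t
  rwa [← hf t ht] at this

end basics

open MeasureTheory Filter Set Topology

/-- The data for the abstract hyperbolic evolution problem, expressed with resolvents. -/
structure KatoData (V : Type*) [NormedAddCommGroup V] [InnerProductSpace ℝ V] where
  j : V →L[ℝ] V
  R : ℕ → ℝ → V →L[ℝ] V
  L : ℝ → V →L[ℝ] V
  H : ℝ → V →L[ℝ] V
  lam : ℕ → ℝ
  β : ℝ
  M : ℝ
  hβ : 0 ≤ β
  hM : 0 ≤ M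
  hlam : ∀ n, 2 * (β + M) + 1 ≤ lam n
  hlamT : Tendsto lam atTop atTop
  hj : DenseRange j
  hR : ∀ n t v, (lam n - β) * ‖R n t v‖ ≤ ‖v‖
  hL : ∀ t v, ‖L t v‖ ≤ M * ‖v‖
  hH : ∀ t v, ‖H t v‖ ≤ M * ‖v‖
  hRc : ∀ n v, Continuous fun t => R n t v
  hLc : ∀ v, Continuous fun t => L t v
  hHc : ∀ v, Continuous fun t => H t v
  hRj : ∀ n t a, R n t (j (a - L t (R n t a))) = j (R n t a)
  hRH : ∀ n t v, lam n • R n t (j v) - j v = R n t (H t v)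
  hdiss : ∀ n m t a b, inner ℝ ((lam n • R n t a - a) - (lam m • R m t b - b))
    (R n t a - R m t b) ≤ β * ‖R n t a - R m t b‖ ^ 2

theorem kt_yosida_diss {V : Type*} [NormedAddCommGroup V] [InnerProductSpace ℝ V]
    {γ l : ℝ} (hγ : 0 ≤ γ) (hl : 2 * γ ≤ l) {w v : V} (h : (l - γ) * ‖w‖ ≤ ‖v‖) :
    inner ℝ (l • (l • w - v)) v ≤ 2 * γ * ‖v‖ ^ 2 := by
  have h1 : inner ℝ (l • (l • w - v)) v = l * (l * inner ℝ w v - ‖v‖ ^ 2) := by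
    rw [real_inner_smul_left, inner_sub_left, real_inner_smul_left, real_inner_self_eq_norm_sq]
  rw [h1]
  have h2 := real_inner_le_norm w v
  have hl0 : 0 ≤ l := by linarith
  have h3 : l * ‖w‖ ≤ 2 * ‖v‖ := by nlinarith [norm_nonneg w]
  have h4 : l * (l * inner ℝ w v - ‖v‖ ^ 2) ≤ l * (l * (‖w‖ * ‖v‖) - ‖v‖ ^ 2) := by gcongr
  have h5 : l * ‖w‖ - ‖v‖ ≤ γ * ‖w‖ := by linarith
  have h6 : l * (l * ‖w‖ - ‖v‖) ≤ l * (γ * ‖w‖) := by gcongr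
  have h7 : γ * (l * ‖w‖) ≤ γ * (2 * ‖v‖) := by gcongr
  have h8 : l * (l * ‖w‖ - ‖v‖) ≤ 2 * γ * ‖v‖ := by linarith
  have h9 := mul_le_mul_of_nonneg_right h8 (norm_nonneg v)
  nlinarith

namespace KatoData

set_option linter.unusedSectionVars false

variable {V : Type*} [NormedAddCommGroup V] [InnerProductSpace ℝ V] (D : KatoData V)

theorem lam_pos (n : ℕ) : 0 < D.lam n := by
  have := D.hlam n; have := D.hβ; have := D.hM; linarith

theorem R_le (n t v) : D.lam n * ‖D.R n t v‖ ≤ 2 * ‖v‖ := by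
  have h1 := D.hlam n
  have h2 := D.hβ
  have h3 := D.hM
  have h4 := D.hR n t v
  nlinarith [norm_nonneg (D.R n t v)]

theorem R_bound (n t v) : ‖D.R n t v‖ ≤ 2 / D.lam n * ‖v‖ := by
  rw [div_mul_eq_mul_div, le_div_iff₀ (D.lam_pos n), mul_comm]
  exact D.R_le n t v

/-- Yosida approximation. -/
noncomputable def K (n : ℕ) (t : ℝ) : V →L[ℝ] V :=
  D.lam n • (D.lam n • D.R n t - ContinuousLinearMap.id ℝ V)

theorem K_apply (n t v) : D.K n t v = D.lam n • (D.lam n • D.R n t v - v) := rfl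

/-- The perturbation product. -/
noncomputable def N (n : ℕ) (t : ℝ) : V →L[ℝ] V := (D.L t).comp (D.R n t)

theorem N_apply (n t v) : D.N n t v = D.L t (D.R n t v) := rfl

theorem N_le (n t v) : ‖D.N n t v‖ ≤ 1 / 2 * ‖v‖ := by
  rw [N_apply]
  have h0 := D.hL t (D.R n t v)
  have h1 := D.hlam n
  have h2 := D.hβ
  have h3 := D.hM
  have h4 := D.hR n t v
  nlinarith [norm_nonneg (D.R n t v)]

theorem N_norm (n t) : ‖D.N n t‖ < 1 := by
  have : ‖D.N n t‖ ≤ 1 / 2 := ContinuousLinearMap.opNorm_le_bound _ (by norm_num) (D.N_le n t)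
  linarith

theorem hasc_N (n v) : Continuous fun t => D.N n t v :=
  kt_strong_apply D.L D.M D.hL D.hLc (D.hRc n v)

variable [CompleteSpace V]

/-- The inverse of `1 - N`. -/
noncomputable def S (n : ℕ) (t : ℝ) : V →L[ℝ] V := Ring.inverse (1 - D.N n t)

theorem S_right (n t v) : D.S n t v = v + D.N n t (D.S n t v) := by
  have h := Ring.mul_inverse_cancel _ (isUnit_one_sub_of_norm_lt_one (D.N_norm n t))
  have h1 := congrArg (fun f : V →L[ℝ] V => f v) h
  change (D.S n t v - D.N n t (D.S n t v)) = v at h1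
  exact sub_eq_iff_eq_add.1 h1

theorem S_left (n t v) : D.S n t (v - D.N n t v) = v := by
  have h := Ring.inverse_mul_cancel _ (isUnit_one_sub_of_norm_lt_one (D.N_norm n t))
  exact congrArg (fun f : V →L[ℝ] V => f v) h

theorem S_le (n t v) : ‖D.S n t v‖ ≤ 2 * ‖v‖ := by
  have h1 := congrArg norm (D.S_right n t v)
  have h2 := norm_add_le v (D.N n t (D.S n t v))
  have h3 := D.N_le n t (D.S n t v)
  linarith

theorem hasc_S (n v) : Continuous fun t => D.S n t v := by
  rw [continuous_iff_continuousAt]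
  intro t₀
  have h1 : ∀ t, D.S n t v - D.S n t₀ v =
      D.S n t (D.N n t (D.S n t₀ v) - D.N n t₀ (D.S n t₀ v)) := by
    intro t
    have a1 := D.S_left n t (D.S n t₀ v)
    have a2 := D.S_right n t₀ v
    have a3 : D.N n t₀ (D.S n t₀ v) = D.S n t₀ v - v := by
      rw [eq_sub_iff_add_eq, add_comm]; exact a2.symm
    rw [a3]
    rw [map_sub] at a1 ⊢
    rw [map_sub, ← sub_eq_zero]
    rw [← sub_eq_zero] at a1
    rw [← a1]
    abel
  have h2 : Tendsto (fun t => D.S n t v - D.S n t₀ v) (𝓝 t₀) (𝓝 0) := by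
    refine squeeze_zero_norm (fun t => ?_)
      (a := fun t => 2 * ‖D.N n t (D.S n t₀ v) - D.N n t₀ (D.S n t₀ v)‖) ?_
    · rw [h1]; exact D.S_le n t _
    · have := ((((D.hasc_N n (D.S n t₀ v)).tendsto t₀).sub_const
        (D.N n t₀ (D.S n t₀ v))).norm).const_mul 2
      simpa using this
  exact tendsto_sub_nhds_zero_iff.1 h2

theorem RS_le' (n t v) : (D.lam n - (D.β + D.M)) * ‖D.R n t (D.S n t v)‖ ≤ ‖v‖ := by
  have h1 := D.hR n t (D.S n t v)
  have h2 := congrArg norm (D.S_right n t v)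
  have h3 := norm_add_le v (D.N n t (D.S n t v))
  have h4 := D.hL t (D.R n t (D.S n t v))
  rw [N_apply] at h3 h2
  nlinarith

theorem RS_le (n t v) : D.lam n * ‖D.R n t (D.S n t v)‖ ≤ 2 * ‖v‖ := by
  have h1 := D.hlam n
  have h2 := D.hβ
  have h3 := D.hM
  have h4 := D.RS_le' n t v
  nlinarith [norm_nonneg (D.R n t (D.S n t v))]

theorem hasc_RS (n v) : Continuous fun t => D.R n t (D.S n t v) :=
  kt_strong_apply (D.R n) _ (D.R_bound n) (D.hRc n) (D.hasc_S n v)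

/-- Yosida approximation of the perturbed operator. -/
noncomputable def KL (n : ℕ) (t : ℝ) : V →L[ℝ] V :=
  D.lam n • (D.lam n • (D.R n t).comp (D.S n t) - ContinuousLinearMap.id ℝ V)

theorem KL_apply (n t v) : D.KL n t v = D.lam n • (D.lam n • D.R n t (D.S n t v) - v) := rfl

/-- The approximate perturbation. -/
noncomputable def Ln (n : ℕ) (t : ℝ) : V →L[ℝ] V :=
  (D.lam n • D.R n t).comp ((D.L t).comp (D.lam n • (D.R n t).comp (D.S n t)))

theorem Ln_apply (n t v) :
    D.Ln n t v = D.lam n • D.R n t (D.L t (D.lam n • D.R n t (D.S n t v))) := rfl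

theorem KL_eq (n t v) : D.KL n t v = D.K n t v + D.Ln n t v := by
  rw [KL_apply, K_apply, Ln_apply]
  have h := D.S_right n t v
  rw [N_apply] at h
  nth_rewrite 1 [h]
  simp only [map_add, map_smul, smul_sub, smul_add]
  abel

theorem K_le (n t v) : ‖D.K n t v‖ ≤ (3 * D.lam n) * ‖v‖ := by
  rw [K_apply, norm_smul, Real.norm_of_nonneg (D.lam_pos n).le]
  have h1 := norm_sub_le (D.lam n • D.R n t v) v
  rw [norm_smul, Real.norm_of_nonneg (D.lam_pos n).le] at h1
  have h2 := D.R_le n t v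
  have := D.lam_pos n
  nlinarith

theorem KL_le (n t v) : ‖D.KL n t v‖ ≤ (3 * D.lam n) * ‖v‖ := by
  rw [KL_apply, norm_smul, Real.norm_of_nonneg (D.lam_pos n).le]
  have h1 := norm_sub_le (D.lam n • D.R n t (D.S n t v)) v
  rw [norm_smul, Real.norm_of_nonneg (D.lam_pos n).le] at h1
  have h2 := D.RS_le n t v
  have := D.lam_pos n
  nlinarith

theorem Ln_le (n t v) : ‖D.Ln n t v‖ ≤ (4 * D.M) * ‖v‖ := by
  rw [Ln_apply, norm_smul, Real.norm_of_nonneg (D.lam_pos n).le]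
  have h1 := D.R_le n t (D.L t (D.lam n • D.R n t (D.S n t v)))
  have h2 := D.hL t (D.lam n • D.R n t (D.S n t v))
  rw [norm_smul, Real.norm_of_nonneg (D.lam_pos n).le] at h2
  have h3 := mul_le_mul_of_nonneg_left (D.RS_le n t v) D.hM
  nlinarith

theorem hasc_K (n v) : Continuous fun t => D.K n t v := by
  simp only [K_apply]
  have := D.hRc n v
  fun_prop

theorem hasc_KL (n v) : Continuous fun t => D.KL n t v := by
  simp only [KL_apply]
  have := D.hasc_RS n v
  fun_prop

theorem hasc_Ln (n v) : Continuous fun t => D.Ln n t v := by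
  have : (fun t => D.Ln n t v) = fun t => D.KL n t v - D.K n t v := by
    ext t; rw [KL_eq]; abel
  rw [this]
  exact (D.hasc_KL n v).sub (D.hasc_K n v)

theorem K_diss (n t v) : inner ℝ (D.K n t v) v ≤ (2 * D.β) * ‖v‖ ^ 2 := by
  rw [K_apply]
  have := D.hlam n; have := D.hM; have := D.hβ
  exact kt_yosida_diss D.hβ (by linarith) (D.hR n t v)

theorem KL_diss (n t v) : inner ℝ (D.KL n t v) v ≤ (2 * (D.β + D.M)) * ‖v‖ ^ 2 := by
  rw [KL_apply]
  have := D.hlam n; have := D.hM; have := D.hβ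
  exact kt_yosida_diss (by linarith) (by linarith) (D.RS_le' n t v)

theorem j_KL (n t v) : D.j (D.KL n t v) = D.K n t (D.j v) := by
  rw [KL_apply, K_apply]
  have h := D.hRj n t (D.S n t v)
  have h2 : D.S n t v - D.L t (D.R n t (D.S n t v)) = v := by
    have := D.S_right n t v
    rw [N_apply] at this
    exact sub_eq_iff_eq_add.2 this
  rw [h2] at h
  rw [map_smul, map_sub, map_smul, h]

theorem K_j (n t v) : D.K n t (D.j v) = D.lam n • D.R n t (D.H t v) := by
  rw [K_apply, D.hRH]

theorem K_j_le (n t v) : ‖D.K n t (D.j v)‖ ≤ 2 * D.M * ‖v‖ := by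
  rw [K_j, norm_smul, Real.norm_of_nonneg (D.lam_pos n).le]
  have h1 := D.R_le n t (D.H t v)
  have h2 := D.hH t v
  linarith

theorem inv_lam : Tendsto (fun n => (D.lam n)⁻¹) atTop (𝓝 0) :=
  tendsto_inv_atTop_zero.comp D.hlamT

theorem J_tendsto (t v) : Tendsto (fun n => D.lam n • D.R n t v) atTop (𝓝 v) := by
  rw [Metric.tendsto_atTop]
  intro ε hε
  obtain ⟨a, ha⟩ := D.hj.exists_dist_lt v (ε := ε / 6) (by positivity)
  rw [dist_eq_norm] at ha
  have h1 : Tendsto (fun n => (D.lam n)⁻¹ * (2 * (D.M * ‖a‖))) atTop (𝓝 0) := by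
    simpa using D.inv_lam.mul_const (2 * (D.M * ‖a‖))
  obtain ⟨N, hN⟩ := eventually_atTop.1 (h1.eventually_lt_const (half_pos hε))
  refine ⟨N, fun n hn => ?_⟩
  have h2 := hN n hn
  have e : D.lam n • D.R n t v - v = D.lam n • D.R n t (v - D.j a) - (v - D.j a)
      + D.R n t (D.H t a) := by
    rw [← D.hRH, map_sub, smul_sub]; abel
  rw [dist_eq_norm, e]
  have h3 := norm_add_le (D.lam n • D.R n t (v - D.j a) - (v - D.j a)) (D.R n t (D.H t a))
  have h4 := norm_sub_le (D.lam n • D.R n t (v - D.j a)) (v - D.j a)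
  rw [norm_smul, Real.norm_of_nonneg (D.lam_pos n).le] at h4
  have h5 := D.R_le n t (v - D.j a)
  have h6 : ‖D.R n t (D.H t a)‖ ≤ (D.lam n)⁻¹ * (2 * (D.M * ‖a‖)) := by
    rw [inv_mul_eq_div, le_div_iff₀ (D.lam_pos n), mul_comm]
    have := D.R_le n t (D.H t a)
    have := D.hH t a
    linarith
  linarith

/-- If `x n → x` then `J n (x n) → x`. -/
theorem J_tendsto' (t) {x : ℕ → V} {v : V} (hx : Tendsto x atTop (𝓝 v)) :
    Tendsto (fun n => D.lam n • D.R n t (x n)) atTop (𝓝 v) := by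
  have h1 : Tendsto (fun n => D.lam n • D.R n t (x n - v)) atTop (𝓝 0) := by
    refine squeeze_zero_norm (fun n => ?_) (a := fun n => 2 * ‖x n - v‖) ?_
    · rw [norm_smul, Real.norm_of_nonneg (D.lam_pos n).le]
      exact D.R_le n t _
    · have := ((hx.sub_const v).norm).const_mul 2
      simpa using this
  have h2 := h1.add (D.J_tendsto t v)
  simpa [smul_sub] using h2

theorem Ln_tendsto (t v) : Tendsto (fun n => D.Ln n t v) atTop (𝓝 (D.L t v)) := by
  simp only [Ln_apply]
  refine D.J_tendsto' t (((D.L t).continuous.tendsto v).comp (D.J_tendsto' t ?_))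
  have h1 : Tendsto (fun n => D.S n t v - v) atTop (𝓝 0) := by
    refine squeeze_zero_norm (fun n => ?_) (a := fun n => (D.lam n)⁻¹ * (D.M * (2 * (2 * ‖v‖)))) ?_
    · have e : D.S n t v - v = D.N n t (D.S n t v) := by
        nth_rewrite 1 [D.S_right n t v]; abel
      rw [e, N_apply, inv_mul_eq_div, le_div_iff₀ (D.lam_pos n)]
      have h1 := D.hL t (D.R n t (D.S n t v))
      have h2 := D.R_le n t (D.S n t v)
      have h3 := D.S_le n t v
      have h4 : D.lam n * ‖D.R n t (D.S n t v)‖ ≤ 2 * (2 * ‖v‖) := by linarith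
      have h5 := mul_le_mul_of_nonneg_left h4 D.hM
      have h6 := mul_le_mul_of_nonneg_right h1 (D.lam_pos n).le
      linarith
    · simpa using D.inv_lam.mul_const (D.M * (2 * (2 * ‖v‖)))
  exact tendsto_sub_nhds_zero_iff.1 h1

theorem brezis (n m : ℕ) (t : ℝ) (v w : V) (c : ℝ)
    (hk : ‖D.K n t v‖ ≤ c) (hk' : ‖D.K m t w‖ ≤ c) :
    inner ℝ (v - w) (D.K n t v - D.K m t w) ≤ 2 * D.β * ‖v - w‖ ^ 2 +
      (2 * D.β * (c * ((D.lam n)⁻¹ + (D.lam m)⁻¹)) ^ 2 +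
        2 * c * (c * ((D.lam n)⁻¹ + (D.lam m)⁻¹))) := by
  have hn := D.lam_pos n
  have hm := D.lam_pos m
  set η := c * ((D.lam n)⁻¹ + (D.lam m)⁻¹) with hη
  set k := D.K n t v with hkd
  set k' := D.K m t w with hkd'
  set e := (D.lam n)⁻¹ • k - (D.lam m)⁻¹ • k' with he
  have hη0 : ‖e‖ ≤ η := by
    refine (norm_sub_le _ _).trans ?_
    rw [norm_smul, norm_smul, Real.norm_of_nonneg (by positivity),
      Real.norm_of_nonneg (by positivity), hη, mul_add, mul_comm c, mul_comm c]
    gcongr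
  have h1 := D.hdiss n m t (D.lam n • v) (D.lam m • w)
  have e1 : D.R n t (D.lam n • v) = v + (D.lam n)⁻¹ • k := by
    rw [hkd, K_apply, smul_smul, inv_mul_cancel₀ hn.ne', one_smul, map_smul]; abel
  have e2 : D.R m t (D.lam m • w) = w + (D.lam m)⁻¹ • k' := by
    rw [hkd', K_apply, smul_smul, inv_mul_cancel₀ hm.ne', one_smul, map_smul]; abel
  have e3 : D.lam n • D.R n t (D.lam n • v) - D.lam n • v = k := by
    rw [e1, smul_add, smul_smul, mul_inv_cancel₀ hn.ne', one_smul]; abel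
  have e4 : D.lam m • D.R m t (D.lam m • w) - D.lam m • w = k' := by
    rw [e2, smul_add, smul_smul, mul_inv_cancel₀ hm.ne', one_smul]; abel
  have e5 : (v + (D.lam n)⁻¹ • k) - (w + (D.lam m)⁻¹ • k') = (v - w) + e := by
    rw [he]; abel
  rw [e3, e4, e1, e2, e5] at h1
  have h2 : inner ℝ (v - w) (k - k') = inner ℝ (k - k') (v - w + e) - inner ℝ (k - k') e := by
    rw [inner_add_right, real_inner_comm]; ring
  have h3 : -inner ℝ (k - k') e ≤ ‖k - k'‖ * ‖e‖ := by
    have := abs_real_inner_le_norm (k - k') e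
    exact (neg_le_abs _).trans this
  have h4 : ‖k - k'‖ ≤ 2 * c := by
    have := norm_sub_le k k'; linarith
  have h5 : ‖k - k'‖ * ‖e‖ ≤ 2 * c * η :=
    mul_le_mul h4 hη0 (norm_nonneg _) ((norm_nonneg _).trans h4)
  have h6 : ‖v - w + e‖ ^ 2 ≤ 2 * ‖v - w‖ ^ 2 + 2 * η ^ 2 := by
    have a1 := norm_add_le (v - w) e
    have a2 : ‖v - w + e‖ ^ 2 ≤ (‖v - w‖ + η) ^ 2 :=
      pow_le_pow_left₀ (norm_nonneg _) (by linarith) 2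
    nlinarith [sq_nonneg (‖v - w‖ - η)]
  have h7 := mul_le_mul_of_nonneg_left h6 D.hβ
  linarith

end KatoData

open MeasureTheory Filter Set Topology

namespace KatoData

set_option linter.unusedSectionVars false

variable {V : Type*} [NormedAddCommGroup V] [InnerProductSpace ℝ V] [CompleteSpace V]
  (D : KatoData V)

/-- Approximation of continuous functions by functions with values in the range of `j`. -/
theorem approx_j {f : ℝ → V} (hf : Continuous f) {δ : ℝ} (hδ : 0 < δ) :
    ∃ b : ℝ → V, Continuous b ∧ ∀ r, ‖f r - D.j (b r)‖ ≤ δ := by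
  obtain ⟨g, hg⟩ := exists_continuous_forall_mem_convex_of_local_const
    (X := ℝ) (E := V) (t := fun r => {x | ‖f r - D.j x‖ ≤ δ}) (by
      intro r
      have h : {x | ‖f r - D.j x‖ ≤ δ} = D.j ⁻¹' (Metric.closedBall (f r) δ) := by
        ext x
        simp only [mem_ofPred_eq, mem_preimage, Metric.mem_closedBall, dist_eq_norm]
        rw [norm_sub_rev]
      rw [h]
      exact (convex_closedBall _ _).linear_preimage D.j.toLinearMap) (by
      intro r
      obtain ⟨a, ha⟩ := D.hj.exists_dist_lt (f r) hδ
      refine ⟨a, ?_⟩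
      rw [dist_eq_norm] at ha
      have : Continuous fun q => ‖f q - D.j a‖ := by fun_prop
      filter_upwards [this.continuousAt.eventually_lt_const ha] with q hq
      exact hq.le)
  exact ⟨g, g.continuous, hg⟩

theorem diff_est {s T : ℝ} {n : ℕ} {f g v w : ℝ → V} (hf : Continuous f) (hg : Continuous g)
    (hv : ∀ t ∈ Icc s T, HasDerivAt v (D.K n t (v t) + f t) t)
    (hw : ∀ t ∈ Icc s T, HasDerivAt w (D.K n t (w t) + g t) t) {t : ℝ} (ht : t ∈ Icc s T) :
    ‖v t - w t‖ ^ 2 ≤ Real.exp ((2 * (2 * D.β) + 1) * (T - s)) *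
      (‖v s - w s‖ ^ 2 + ∫ r in s..t, ‖f r - g r‖ ^ 2) := by
  have h := kt_energy (V := V) (s := s) (T := T) (β := 2 * D.β) (by have := D.hβ; linarith)
    (P := D.K n) (D.K_diss n) (v := fun t => v t - w t) (f := fun t => f t - g t)
    (hf.sub hg) (fun t ht => by
      refine ((hv t ht).sub (hw t ht)).congr_deriv ?_
      rw [map_sub]; abel) ht
  exact h

theorem cauchy_sol {s T : ℝ} (hsT : s ≤ T) (z : V) {f : ℝ → V} (hf : Continuous f)
    (v : ℕ → ℝ → V) (hv0 : ∀ n, v n s = z)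
    (hv : ∀ n, ∀ t ∈ Icc s T, HasDerivAt (v n) (D.K n t (v n t) + f t) t) :
    ∀ ε > 0, ∃ N, ∀ n ≥ N, ∀ m ≥ N, ∀ t ∈ Icc s T, ‖v n t - v m t‖ ≤ ε := by
  intro ε hε
  have hβ := D.hβ
  have hTs : 0 ≤ T - s := sub_nonneg.2 hsT
  set E1 := Real.exp ((2 * (2 * D.β) + 1) * (T - s)) with hE1
  have hE1' : 1 ≤ E1 := Real.one_le_exp (by positivity)
  set C := E1 * (1 + (T - s)) with hC
  have hC1 : 1 ≤ C := by nlinarith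
  have hC0 : 0 < C := by linarith
  set δ := ε / 3 / C with hδ
  have hδ0 : 0 < δ := by positivity
  have hCδ : C * δ ^ 2 ≤ (ε / 3) ^ 2 := by
    have : C * δ ^ 2 = (ε / 3) ^ 2 / C := by rw [hδ]; field_simp
    rw [this]
    exact div_le_self (by positivity) hC1
  obtain ⟨a, ha⟩ := D.hj.exists_dist_lt z hδ0
  rw [dist_eq_norm] at ha
  obtain ⟨b, hb, hfb⟩ := D.approx_j hf hδ0
  have hlam0 : ∀ n, 0 ≤ 3 * D.lam n := fun n => by have := D.lam_pos n; linarith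
  choose y hyc hy0 hy using fun n =>
    kt_ode hsT (hlam0 n) (D.KL n) (D.KL_le n) (D.hasc_KL n) hb a
  set Yb := Real.exp ((2 * (2 * (D.β + D.M)) + 1) * (T - s)) *
    (‖a‖ ^ 2 + ∫ r in s..T, ‖b r‖ ^ 2) with hYb
  have hybound : ∀ n, ∀ t ∈ Icc s T, ‖y n t‖ ≤ Real.sqrt Yb := by
    intro n t ht
    apply Real.le_sqrt_of_sq_le
    have h := kt_energy (V := V) (s := s) (T := T) (β := 2 * (D.β + D.M))
      (by have := D.hM; linarith) (P := D.KL n) (D.KL_diss n) hb (hy n) ht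
    refine h.trans ?_
    rw [hy0, hYb]
    have : ∫ r in s..t, ‖b r‖ ^ 2 ≤ ∫ r in s..T, ‖b r‖ ^ 2 :=
      intervalIntegral.integral_mono_interval le_rfl ht.1 ht.2
        (Eventually.of_forall fun _ => by positivity)
        (Continuous.intervalIntegrable (by fun_prop) _ _)
    gcongr
  set c := 2 * D.M * Real.sqrt Yb with hc
  have hM := D.hM
  have hc0 : 0 ≤ c := by positivity
  have hjy : ∀ n, ∀ t ∈ Icc s T,
      HasDerivAt (fun t => D.j (y n t)) (D.K n t (D.j (y n t)) + D.j (b t)) t := by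
    intro n t ht
    have := D.j.hasFDerivAt.comp_hasDerivAt t (hy n t ht)
    rw [map_add, D.j_KL] at this
    exact this
  have hk : ∀ n, ∀ t ∈ Icc s T, ‖D.K n t (D.j (y n t))‖ ≤ c := by
    intro n t ht
    refine (D.K_j_le n t _).trans ?_
    have := hybound n t ht
    rw [hc]; gcongr
  have hdiff1 : ∀ n, ∀ t ∈ Icc s T, ‖v n t - D.j (y n t)‖ ≤ ε / 3 := by
    intro n t ht
    apply le_of_sq_le_sq _ (by positivity)
    have hjb : Continuous fun t => D.j (b t) := D.j.continuous.comp hb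
    refine (D.diff_est hf hjb (hv n) (hjy n) ht).trans ?_
    refine le_trans ?_ hCδ
    rw [hv0, hy0, hC, mul_assoc, ← hE1]
    have h1 : ∫ r in s..t, ‖f r - D.j (b r)‖ ^ 2 ≤ ∫ r in s..t, δ ^ 2 := by
      refine intervalIntegral.integral_mono_on ht.1
        (Continuous.intervalIntegrable (by fun_prop) _ _) (by simp) ?_
      intro r hr
      have := hfb r
      gcongr
    rw [intervalIntegral.integral_const, smul_eq_mul] at h1
    have h2 : ‖z - D.j a‖ ^ 2 ≤ δ ^ 2 := by gcongr
    have h3 : (t - s) * δ ^ 2 ≤ (T - s) * δ ^ 2 := by have := ht.2; gcongr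
    have h4 : 0 ≤ E1 := by linarith
    apply mul_le_mul_of_nonneg_left _ h4
    linarith
  -- the Brezis estimate
  set η : ℕ × ℕ → ℝ := fun q => c * ((D.lam q.1)⁻¹ + (D.lam q.2)⁻¹) with hη
  set ρ : ℕ × ℕ → ℝ := fun q => 2 * (2 * D.β * η q ^ 2 + 2 * c * η q) with hρ
  have hη0 : ∀ q, 0 ≤ η q := fun q => by
    have := D.lam_pos q.1; have := D.lam_pos q.2
    simp only [hη]; positivity
  have hηt : Tendsto η atTop (𝓝 0) := by
    rw [← prod_atTop_atTop_eq]
    have := ((D.inv_lam.comp (tendsto_fst (f := (atTop : Filter ℕ)) (g := (atTop : Filter ℕ)))).add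
      (D.inv_lam.comp tendsto_snd)).const_mul c
    simpa using this
  have hρt : Tendsto (fun q => Real.exp (4 * D.β * (T - s)) * ((T - s) * ρ q)) atTop (𝓝 0) := by
    have := (((((hηt.pow 2).const_mul (2 * D.β)).add (hηt.const_mul (2 * c))).const_mul 2).const_mul
      (T - s)).const_mul (Real.exp (4 * D.β * (T - s)))
    simpa using this
  have hev := hρt.eventually_lt_const (show (0 : ℝ) < (ε / 3) ^ 2 by positivity)
  obtain ⟨N, hN⟩ := eventually_atTop_prod_self'.1 hev
  refine ⟨N, fun n hn m hm t ht => ?_⟩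
  have hdiff2 : ‖D.j (y n t) - D.j (y m t)‖ ≤ ε / 3 := by
    apply le_of_sq_le_sq _ (by positivity)
    refine le_trans ?_ (hN n hn m hm).le
    have hd : ∀ t ∈ Icc s T, HasDerivAt (fun t => ‖D.j (y n t) - D.j (y m t)‖ ^ 2)
        (2 * inner ℝ (D.j (y n t) - D.j (y m t))
          (D.K n t (D.j (y n t)) - D.K m t (D.j (y m t)))) t := by
      intro t ht
      have h0 : HasDerivAt (fun t => D.j (y n t) - D.j (y m t))
          (D.K n t (D.j (y n t)) - D.K m t (D.j (y m t))) t :=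
        ((hjy n t ht).sub (hjy m t ht)).congr_deriv (by abel)
      exact h0.norm_sq
    have hρ0 : 0 ≤ ρ (n, m) := by
      have := hη0 (n, m)
      simp only [hρ]; positivity
    have h1 := kt_gronwall (c := 4 * D.β) (by positivity) hd (ψ := fun _ => ρ (n, m))
      continuous_const (fun _ => hρ0) (fun t ht => by
        have := D.brezis n m t (D.j (y n t)) (D.j (y m t)) c (hk n t ht) (hk m t ht)
        simp only [hρ, hη]
        linarith) ht
    refine h1.trans ?_
    rw [hy0, hy0, sub_self, norm_zero, intervalIntegral.integral_const, smul_eq_mul]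
    have e1 : Real.exp (4 * D.β * (t - s)) ≤ Real.exp (4 * D.β * (T - s)) := by
      apply Real.exp_le_exp.2
      have := ht.2
      gcongr
    have e2 : (0 : ℝ) ^ 2 + (t - s) * ρ (n, m) ≤ (T - s) * ρ (n, m) := by
      have := ht.2
      rw [zero_pow two_ne_zero, zero_add]
      gcongr
    have e3 : (0 : ℝ) ≤ 0 ^ 2 + (t - s) * ρ (n, m) := by
      have := sub_nonneg.2 ht.1
      positivity
    exact mul_le_mul e1 e2 e3 (Real.exp_pos _).le
  have h1 := hdiff1 n t ht
  have h2 := hdiff1 m t ht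
  have e : v n t - v m t = (v n t - D.j (y n t)) + (D.j (y n t) - D.j (y m t))
      - (v m t - D.j (y m t)) := by abel
  rw [e]
  have h3 := norm_sub_le ((v n t - D.j (y n t)) + (D.j (y n t) - D.j (y m t)))
    (v m t - D.j (y m t))
  have h4 := norm_add_le (v n t - D.j (y n t)) (D.j (y n t) - D.j (y m t))
  linarith

/-- Existence of strict solutions. -/
theorem exists_solution {s T : ℝ} (hsT : s ≤ T) (z : V) :
    ∃ w : ℝ → V, Continuous w ∧
      ∀ t ∈ Icc s T, D.j (w t) = D.j z + ∫ r in s..t, D.H r (w r) := by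
  have hβ := D.hβ
  have hM := D.hM
  have hTs : 0 ≤ T - s := sub_nonneg.2 hsT
  have hlam0 : ∀ n, 0 ≤ 3 * D.lam n := fun n => by have := D.lam_pos n; linarith
  -- solutions with forcing
  have hsol : ∀ f : ℝ → V, ∃ u : ℕ → ℝ → V, Continuous f →
      ((∀ n, Continuous (u n)) ∧ (∀ n, u n s = z) ∧
        ∀ n, ∀ t ∈ Icc s T, HasDerivAt (u n) (D.K n t (u n t) + f t) t) := by
    intro f
    by_cases hf : Continuous f
    · choose u h1 h2 h3 using fun n =>
        kt_ode hsT (hlam0 n) (D.K n) (D.K_le n) (D.hasc_K n) hf z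
      exact ⟨u, fun _ => ⟨h1, h2, h3⟩⟩
    · exact ⟨0, fun h => absurd h hf⟩
  choose u hu using hsol
  have hlimex : ∀ f : ℝ → V, ∃ g : ℝ → V, Continuous f → (Continuous g ∧
      ∀ ε > 0, ∃ N, ∀ n ≥ N, ∀ t ∈ Icc s T, ‖u f n t - g t‖ ≤ ε) := by
    intro f
    by_cases hf : Continuous f
    · obtain ⟨h1, h2, h3⟩ := hu f hf
      obtain ⟨g, hg⟩ := kt_unif_limit hsT (u f) h1 (D.cauchy_sol hsT z hf (u f) h2 h3)
      exact ⟨g, fun _ => hg⟩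
    · exact ⟨0, fun h => absurd h hf⟩
  choose S hS using hlimex
  have hSt : ∀ f, Continuous f → ∀ t ∈ Icc s T, Tendsto (fun n => u f n t) atTop (𝓝 (S f t)) := by
    intro f hf t ht
    rw [Metric.tendsto_atTop]
    intro ε hε
    obtain ⟨N, hN⟩ := (hS f hf).2 (ε / 2) (by positivity)
    refine ⟨N, fun n hn => ?_⟩
    rw [dist_eq_norm]
    have := hN n hn t ht
    linarith
  have hLf : ∀ f : ℝ → V, Continuous f → Continuous fun r => D.L r (f r) := fun f hf =>
    kt_strong_apply D.L D.M D.hL D.hLc hf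
  set E1 := Real.exp ((2 * (2 * D.β) + 1) * (T - s)) with hE1
  have hE10 : 0 < E1 := Real.exp_pos _
  obtain ⟨w, hwc, hw⟩ := kt_volterra hsT (M := E1 * (D.M ^ 2 + 1)) (by positivity)
    (fun f => S (fun r => D.L r (f r))) (fun f hf => (hS _ (hLf f hf)).1) (by
      intro f g hf hg t ht
      have h1 : Tendsto (fun n => ‖u (fun r => D.L r (f r)) n t - u (fun r => D.L r (g r)) n t‖ ^ 2)
          atTop (𝓝 (‖S (fun r => D.L r (f r)) t - S (fun r => D.L r (g r)) t‖ ^ 2)) :=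
        (((hSt _ (hLf f hf) t ht).sub (hSt _ (hLf g hg) t ht)).norm).pow 2
      refine le_of_tendsto h1 (Eventually.of_forall fun n => ?_)
      obtain ⟨a1, a2, a3⟩ := hu _ (hLf f hf)
      obtain ⟨b1, b2, b3⟩ := hu _ (hLf g hg)
      refine (D.diff_est (hLf f hf) (hLf g hg) (a3 n) (b3 n) ht).trans ?_
      rw [a2, b2, sub_self, norm_zero, zero_pow two_ne_zero, zero_add, mul_assoc, ← hE1]
      apply mul_le_mul_of_nonneg_left _ hE10.le
      rw [← intervalIntegral.integral_const_mul]
      refine intervalIntegral.integral_mono_on ht.1 ?_ ?_ ?_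
      · have := hLf f hf
        have := hLf g hg
        exact Continuous.intervalIntegrable (by fun_prop) _ _
      · exact Continuous.intervalIntegrable (by fun_prop) _ _
      · intro r _
        rw [← map_sub]
        have h2 := D.hL r (f r - g r)
        have h3 := pow_le_pow_left₀ (norm_nonneg _) h2 2
        nlinarith [sq_nonneg ‖f r - g r‖])
  refine ⟨w, hwc, ?_⟩
  obtain ⟨v1, v2, v3⟩ := hu _ (hLf w hwc)
  set v := u (fun r => D.L r (w r)) with hvdef
  have hvw : ∀ ε > 0, ∃ N, ∀ n ≥ N, ∀ t ∈ Icc s T, ‖v n t - w t‖ ≤ ε := by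
    intro ε hε
    obtain ⟨N, hN⟩ := (hS _ (hLf w hwc)).2 ε hε
    refine ⟨N, fun n hn t ht => ?_⟩
    rw [← hw t ht]
    exact hN n hn t ht
  have hvt : ∀ t ∈ Icc s T, Tendsto (fun n => v n t) atTop (𝓝 (w t)) := by
    intro t ht
    rw [← hw t ht]
    exact hSt _ (hLf w hwc) t ht
  -- solutions of the perturbed problem
  choose W W1 W2 W3 using fun n =>
    kt_ode hsT (hlam0 n) (D.KL n) (D.KL_le n) (D.hasc_KL n) (continuous_zero (X := ℝ) (M := V)) z
  set E2 := Real.exp ((2 * (2 * (D.β + D.M)) + 1) * (T - s)) with hE2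
  have hWb : ∀ n, ∀ t ∈ Icc s T, ‖W n t‖ ^ 2 ≤ E2 * ‖z‖ ^ 2 := by
    intro n t ht
    have h := kt_energy (V := V) (s := s) (T := T) (β := 2 * (D.β + D.M))
      (by linarith) (P := D.KL n) (D.KL_diss n) continuous_zero (W3 n) ht
    simpa [W2] using h
  let g : ℕ → ℝ → V := fun n r => D.Ln n r (v n r) - D.L r (w r)
  have hgc : ∀ n, Continuous (g n) := fun n =>
    (kt_strong_apply (D.Ln n) _ (D.Ln_le n) (D.hasc_Ln n) (v1 n)).sub (hLf w hwc)
  have hgt : ∀ r ∈ Icc s T, Tendsto (fun n => g n r) atTop (𝓝 0) := by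
    intro r hr
    have h1 : Tendsto (fun n => D.Ln n r (v n r - w r)) atTop (𝓝 0) := by
      refine squeeze_zero_norm (fun n => D.Ln_le n r _) ?_
      have := ((((hvt r hr).sub_const (w r)).norm).const_mul (4 * D.M))
      simpa using this
    have h2 := (h1.add (D.Ln_tendsto r (w r))).sub_const (D.L r (w r))
    simpa [g] using h2
  obtain ⟨Cw, hCw⟩ : ∃ C, ∀ t ∈ Icc s T, ‖w t‖ ≤ C :=
    isCompact_Icc.exists_bound_of_continuousOn hwc.continuousOn
  have hCw0 : 0 ≤ Cw := (norm_nonneg _).trans (hCw s (left_mem_Icc.2 hsT))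
  obtain ⟨N0, hN0⟩ := hvw 1 one_pos
  have hgb : ∀ n ≥ N0, ∀ r ∈ Icc s T, ‖g n r‖ ≤ 4 * D.M * (1 + Cw) + D.M * Cw := by
    intro n hn r hr
    have h1 := norm_sub_le (D.Ln n r (v n r)) (D.L r (w r))
    have h2 := D.Ln_le n r (v n r)
    have h3 := D.hL r (w r)
    have h4 := hCw r hr
    have h5 := hN0 n hn r hr
    have h6 : ‖v n r‖ ≤ 1 + Cw := by
      have := norm_sub_norm_le (v n r) (w r)
      linarith
    have h7 := mul_le_mul_of_nonneg_left h4 hM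
    have h8 := mul_le_mul_of_nonneg_left h6 (show 0 ≤ 4 * D.M by linarith)
    change ‖D.Ln n r (v n r) - D.L r (w r)‖ ≤ _
    linarith
  have hgi : ∀ t ∈ Icc s T, Tendsto (fun n => ∫ r in s..t, ‖g n r‖ ^ 2) atTop (𝓝 0) := by
    intro t ht
    have h0 : (0 : ℝ) = ∫ r in s..t, (0 : ℝ) := by simp
    rw [h0]
    refine intervalIntegral.tendsto_integral_filter_of_dominated_convergence
      (fun _ => (4 * D.M * (1 + Cw) + D.M * Cw) ^ 2) ?_ ?_ (by simp) ?_
    · refine Eventually.of_forall fun n => Continuous.aestronglyMeasurable ?_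
      have := hgc n
      fun_prop
    · filter_upwards [eventually_ge_atTop N0] with n hn
      refine Eventually.of_forall fun r hr => ?_
      rw [uIoc_of_le ht.1] at hr
      rw [Real.norm_of_nonneg (by positivity)]
      exact pow_le_pow_left₀ (norm_nonneg _) (hgb n hn r ⟨hr.1.le, hr.2.trans ht.2⟩) 2
    · refine Eventually.of_forall fun r hr => ?_
      rw [uIoc_of_le ht.1] at hr
      have := ((hgt r ⟨hr.1.le, hr.2.trans ht.2⟩).norm).pow 2
      simpa using this
  have hWt : ∀ t ∈ Icc s T, Tendsto (fun n => W n t) atTop (𝓝 (w t)) := by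
    intro t ht
    have h1 : ∀ n, ‖W n t - v n t‖ ^ 2 ≤ E2 * ∫ r in s..t, ‖g n r‖ ^ 2 := by
      intro n
      have h := kt_energy (V := V) (s := s) (T := T) (β := 2 * (D.β + D.M))
        (by linarith) (P := D.KL n) (D.KL_diss n) (v := fun t => W n t - v n t) (hgc n)
        (fun r hr => by
          refine ((W3 n r hr).sub (v3 n r hr)).congr_deriv ?_
          rw [map_sub, D.KL_eq n r (v n r)]
          simp only [g, Pi.zero_apply]
          abel) ht
      simpa [W2, v2] using h
    have h2 : Tendsto (fun n => W n t - v n t) atTop (𝓝 0) := by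
      rw [tendsto_zero_iff_norm_tendsto_zero]
      have h3 : Tendsto (fun n => Real.sqrt (E2 * ∫ r in s..t, ‖g n r‖ ^ 2)) atTop (𝓝 0) := by
        have := ((hgi t ht).const_mul E2).sqrt
        simpa using this
      exact squeeze_zero (fun _ => norm_nonneg _) (fun n => Real.le_sqrt_of_sq_le (h1 n)) h3
    simpa using h2.add (hvt t ht)
  have hWint : ∀ n, ∀ t ∈ Icc s T,
      D.j (W n t) = D.j z + ∫ r in s..t, D.lam n • D.R n r (D.H r (W n r)) := by
    intro n t ht
    have hc : Continuous fun r => D.lam n • D.R n r (D.H r (W n r)) := by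
      have := kt_strong_apply (D.R n) _ (D.R_bound n) (D.hRc n)
        (kt_strong_apply D.H D.M D.hH D.hHc (W1 n))
      fun_prop
    have h1 := intervalIntegral.integral_eq_sub_of_hasDerivAt
      (f := fun r => D.j (W n r)) (f' := fun r => D.lam n • D.R n r (D.H r (W n r)))
      (a := s) (b := t) (by
        intro r hr
        rw [uIcc_of_le ht.1] at hr
        have := D.j.hasFDerivAt.comp_hasDerivAt r (W3 n r ⟨hr.1, hr.2.trans ht.2⟩)
        rw [map_add, D.j_KL, D.K_j, Pi.zero_apply, map_zero, add_zero] at this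
        exact this) (hc.intervalIntegrable _ _)
    rw [h1, W2]; abel
  intro t ht
  have lhs : Tendsto (fun n => D.j (W n t)) atTop (𝓝 (D.j (w t))) :=
    (D.j.continuous.tendsto _).comp (hWt t ht)
  have rhs : Tendsto (fun n => D.j (W n t)) atTop (𝓝 (D.j z + ∫ r in s..t, D.H r (w r))) := by
    simp only [hWint _ t ht]
    refine tendsto_const_nhds.add ?_
    refine intervalIntegral.tendsto_integral_filter_of_dominated_convergence
      (fun _ => 2 * (D.M * Real.sqrt (E2 * ‖z‖ ^ 2))) ?_ ?_ (by simp) ?_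
    · refine Eventually.of_forall fun n => Continuous.aestronglyMeasurable ?_
      have := kt_strong_apply (D.R n) _ (D.R_bound n) (D.hRc n)
        (kt_strong_apply D.H D.M D.hH D.hHc (W1 n))
      fun_prop
    · refine Eventually.of_forall fun n => Eventually.of_forall fun r hr => ?_
      rw [uIoc_of_le ht.1] at hr
      rw [norm_smul, Real.norm_of_nonneg (D.lam_pos n).le]
      refine (D.R_le n r _).trans ?_
      have h1 := D.hH r (W n r)
      have h2 := Real.le_sqrt_of_sq_le (hWb n r ⟨hr.1.le, hr.2.trans ht.2⟩)
      have h3 := mul_le_mul_of_nonneg_left h2 hM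
      linarith
    · refine Eventually.of_forall fun r hr => ?_
      rw [uIoc_of_le ht.1] at hr
      exact D.J_tendsto' r (((D.H r).continuous.tendsto _).comp
        (hWt r ⟨hr.1.le, hr.2.trans ht.2⟩))
  exact tendsto_nhds_unique lhs rhs

end KatoData

open MeasureTheory Filter Set Topology

section groupfacts

variable {V : Type*} [NormedAddCommGroup V] [InnerProductSpace ℝ V]

theorem kt_G_neg (G : ℝ → V →L[ℝ] V) (hG0 : G 0 = ContinuousLinearMap.id ℝ V)
    (hGadd : ∀ x y : ℝ, G (x + y) = (G x).comp (G y)) (x : ℝ) (v : V) :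
    G (-x) (G x v) = v := by
  have := hGadd (-x) x
  rw [neg_add_cancel, hG0] at this
  exact (congrArg (fun f : V →L[ℝ] V => f v) this).symm

theorem kt_G_neg' (G : ℝ → V →L[ℝ] V) (hG0 : G 0 = ContinuousLinearMap.id ℝ V)
    (hGadd : ∀ x y : ℝ, G (x + y) = (G x).comp (G y)) (x : ℝ) (v : V) :
    G x (G (-x) v) = v := by
  have := kt_G_neg G hG0 hGadd (-x) v
  rwa [neg_neg] at this

theorem kt_G_le (G : ℝ → V →L[ℝ] V) (hGnorm : ∀ x : ℝ, ‖G x‖ ≤ 1) (x : ℝ) (v : V) :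
    ‖G x v‖ ≤ 1 * ‖v‖ :=
  ((G x).le_opNorm v).trans (by gcongr; exact hGnorm x)

theorem kt_G_norm (G : ℝ → V →L[ℝ] V) (hG0 : G 0 = ContinuousLinearMap.id ℝ V)
    (hGadd : ∀ x y : ℝ, G (x + y) = (G x).comp (G y))
    (hGnorm : ∀ x : ℝ, ‖G x‖ ≤ 1) (x : ℝ) (v : V) : ‖G x v‖ = ‖v‖ := by
  apply le_antisymm
  · simpa using kt_G_le G hGnorm x v
  · have := kt_G_le G hGnorm (-x) (G x v)
    rwa [kt_G_neg G hG0 hGadd, one_mul] at this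

theorem kt_G_comm (G : ℝ → V →L[ℝ] V)
    (hGadd : ∀ x y : ℝ, G (x + y) = (G x).comp (G y)) (x y : ℝ) (v : V) :
    G x (G y v) = G y (G x v) := by
  have h1 := hGadd x y
  have h2 := hGadd y x
  rw [add_comm, h2] at h1
  exact (congrArg (fun f : V →L[ℝ] V => f v) h1).symm

theorem kt_G_deriv (G : ℝ → V →L[ℝ] V)
    (hGadd : ∀ x y : ℝ, G (x + y) = (G x).comp (G y)) {v w : V}
    (h : HasDerivAt (fun τ : ℝ => G τ v) w 0) (x : ℝ) :
    HasDerivAt (fun τ : ℝ => G τ v) (G x w) x := by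
  have h1 : HasDerivAt (fun τ : ℝ => G τ v) w (x - x) := by rwa [sub_self]
  have h2 : HasDerivAt (fun τ : ℝ => G (τ - x) v) w x := by
    simpa using h1.comp_sub_const x x
  have h3 := (G x).hasFDerivAt.comp_hasDerivAt x h2
  refine h3.congr_of_eventuallyEq (Eventually.of_forall fun τ => ?_)
  have := hGadd x (τ - x)
  rw [add_sub_cancel] at this
  simp only [Function.comp, this, ContinuousLinearMap.comp_apply]

theorem kt_B_comm (G : ℝ → V →L[ℝ] V)
    (hGadd : ∀ x y : ℝ, G (x + y) = (G x).comp (G y))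
    (domB : Set V) (B : V → V)
    (hdomB : ∀ v : V, v ∈ domB ↔ ∃ w : V, HasDerivAt (fun τ : ℝ => G τ v) w 0)
    (hBgen : ∀ v ∈ domB, HasDerivAt (fun τ : ℝ => G τ v) (B v) 0) (x : ℝ) (v : V)
    (hv : v ∈ domB) : G x v ∈ domB ∧ B (G x v) = G x (B v) := by
  have h1 : HasDerivAt (fun τ : ℝ => G τ (G x v)) (G x (B v)) 0 := by
    refine ((G x).hasFDerivAt.comp_hasDerivAt 0 (hBgen v hv)).congr_of_eventuallyEq
      (Eventually.of_forall fun τ => ?_)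
    exact kt_G_comm G hGadd τ x v
  have h2 : G x v ∈ domB := (hdomB _).2 ⟨_, h1⟩
  exact ⟨h2, (hBgen _ h2).unique h1⟩

theorem kt_Bk {Y : Type*} [NormedAddCommGroup Y] [NormedSpace ℝ Y] [CompleteSpace Y]
    (p : ℕ) (G : ℝ → V →L[ℝ] V) (hG0 : G 0 = ContinuousLinearMap.id ℝ V)
    (domB : Set V) (B : V → V)
    (hBgen : ∀ v ∈ domB, HasDerivAt (fun τ : ℝ => G τ v) (B v) 0)
    (ι : Y →L[ℝ] V) (hY : ∀ y, ∀ k < p, B^[k] (ι y) ∈ domB) :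
    ∃ Bk : ℕ → Y →L[ℝ] V, ∀ k ≤ p, ∀ y, Bk k y = B^[k] (ι y) := by
  have key : ∀ k ≤ p, ∃ b : Y →L[ℝ] V, ∀ y, b y = B^[k] (ι y) := by
    intro k
    induction k with
    | zero => exact fun _ => ⟨ι, fun y => rfl⟩
    | succ k ih =>
      intro hk
      obtain ⟨b, hb⟩ := ih (by omega)
      let g : ℕ → Y →L[ℝ] V := fun m =>
        ((1 / ((m : ℝ) + 1))⁻¹) • ((G (1 / ((m : ℝ) + 1)) - ContinuousLinearMap.id ℝ V).comp b)
      have hg : Tendsto (fun m y => g m y) atTop (𝓝 (fun y => B^[k+1] (ι y))) := by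
        rw [tendsto_pi_nhds]
        intro y
        have h1 := hBgen _ (hY y k (by omega))
        rw [hasDerivAt_iff_tendsto_slope_zero] at h1
        have h2 : Tendsto (fun m : ℕ => 1 / ((m : ℝ) + 1)) atTop (𝓝[≠] 0) := by
          rw [tendsto_nhdsWithin_iff]
          refine ⟨tendsto_one_div_add_atTop_nhds_zero_nat, Eventually.of_forall fun m => ?_⟩
          have : (0:ℝ) < 1 / ((m : ℝ) + 1) := by positivity
          exact this.ne'
        have h3 := h1.comp h2
        rw [Function.iterate_succ_apply']
        refine h3.congr fun m => ?_
        simp [g, hb, hG0]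
      exact ⟨continuousLinearMapOfTendsto g hg, fun y => rfl⟩
  choose! b hb using key
  exact ⟨b, hb⟩

theorem kt_AY {Y : Type*} [NormedAddCommGroup Y] [NormedSpace ℝ Y] [CompleteSpace Y]
    [CompleteSpace V]
    (ι : Y →L[ℝ] V) (D : Set V) (domA : Set V) (hD : D ⊆ domA) (A P : V → V) (c : ℝ)
    (hA_add : ∀ x ∈ domA, ∀ y ∈ domA, A (x + y) = A x + A y)
    (hA_smul : ∀ (a : ℝ), ∀ x ∈ domA, A (a • x) = a • A x)
    (hYsub : ∀ y : Y, ι y ∈ D) (PY : Y →L[ℝ] V) (hPY : ∀ y, PY y = P (ι y))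
    (hcl : ∀ (u : ℕ → V) (x w : V), (∀ n, u n ∈ D) → Tendsto u atTop (𝓝 x) →
      Tendsto (fun n => A (u n) - c • P (u n)) atTop (𝓝 w) →
      x ∈ D ∧ A x - c • P x = w) :
    ∃ AY : Y →L[ℝ] V, ∀ y, AY y = A (ι y) := by
  let g : Y →ₗ[ℝ] V :=
    { toFun := fun y => A (ι y) - c • PY y
      map_add' := fun x y => by
        rw [map_add, map_add, hA_add _ (hD (hYsub x)) _ (hD (hYsub y)), smul_add]; abel
      map_smul' := fun a x => by
        rw [map_smul, map_smul, hA_smul _ _ (hD (hYsub x)), smul_comm c a, smul_sub]; rfl }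
  have hg : Continuous g := by
    apply LinearMap.continuous_of_seq_closed_graph
    intro u x y hu hgu
    have := hcl (fun n => ι (u n)) (ι x) y (fun n => hYsub _) ((ι.continuous.tendsto x).comp hu)
      (by simpa [Function.comp_def, g, hPY] using hgu)
    rw [← this.2]
    simp [g, hPY]
  refine ⟨(⟨g, hg⟩ : Y →L[ℝ] V) + c • PY, fun y => ?_⟩
  simp [g]

theorem kt_diss_of_norm {x k : V} {l₁ : ℝ}
    (h : ∀ l : ℝ, l₁ < l → (l - l₁) * ‖x‖ ≤ ‖l • x - k‖) : inner ℝ k x ≤ l₁ * ‖x‖ ^ 2 := by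
  have h1 : ∀ l : ℝ, l₁ < l →
      2 * l * (inner ℝ k x - l₁ * ‖x‖ ^ 2) ≤ ‖k‖ ^ 2 - l₁ ^ 2 * ‖x‖ ^ 2 := by
    intro l hl
    have h2 : ((l - l₁) * ‖x‖) ^ 2 ≤ ‖l • x - k‖ ^ 2 := by
      have := h l hl
      have : 0 ≤ (l - l₁) * ‖x‖ := mul_nonneg (by linarith) (norm_nonneg _)
      gcongr
    rw [norm_sub_sq_real, norm_smul, real_inner_smul_left, real_inner_comm, mul_pow,
      mul_pow, Real.norm_eq_abs, sq_abs] at h2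
    nlinarith
  by_contra! hc
  set d := inner ℝ k x - l₁ * ‖x‖ ^ 2 with hd
  have hdpos : 0 < d := by linarith
  set E := ‖k‖ ^ 2 - l₁ ^ 2 * ‖x‖ ^ 2
  have := h1 (|l₁| + (|E| / d + 1)) (by
    have := le_abs_self l₁
    have : 0 ≤ |E| / d := by positivity
    linarith)
  have h5 : |E| / d * d = |E| := div_mul_cancel₀ _ hdpos.ne'
  have := le_abs_self E
  have := abs_nonneg E
  have := abs_nonneg l₁
  have := mul_nonneg (abs_nonneg l₁) hdpos.le
  nlinarith

end groupfacts

open MeasureTheory Filter Set Topology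

/-- Uniform bound for a strongly continuous family on a compact interval. -/
theorem kt_bdd {W V : Type*} [NormedAddCommGroup W] [NormedSpace ℝ W] [CompleteSpace W]
    [NormedAddCommGroup V] [NormedSpace ℝ V] {T : ℝ} (hT : 0 ≤ T) (L : ℝ → W →L[ℝ] V)
    (hLcont : ∀ w : W, ContinuousOn (fun t : ℝ => L t w) (Icc (0 : ℝ) T)) :
    ∃ M : ℝ, 0 ≤ M ∧ ∀ t v, ‖L (ktClamp 0 T t) v‖ ≤ M * ‖v‖ := by
  obtain ⟨M, hM⟩ := banach_steinhaus (g := fun t : ℝ => L (ktClamp 0 T t)) (by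
    intro x
    obtain ⟨C, hC⟩ := isCompact_Icc.exists_bound_of_continuousOn (hLcont x)
    exact ⟨C, fun t => hC _ (ktClamp_mem hT t)⟩)
  refine ⟨M, (norm_nonneg _).trans (hM 0), fun t v => ?_⟩
  exact ((L (ktClamp 0 T t)).le_opNorm v).trans (by gcongr; exact hM t)

theorem kt_build {V : Type*} [NormedAddCommGroup V] [InnerProductSpace ℝ V] [CompleteSpace V]
    {Y : Type*} [NormedAddCommGroup Y] [InnerProductSpace ℝ Y] [CompleteSpace Y]
    (T : ℝ) (hT : 0 < T) (ω : ℝ → ℝ) (hω : ContinuousOn ω (Icc 0 T))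
    (c : ℝ → ℝ) (hc : ContinuousOn c (Icc (0 : ℝ) T))
    (G : ℝ → V →L[ℝ] V)
    (hG0 : G 0 = ContinuousLinearMap.id ℝ V)
    (hGadd : ∀ x y : ℝ, G (x + y) = (G x).comp (G y))
    (hGcont : ∀ v : V, Continuous fun x : ℝ => G x v)
    (hGnorm : ∀ x : ℝ, ‖G x‖ ≤ 1)
    (ι : Y →L[ℝ] V) (hι_dense : DenseRange ι)
    (GY : ℝ → Y →L[ℝ] Y)
    (hGY : ∀ (x : ℝ) (y : Y), ι (GY x y) = G x (ι y))
    (hGYnorm : ∀ x : ℝ, ‖GY x‖ ≤ 1)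
    (D : Set V) (A P : V → V) (hYsub : ∀ y : Y, ι y ∈ D)
    (AY PY : Y →L[ℝ] V) (hAY : ∀ y, AY y = A (ι y)) (hPY : ∀ y, PY y = P (ι y))
    (lam₁ : ℝ)
    (hres : ∀ t ∈ Icc (0 : ℝ) T, ∀ lam : ℝ, lam₁ < lam →
      ∃ R : V →L[ℝ] V, ‖R‖ ≤ (lam - lam₁)⁻¹ ∧
        (∀ x ∈ D, R (lam • x - (A x - c t • P x)) = x) ∧
        ∀ w : V, R w ∈ D ∧ lam • R w - (A (R w) - c t • P (R w)) = w)
    (Q : Y ≃L[ℝ] V)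
    (hQb : ∀ (x : ℝ) (y : Y), Q (GY x y) = G x (Q y))
    (L : ℝ → V →L[ℝ] V)
    (hLcont : ∀ w : V, ContinuousOn (fun t : ℝ => L t w) (Icc (0 : ℝ) T))
    (hQc : ∀ t ∈ Icc (0 : ℝ) T, ∀ x ∈ D,
      ∃ w : Y, ι w = A (ι (Q.symm x)) - c t • P (ι (Q.symm x)) ∧
        Q w = (A x - c t • P x) + L t x)
    (s : ℝ) (hs : s ∈ Ico (0 : ℝ) T) (x₀ : Y) :
    ∃ y : ℝ → Y, Continuous y ∧ ∀ t ∈ Icc s T,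
      ι (y t) = G (-ω s) (ι x₀) +
        ∫ r in s..t, G (-ω r) (AY (GY (ω r) (y r)) - c r • PY (GY (ω r) (y r))) := by
  set τ : ℝ → ℝ := ktClamp 0 T with hτ
  have hτm : ∀ t, τ t ∈ Icc 0 T := ktClamp_mem hT.le
  have hτc : Continuous τ := ktClamp_cont 0 T
  set o : ℝ → ℝ := fun t => ω (τ t) with ho
  have hoc : Continuous o := hω.comp_continuous hτc hτm
  have hcc : Continuous fun t => c (τ t) := hc.comp_continuous hτc hτm
  have hGY' : ∀ x v, GY x (Q.symm v) = Q.symm (G x v) := by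
    intro x v
    apply Q.injective
    rw [hQb]; simp
  have hGle := kt_G_le G hGnorm
  have hGiso := kt_G_norm G hG0 hGadd hGnorm
  have hGn := kt_G_neg G hG0 hGadd
  have hGn' := kt_G_neg' G hG0 hGadd
  -- the operators in `Y`
  set HY : ℝ → Y →L[ℝ] V := fun t => AY - c t • PY with hHY
  have hHYc : ∀ y : Y, ContinuousOn (fun t : ℝ => HY t y) (Icc (0 : ℝ) T) := by
    intro y
    have : ContinuousOn (fun t : ℝ => AY y - c t • PY y) (Icc (0 : ℝ) T) :=
      continuousOn_const.sub (hc.smul continuousOn_const)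
    exact this
  obtain ⟨M₁, hM₁0, hM₁⟩ := kt_bdd hT.le HY hHYc
  obtain ⟨M₂, hM₂0, hM₂⟩ := kt_bdd hT.le L hLcont
  set q : ℝ := ‖(Q.symm : V →L[ℝ] Y)‖ with hq
  set M : ℝ := M₂ + M₁ * q with hM
  have hq0 : 0 ≤ q := norm_nonneg _
  have hM0 : 0 ≤ M := by positivity
  set β : ℝ := max lam₁ 0 with hβ
  have hβ0 : 0 ≤ β := le_max_right _ _
  have hβ1 : lam₁ ≤ β := le_max_left _ _
  set lam : ℕ → ℝ := fun n => (n : ℝ) + (2 * (β + M) + 1) with hlam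
  have hlam1 : ∀ n, 2 * (β + M) + 1 ≤ lam n := fun n => by
    have : (0:ℝ) ≤ n := Nat.cast_nonneg n
    simp only [hlam]; linarith
  have hlam2 : ∀ n, lam₁ < lam n := fun n => by have := hlam1 n; linarith
  have hlamβ : ∀ n, β < lam n := fun n => by have := hlam1 n; linarith
  have hex : ∀ n t, ∃ R : V →L[ℝ] V, ‖R‖ ≤ (lam n - lam₁)⁻¹ ∧
        (∀ x ∈ D, R (lam n • x - (A x - c (τ t) • P x)) = x) ∧
        ∀ w : V, R w ∈ D ∧ lam n • R w - (A (R w) - c (τ t) • P (R w)) = w :=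
    fun n t => hres _ (hτm t) _ (hlam2 n)
  choose R hRn hRl hRr using hex
  have hRle : ∀ n t v, (lam n - lam₁) * ‖R n t v‖ ≤ ‖v‖ := by
    intro n t v
    have h1 : 0 < lam n - lam₁ := by have := hlam2 n; linarith
    have h2 : ‖R n t v‖ ≤ (lam n - lam₁)⁻¹ * ‖v‖ :=
      ((R n t).le_opNorm v).trans (by gcongr; exact hRn n t)
    calc (lam n - lam₁) * ‖R n t v‖ ≤ (lam n - lam₁) * ((lam n - lam₁)⁻¹ * ‖v‖) := by gcongr
      _ = ‖v‖ := by field_simp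
  have hRle' : ∀ n t v, ‖R n t v‖ ≤ (lam n - lam₁)⁻¹ * ‖v‖ := fun n t v =>
      ((R n t).le_opNorm v).trans (by gcongr; exact hRn n t)
  have hRcont : ∀ n v, Continuous fun t => R n t v := by
    intro n v
    rw [continuous_iff_continuousAt]
    intro t₀
    have h0 : 0 ≤ (lam n - lam₁)⁻¹ := (norm_nonneg _).trans (hRn n t₀)
    have hb : ∀ t, ‖R n t v - R n t₀ v‖ ≤
        |c (τ t) - c (τ t₀)| * ((lam n - lam₁)⁻¹ * ‖P (R n t₀ v)‖) := by
      intro t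
      obtain ⟨h1, h2⟩ := hRr n t₀ v
      have h3 := hRl n t _ h1
      have h4 : lam n • R n t₀ v - (A (R n t₀ v) - c (τ t) • P (R n t₀ v)) =
          v + (c (τ t) - c (τ t₀)) • P (R n t₀ v) := by
        linear_combination (norm := module) h2
      rw [h4, map_add, map_smul] at h3
      have h5 : R n t v - R n t₀ v = -((c (τ t) - c (τ t₀)) • R n t (P (R n t₀ v))) := by
        linear_combination (norm := module) h3
      rw [h5, norm_neg, norm_smul, Real.norm_eq_abs]
      gcongr
      exact hRle' _ _ _
    rw [ContinuousAt, tendsto_iff_norm_sub_tendsto_zero]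
    refine squeeze_zero (fun _ => norm_nonneg _) hb ?_
    have : Continuous fun t => |c (τ t) - c (τ t₀)| * ((lam n - lam₁)⁻¹ * ‖P (R n t₀ v)‖) :=
      ((hcc.sub continuous_const).abs).mul continuous_const
    simpa using this.tendsto t₀
  let jj : V →L[ℝ] V := ι.comp (Q.symm : V →L[ℝ] Y)
  have hjj : ∀ v, jj v = ι (Q.symm v) := fun v => rfl
  have hjG : ∀ x v, jj (G x v) = G x (jj v) := by
    intro x v
    rw [hjj, hjj, ← hGY', hGY]
  have hGoc : Continuous fun t => -o t := hoc.neg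
  have conjc : ∀ (S : ℝ → V →L[ℝ] V) (m : ℝ), (∀ t v, ‖S t v‖ ≤ m * ‖v‖) →
      (∀ v, Continuous fun t => S t v) → ∀ v, Continuous fun t => G (-o t) (S t (G (o t) v)) := by
    intro S m hS hSc v
    have h1 : Continuous fun t => S t (G (o t) v) :=
      kt_strong_apply S m hS hSc ((hGcont v).comp hoc)
    exact kt_strong_apply (fun t => G (-o t)) 1 (fun t v => hGle _ _)
      (fun v => (hGcont v).comp hGoc) h1
  have hLcc : ∀ v, Continuous fun t => L (τ t) v := fun v =>
    (hLcont v).comp_continuous hτc hτm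
  let H0 : ℝ → V →L[ℝ] V := fun t => (HY (τ t)).comp (Q.symm : V →L[ℝ] Y)
  have hH0c : ∀ v, Continuous fun t => H0 t v := fun v =>
    (hHYc (Q.symm v)).comp_continuous hτc hτm
  have hH0b : ∀ t v, ‖H0 t v‖ ≤ (M₁ * q) * ‖v‖ := by
    intro t v
    calc ‖H0 t v‖ ≤ M₁ * ‖Q.symm v‖ := hM₁ t (Q.symm v)
      _ ≤ M₁ * (q * ‖v‖) := by gcongr; exact (Q.symm : V →L[ℝ] Y).le_opNorm v
      _ = _ := by ring
  have hH0A : ∀ t v, H0 t v = A (jj v) - c (τ t) • P (jj v) := by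
    intro t v
    change AY (Q.symm v) - c (τ t) • PY (Q.symm v) = _
    rw [hAY, hPY, hjj]
  let KD : KatoData V :=
    { j := jj
      R := fun n t => (G (-o t)).comp ((R n t).comp (G (o t)))
      L := fun t => (G (-o t)).comp ((L (τ t)).comp (G (o t)))
      H := fun t => (G (-o t)).comp ((H0 t).comp (G (o t)))
      lam := lam
      β := β
      M := M
      hβ := hβ0
      hM := hM0
      hlam := hlam1
      hlamT := tendsto_natCast_atTop_atTop.atTop_add tendsto_const_nhds
      hj := by
        refine hι_dense.comp ?_ ι.continuous
        exact Q.symm.surjective.denseRange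
      hR := by
        intro n t v
        simp only [ContinuousLinearMap.comp_apply, hGiso]
        have h := hRle n t (G (o t) v)
        rw [hGiso] at h
        refine le_trans ?_ h
        gcongr
      hL := by
        intro t v
        simp only [ContinuousLinearMap.comp_apply, hGiso]
        refine (hM₂ t (G (o t) v)).trans ?_
        rw [hGiso]
        gcongr
        have : 0 ≤ M₁ * q := by positivity
        linarith
      hH := by
        intro t v
        simp only [ContinuousLinearMap.comp_apply, hGiso]
        refine (hH0b t (G (o t) v)).trans ?_
        rw [hGiso]
        gcongr
        linarith
      hRc := fun n v => conjc (R n) _ (hRle' n) (hRcont n) v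
      hLc := fun v => conjc (fun t => L (τ t)) _ hM₂ hLcc v
      hHc := fun v => conjc H0 _ hH0b hH0c v
      hRj := by
        intro n t a
        simp only [ContinuousLinearMap.comp_apply, hGn', map_sub, hjG]
        set a' := G (o t) a
        obtain ⟨h1, h2⟩ := hRr n t a'
        obtain ⟨w, hw1, hw2⟩ := hQc _ (hτm t) _ h1
        rw [← hjj] at hw1
        have h3 : ι w = jj (A (R n t a') - c (τ t) • P (R n t a')) + jj (L (τ t) (R n t a')) := by
          rw [← map_add, ← hw2, hjj]; simp
        have h4 := hRl n t (jj (R n t a')) (hYsub _)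
        rw [← hw1, h3] at h4
        have h5 : A (R n t a') - c (τ t) • P (R n t a') = lam n • R n t a' - a' := by
          linear_combination (norm := module) -h2
        rw [h5] at h4
        rw [← map_sub, ← map_sub]
        congr 1
        conv_rhs => rw [← h4]
        congr 1
        have h6 : jj a' = G (o t) (jj a) := hjG _ _
        simp only [map_sub, map_smul, h6]
        module
      hRH := by
        intro n t v
        simp only [ContinuousLinearMap.comp_apply, hGn']
        set v' := G (o t) v with hv'
        have h4 := hRl n t (jj v') (hYsub _)
        rw [← hH0A, map_sub, map_smul] at h4
        have h5 : jj v = G (-o t) (jj v') := by rw [← hjG, hv', hGn]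
        rw [← hjG, ← hv', h5, ← map_smul, ← map_sub]
        congr 1
        linear_combination (norm := module) h4
      hdiss := by
        intro n m t a b
        simp only [ContinuousLinearMap.comp_apply]
        refine le_trans (kt_diss_of_norm (l₁ := lam₁) ?_) (by gcongr)
        intro l hl
        obtain ⟨Rl, hn, hl1, -⟩ := hres _ (hτm t) l hl
        set a' := G (o t) a with ha'
        set b' := G (o t) b with hb'
        have ha : a = G (-o t) a' := by rw [ha', hGn]
        have hb : b = G (-o t) b' := by rw [hb', hGn]
        rw [ha, hb]
        simp only [← (G (-o t)).map_smul, ← (G (-o t)).map_sub, hGiso]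
        obtain ⟨h1, h2⟩ := hRr n t a'
        obtain ⟨h3, h4⟩ := hRr m t b'
        have h5 : A (R n t a') - c (τ t) • P (R n t a') = lam n • R n t a' - a' := by
          linear_combination (norm := module) -h2
        have h6 : A (R m t b') - c (τ t) • P (R m t b') = lam m • R m t b' - b' := by
          linear_combination (norm := module) -h4
        have h7 := hl1 _ h1
        have h8 := hl1 _ h3
        rw [h5] at h7
        rw [h6] at h8
        have h9 : R n t a' - R m t b' = Rl (l • (R n t a' - R m t b') -
          ((lam n • R n t a' - a') - (lam m • R m t b' - b'))) := by
          conv_lhs => rw [← h7, ← h8, ← map_sub]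
          congr 1
          module
        have h10 : 0 < l - lam₁ := by linarith
        set xx := R n t a' - R m t b'
        set kk := l • xx - ((lam n • R n t a' - a') - (lam m • R m t b' - b'))
        have h11 : ‖xx‖ ≤ (l - lam₁)⁻¹ * ‖kk‖ := by
          conv_lhs => rw [h9]
          exact (Rl.le_opNorm kk).trans (by gcongr)
        calc (l - lam₁) * ‖xx‖ ≤ (l - lam₁) * ((l - lam₁)⁻¹ * ‖kk‖) := by gcongr
          _ = ‖kk‖ := by field_simp }
  obtain ⟨w, hw, hw2⟩ := KD.exists_solution hs.2.le (Q (GY (-ω s) x₀))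
  refine ⟨fun t => Q.symm (w t), Q.symm.continuous.comp hw, fun t ht => ?_⟩
  have h1 := hw2 t ht
  have h2 : KD.j (Q (GY (-ω s) x₀)) = G (-ω s) (ι x₀) := by
    change ι (Q.symm (Q (GY (-ω s) x₀))) = _
    rw [Q.symm_apply_apply, hGY]
  rw [h2] at h1
  change ι (Q.symm (w t)) = _ at h1
  rw [h1]
  congr 1
  apply intervalIntegral.integral_congr
  intro r hr
  rw [uIcc_of_le ht.1] at hr
  have h3 : τ r = r := ktClamp_eq ⟨hs.1.trans hr.1, hr.2.trans ht.2⟩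
  change G (-ω (τ r)) (AY (Q.symm (G (ω (τ r)) (w r))) - c (τ r) • PY (Q.symm (G (ω (τ r)) (w r)))) = _
  simp only [h3, hGY']

open MeasureTheory Filter Set Topology

/-- A plateau function around `v`. -/
noncomputable def ktBump (δ v r : ℝ) : ℝ := max 0 (min 1 (2 - |r - v| / δ))

theorem ktBump_cont (δ v : ℝ) : Continuous (ktBump δ v) := by
  unfold ktBump; fun_prop

theorem ktBump_nonneg (δ v r : ℝ) : 0 ≤ ktBump δ v r := le_max_left _ _

theorem ktBump_le_one (δ v r : ℝ) : ktBump δ v r ≤ 1 :=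
  max_le zero_le_one (min_le_left _ _)

theorem ktBump_eq_one {δ v r : ℝ} (hδ : 0 < δ) (h : |r - v| ≤ δ) : ktBump δ v r = 1 := by
  unfold ktBump
  have : |r - v| / δ ≤ 1 := (div_le_one hδ).2 h
  rw [min_eq_left (by linarith), max_eq_right zero_le_one]

theorem ktBump_int (μ : Measure ℝ) [IsFiniteMeasure μ] (hμna : ∀ x : ℝ, μ {x} = 0) (v : ℝ)
    {ε : ℝ} (hε : 0 < ε) :
    ∀ᶠ m : ℕ in atTop, ∫ r, ktBump (1 / ((m : ℝ) + 1)) v r ∂μ < ε := by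
  have h : Tendsto (fun m : ℕ => ∫ r, ktBump (1 / ((m : ℝ) + 1)) v r ∂μ) atTop
      (𝓝 (∫ r, (0 : ℝ) ∂μ)) := by
    refine tendsto_integral_of_dominated_convergence (fun _ => (1 : ℝ))
      (fun m => (ktBump_cont _ _).aestronglyMeasurable) (integrable_const _) ?_ ?_
    · intro m
      refine Eventually.of_forall fun r => ?_
      rw [Real.norm_eq_abs, abs_of_nonneg (ktBump_nonneg _ _ _)]
      exact ktBump_le_one _ _ _
    · have h1 : ∀ᵐ r ∂μ, r ≠ v := by
        rw [ae_iff]; simpa using hμna v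
      filter_upwards [h1] with r hr
      have hpos : 0 < |r - v| / 2 := by
        have := abs_pos.2 (sub_ne_zero.2 hr); positivity
      have h2 := (tendsto_one_div_add_atTop_nhds_zero_nat (𝕜 := ℝ)).eventually_lt_const hpos
      refine tendsto_const_nhds.congr' ?_
      filter_upwards [h2] with m hm
      unfold ktBump
      have hδ : (0 : ℝ) < 1 / ((m : ℝ) + 1) := by positivity
      have : 2 ≤ |r - v| / (1 / ((m : ℝ) + 1)) := by
        rw [le_div_iff₀ hδ]; linarith
      symm
      apply max_eq_left
      exact (min_le_right _ _).trans (by linarith)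
  rw [integral_zero] at h
  exact h.eventually_lt_const hε

theorem ktClamp_left {a b t : ℝ} (hab : a ≤ b) (h : t ≤ a) : ktClamp a b t = a := by
  unfold ktClamp; rw [min_eq_right (h.trans hab), max_eq_left h]

theorem ktClamp_right {a b t : ℝ} (hab : a ≤ b) (h : b ≤ t) : ktClamp a b t = b := by
  unfold ktClamp; rw [min_eq_left h, max_eq_right hab]

theorem ktClamp_mono (a b : ℝ) {r r' : ℝ} (h : r ≤ r') : ktClamp a b r ≤ ktClamp a b r' := by
  unfold ktClamp; gcongr

theorem ktClamp_lip (a b : ℝ) (r r' : ℝ) (h : r ≤ r') :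
    ktClamp a b r' - ktClamp a b r ≤ r' - r := by
  unfold ktClamp
  rcases le_total b r with h1 | h1 <;> rcases le_total b r' with h2 | h2 <;>
  rcases le_total a (min b r) with h3 | h3 <;> rcases le_total a (min b r') with h4 | h4 <;>
  simp_all <;> linarith

theorem kt_cell {p : ℕ} (hp : 0 < p) (ω : ℝ → ℝ) {s u : ℝ} (hsu : s < u) {δ a a' η β Bd : ℝ}
    (haa : a < a') (hmesh : a' - a < δ)
    (hη : |ω (ktClamp s u a') - ω (ktClamp s u a)| ^ p ≤ η) (hβ : |β| ≤ Bd) :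
    |(|ω (ktClamp s u a') - ω (ktClamp s u a)| ^ p * β) -
      (|ω a' - ω a| ^ p * (max 0 (1 - |a - ktClamp s u a| / δ) * β))| ≤
    Bd * (|ω a' - ω a| ^ p * (ktBump δ s a + ktBump δ u a) +
      η * (((if s < a' then 1 else 0) - (if s < a then 1 else 0)) +
        ((if u < a' then 1 else 0) - (if u < a then 1 else 0)))) := by
  have hδ : 0 < δ := by linarith
  set d := |ω a' - ω a| ^ p with hd
  set dd := |ω (ktClamp s u a') - ω (ktClamp s u a)| ^ p with hdd
  set χ := max 0 (1 - |a - ktClamp s u a| / δ) with hχ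
  have hd0 : 0 ≤ d := by positivity
  have hdd0 : 0 ≤ dd := by positivity
  have hη0 : 0 ≤ η := hdd0.trans hη
  have hB0 : 0 ≤ Bd := (abs_nonneg _).trans hβ
  have hχ0 : 0 ≤ χ := le_max_left _ _
  have hχ1 : χ ≤ 1 := max_le zero_le_one (by
    have : 0 ≤ |a - ktClamp s u a| / δ := by positivity
    linarith)
  have hes : (0:ℝ) ≤ (if s < a' then 1 else 0) - (if s < a then 1 else 0) := by
    split_ifs <;> first | (exfalso; linarith) | norm_num
  have heu : (0:ℝ) ≤ (if u < a' then 1 else 0) - (if u < a then 1 else 0) := by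
    split_ifs <;> first | (exfalso; linarith) | norm_num
  have hψs := ktBump_nonneg δ s a
  have hψu := ktBump_nonneg δ u a
  have gen : ∀ {E P : ℝ}, dd ≤ E → χ ≤ P → |dd * β - d * (χ * β)| ≤ Bd * (d * P + E) := by
    intro E P h1 h2
    have e1 : dd * β - d * (χ * β) = (dd - d * χ) * β := by ring
    rw [e1, abs_mul, mul_comm]
    have h3 : |dd - d * χ| ≤ d * P + E := by
      have : d * χ ≤ d * P := by gcongr
      have : 0 ≤ d * χ := by positivity
      rw [abs_le]; constructor <;> linarith
    gcongr
  have hE : 0 ≤ η * (((if s < a' then 1 else 0) - (if s < a then 1 else 0)) +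
        ((if u < a' then 1 else 0) - (if u < a then 1 else 0))) := by positivity
  rcases le_or_gt a' s with h1 | h1
  · -- cell on the left
    apply gen
    · have : dd = 0 := by
        rw [hdd, ktClamp_left hsu.le h1, ktClamp_left hsu.le (haa.le.trans h1), sub_self, abs_zero,
          zero_pow hp.ne']
      linarith
    · rw [hχ, ktClamp_left hsu.le (haa.le.trans h1)]
      have : max 0 (1 - |a - s| / δ) ≤ ktBump δ s a := by
        unfold ktBump
        apply max_le_max le_rfl
        apply le_min
        · have : 0 ≤ |a - s| / δ := by positivity
          linarith
        · linarith
      linarith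
  rcases le_or_gt u a with h2 | h2
  · apply gen
    · have : dd = 0 := by
        rw [hdd, ktClamp_right hsu.le h2, ktClamp_right hsu.le (h2.trans haa.le), sub_self,
          abs_zero, zero_pow hp.ne']
      linarith
    · rw [hχ, ktClamp_right hsu.le h2]
      have : max 0 (1 - |a - u| / δ) ≤ ktBump δ u a := by
        unfold ktBump
        apply max_le_max le_rfl
        apply le_min
        · have : 0 ≤ |a - u| / δ := by positivity
          linarith
        · linarith
      linarith
  rcases lt_or_ge a s with h3 | h3
  · apply gen
    · have e : (if s < a' then (1:ℝ) else 0) - (if s < a then 1 else 0) = 1 := by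
        rw [if_pos h1, if_neg (by linarith)]; norm_num
      rw [e]
      nlinarith
    · have : ktBump δ s a = 1 := ktBump_eq_one hδ (by rw [abs_le]; constructor <;> linarith)
      linarith
  rcases lt_or_ge u a' with h4 | h4
  · apply gen
    · have e : (if u < a' then (1:ℝ) else 0) - (if u < a then 1 else 0) = 1 := by
        rw [if_pos h4, if_neg (by linarith)]; norm_num
      rw [e]
      nlinarith
    · have : ktBump δ u a = 1 := ktBump_eq_one hδ (by rw [abs_le]; constructor <;> linarith)
      linarith
  · have e1 : ktClamp s u a = a := ktClamp_eq ⟨h3, h2.le⟩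
    have e2 : ktClamp s u a' = a' := ktClamp_eq ⟨h1.le, h4⟩
    have e3 : dd = d := by rw [hdd, e1, e2]
    have e4 : χ = 1 := by rw [hχ, e1]; simp
    rw [e3, e4, one_mul, sub_self, abs_zero]
    positivity

theorem kt_osc {ω : ℝ → ℝ} (hω : Continuous ω) {s u : ℝ} {N : ℕ → ℕ} {t : ℕ → ℕ → ℝ}
    (hsu : s ≤ u)
    (hmono : ∀ n i, i < N n → t n i < t n (i + 1))
    (hmesh : ∀ ε > 0, ∃ n₀ : ℕ, ∀ n ≥ n₀, ∀ i < N n, t n (i + 1) - t n i < ε)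
    {ε : ℝ} (hε : 0 < ε) :
    ∀ᶠ n in atTop, ∀ i < N n, |ω (ktClamp s u (t n (i+1))) - ω (ktClamp s u (t n i))| < ε := by
  have h := (isCompact_Icc (a := s) (b := u)).uniformContinuousOn_of_continuous hω.continuousOn
  rw [Metric.uniformContinuousOn_iff] at h
  obtain ⟨δ, hδ, h⟩ := h ε hε
  obtain ⟨n₀, hn⟩ := hmesh δ hδ
  filter_upwards [eventually_ge_atTop n₀] with n hn' i hi
  refine h _ (ktClamp_mem hsu _) _ (ktClamp_mem hsu _) ?_
  rw [Real.dist_eq, abs_of_nonneg (sub_nonneg.2 (ktClamp_mono _ _ (hmono n i hi).le))]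
  exact (ktClamp_lip s u _ _ (hmono n i hi).le).trans_lt (hn n hn' i hi)

theorem kt_scalar {p : ℕ} (hp : 0 < p) {ω : ℝ → ℝ} (hω : Continuous ω)
    {N : ℕ → ℕ} {t : ℕ → ℕ → ℝ}
    (hmono : ∀ n i, i < N n → t n i < t n (i + 1))
    (hmesh : ∀ ε > 0, ∃ n₀ : ℕ, ∀ n ≥ n₀, ∀ i < N n, t n (i + 1) - t n i < ε)
    (μ : Measure ℝ) [IsFiniteMeasure μ] (hμna : ∀ x : ℝ, μ {x} = 0)
    (hweak : ∀ g : ℝ → ℝ, Continuous g → (∃ M : ℝ, ∀ x, |g x| ≤ M) →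
      Tendsto (fun n => ∑ j ∈ Finset.range (N n),
          |ω (t n (j + 1)) - ω (t n j)| ^ p * g (t n j)) atTop (𝓝 (∫ x, g x ∂μ)))
    {s u : ℝ} (hsu : s < u) (b : ℝ → ℝ) (hb : Continuous b) :
    Tendsto (fun n => ∑ j ∈ Finset.range (N n),
      |ω (ktClamp s u (t n (j + 1))) - ω (ktClamp s u (t n j))| ^ p * b (ktClamp s u (t n j)))
      atTop (𝓝 (∫ x in Icc s u, b x ∂μ)) := by
  obtain ⟨B₀, hB₀⟩ := (isCompact_Icc (a := s) (b := u)).exists_bound_of_continuousOn hb.continuousOn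
  have hB0 : 0 ≤ B₀ := (norm_nonneg _).trans (hB₀ s ⟨le_rfl, hsu.le⟩)
  have hB : ∀ r, |b (ktClamp s u r)| ≤ B₀ := fun r => hB₀ _ (ktClamp_mem hsu.le r)
  rw [Metric.tendsto_atTop']
  intro ε hε
  set ε' := ε / (8 * (B₀ + 1)) with hε'
  have hε'0 : 0 < ε' := by positivity
  have hε'B : B₀ * ε' ≤ ε / 8 := by
    have h1 : (B₀ + 1) * ε' = ε / 8 := by rw [hε']; field_simp
    nlinarith
  obtain ⟨m, hm1, hm2⟩ := ((ktBump_int μ hμna s (half_pos hε'0)).and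
    (ktBump_int μ hμna u (half_pos hε'0))).exists
  set δ : ℝ := 1 / ((m : ℝ) + 1) with hδ
  have hδ0 : 0 < δ := by positivity
  set ψ : ℝ → ℝ := fun r => ktBump δ s r + ktBump δ u r with hψ
  have hψc : Continuous ψ := (ktBump_cont _ _).add (ktBump_cont _ _)
  have hψ0 : ∀ r, 0 ≤ ψ r := fun r => add_nonneg (ktBump_nonneg _ _ _) (ktBump_nonneg _ _ _)
  have hψ2 : ∀ r, |ψ r| ≤ 2 := fun r => by
    rw [abs_of_nonneg (hψ0 r)]
    have := ktBump_le_one δ s r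
    have := ktBump_le_one δ u r
    simp only [hψ]; linarith
  have bint : ∀ v, Integrable (ktBump δ v) μ := fun v =>
    Integrable.of_bound (ktBump_cont _ _).aestronglyMeasurable 1
      (Eventually.of_forall fun r => by
        rw [Real.norm_eq_abs, abs_of_nonneg (ktBump_nonneg _ _ _)]; exact ktBump_le_one _ _ _)
  have hψi : Integrable ψ μ := (bint s).add (bint u)
  have hψint : ∫ r, ψ r ∂μ < ε' := by
    rw [hψ, integral_add (bint s) (bint u)]; linarith
  set g : ℝ → ℝ := fun r => max 0 (1 - |r - ktClamp s u r| / δ) * b (ktClamp s u r) with hg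
  have hκ := ktClamp_cont s u
  have hgc : Continuous g := by
    have h1 : Continuous fun r => max 0 (1 - |r - ktClamp s u r| / δ) := by fun_prop
    exact h1.mul (hb.comp hκ)
  have hχ1 : ∀ r, max 0 (1 - |r - ktClamp s u r| / δ) ≤ 1 := fun r => max_le zero_le_one (by
    have : 0 ≤ |r - ktClamp s u r| / δ := by positivity
    linarith)
  have hχ0 : ∀ r, 0 ≤ max 0 (1 - |r - ktClamp s u r| / δ) := fun r => le_max_left _ _
  have hgb : ∀ r, |g r| ≤ B₀ := fun r => by
    simp only [hg]
    rw [abs_mul, abs_of_nonneg (hχ0 r)]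
    calc _ ≤ 1 * B₀ := by gcongr; exacts [hχ1 r, hB r]
      _ = B₀ := one_mul _
  have hgi : Integrable g μ := Integrable.of_bound hgc.aestronglyMeasurable B₀
      (Eventually.of_forall hgb)
  have t1 := hweak g hgc ⟨B₀, hgb⟩
  have t2 := hweak ψ hψc ⟨2, hψ2⟩
  -- comparison of the limits
  have hlim : |∫ r, g r ∂μ - ∫ x in Icc s u, b x ∂μ| ≤ B₀ * ε' := by
    have hbi : Integrable ((Icc s u).indicator b) μ := by
      rw [integrable_indicator_iff measurableSet_Icc]
      exact hb.continuousOn.integrableOn_compact isCompact_Icc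
    rw [← integral_indicator measurableSet_Icc, ← integral_sub hgi hbi, ← Real.norm_eq_abs]
    calc _ ≤ ∫ r, B₀ * ψ r ∂μ := by
          apply norm_integral_le_of_norm_le (hψi.const_mul _)
          refine Eventually.of_forall fun r => ?_
          by_cases hr : r ∈ Icc s u
          · rw [indicator_of_mem hr]
            simp only [hg, ktClamp_eq hr, sub_self, abs_zero, zero_div, sub_zero]
            simp
            exact mul_nonneg hB0 (hψ0 r)
          · rw [indicator_of_notMem hr, sub_zero, Real.norm_eq_abs]
            simp only [hg]
            rw [abs_mul, abs_of_nonneg (hχ0 r), mul_comm]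
            gcongr
            · exact hB r
            · have key : ∀ v, max 0 (1 - |r - v| / δ) ≤ ktBump δ v r := by
                intro v
                unfold ktBump
                apply max_le_max le_rfl
                apply le_min
                · have : 0 ≤ |r - v| / δ := by positivity
                  linarith
                · linarith
              have k0 := ktBump_nonneg δ s r
              have k1 := ktBump_nonneg δ u r
              rcases le_or_gt r s with h1 | h1
              · rw [ktClamp_left hsu.le h1]
                have := key s
                simp only [hψ]; linarith
              · have h2 : u ≤ r := by
                  by_contra! h2
                  exact hr ⟨h1.le, h2.le⟩
                rw [ktClamp_right hsu.le h2]
                have := key u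
                simp only [hψ]; linarith
      _ = B₀ * ∫ r, ψ r ∂μ := integral_const_mul _ _
      _ ≤ B₀ * ε' := by gcongr
  obtain ⟨n₀, hn₀⟩ := hmesh δ hδ0
  have hev3 : ∀ᶠ n in atTop, ∀ i < N n,
      |ω (ktClamp s u (t n (i+1))) - ω (ktClamp s u (t n i))| ^ p ≤ ε' := by
    have h1 : ∃ e > 0, (e : ℝ) ^ p ≤ ε' := by
      have : Tendsto (fun x : ℝ => x ^ p) (𝓝[>] 0) (𝓝 0) := by
        have := (continuous_pow p).tendsto (0:ℝ)
        rw [zero_pow hp.ne'] at this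
        exact this.mono_left nhdsWithin_le_nhds
      obtain ⟨e, he, he'⟩ := ((this.eventually_le_const hε'0).and self_mem_nhdsWithin).exists
      exact ⟨e, he', he⟩
    obtain ⟨e, he, hep⟩ := h1
    filter_upwards [kt_osc hω hsu.le hmono hmesh he] with n hn i hi
    exact (pow_le_pow_left₀ (abs_nonneg _) (hn i hi).le p).trans hep
  have hev1 := (Metric.tendsto_nhds.1 t1) (ε / 8) (by positivity)
  have hev2 := t2.eventually_lt_const hψint
  have hev : ∀ᶠ n in atTop, dist (∑ j ∈ Finset.range (N n),
      |ω (ktClamp s u (t n (j + 1))) - ω (ktClamp s u (t n j))| ^ p * b (ktClamp s u (t n j)))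
      (∫ x in Icc s u, b x ∂μ) < ε := by
    filter_upwards [hev1, hev2, hev3, eventually_ge_atTop n₀] with n h1 h2 h3 h4
    rw [Real.dist_eq] at h1 ⊢
    have hcell : |(∑ j ∈ Finset.range (N n),
      |ω (ktClamp s u (t n (j + 1))) - ω (ktClamp s u (t n j))| ^ p * b (ktClamp s u (t n j))) -
        ∑ j ∈ Finset.range (N n), |ω (t n (j + 1)) - ω (t n j)| ^ p * g (t n j)| ≤
        B₀ * (ε' + ε' * 2) := by
      rw [← Finset.sum_sub_distrib]
      refine (Finset.abs_sum_le_sum_abs _ _).trans ?_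
      refine (Finset.sum_le_sum fun j hj => kt_cell hp ω hsu (δ := δ) (hmono n j (Finset.mem_range.1 hj))
        (hn₀ n h4 j (Finset.mem_range.1 hj)) (h3 j (Finset.mem_range.1 hj)) (hB _)).trans ?_
      rw [← Finset.mul_sum]
      gcongr
      rw [Finset.sum_add_distrib, ← Finset.mul_sum, Finset.sum_add_distrib,
        Finset.sum_range_sub (fun j => if s < t n j then (1:ℝ) else 0),
        Finset.sum_range_sub (fun j => if u < t n j then (1:ℝ) else 0)]
      gcongr
      have hPQ : ∀ (P Q : Prop) [Decidable P] [Decidable Q],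
          (if P then (1:ℝ) else 0) - (if Q then 1 else 0) ≤ 1 := by
        intro P Q _ _; split_ifs <;> norm_num
      have := hPQ (s < t n (N n)) (s < t n 0)
      have := hPQ (u < t n (N n)) (u < t n 0)
      linarith
    rw [abs_le] at hcell hlim
    rw [abs_lt] at h1 ⊢
    constructor <;> linarith
  exact eventually_atTop.1 (hev.mono fun n h => h) |>.imp fun a ha n hn => ha n hn.le

open MeasureTheory Filter Set Topology

theorem kt_density {V : Type*} [NormedAddCommGroup V] [NormedSpace ℝ V]
    {T : ℝ} (hT : 0 < T) (μ : Measure ℝ) [IsFiniteMeasure μ] (hμna : ∀ x : ℝ, μ {x} = 0)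
    (dvar : ℝ → ℝ)
    (hvar : ∀ t ∈ Icc (0 : ℝ) T,
      HasDerivWithinAt (fun u => (μ (Icc 0 u)).toReal) (dvar t) (Icc (0 : ℝ) T) t)
    (hdvarc : ContinuousOn dvar (Icc (0 : ℝ) T)) {s u : ℝ} (hs : 0 ≤ s) (hsu : s ≤ u) (hu : u ≤ T)
    (b : ℝ → V) :
    ∫ x in Icc s u, b x ∂μ = ∫ r in s..u, dvar r • b r := by
  set dc : ℝ → ℝ := fun r => dvar (ktClamp 0 T r) with hdc
  have hdcc : Continuous dc := hdvarc.comp_continuous (ktClamp_cont 0 T) (ktClamp_mem hT.le)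
  have hmono : MonotoneOn (fun u => (μ (Icc 0 u)).toReal) (Icc (0:ℝ) T) := by
    intro x _ y _ hxy
    exact ENNReal.toReal_mono (measure_ne_top _ _) (measure_mono (Icc_subset_Icc_right hxy))
  have hnn : ∀ r ∈ Icc (0:ℝ) T, 0 ≤ dvar r := by
    intro r hr
    rw [← (hvar r hr).derivWithin (uniqueDiffOn_Icc hT r hr)]
    exact hmono.derivWithin_nonneg
  have hnn' : ∀ r, 0 ≤ dc r := fun r => hnn _ (ktClamp_mem hT.le r)
  set ν : Measure ℝ := (volume.restrict (Icc 0 T)).withDensity (fun x => ENNReal.ofReal (dc x))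
    with hν
  have hF : ∀ m ∈ Icc (0:ℝ) T, (μ (Icc 0 m)).toReal = ∫ r in (0:ℝ)..m, dc r := by
    intro m hm
    have h1 : ∫ r in (0:ℝ)..m, dc r = (μ (Icc 0 m)).toReal - (μ (Icc 0 0)).toReal := by
      apply intervalIntegral.integral_eq_sub_of_hasDerivAt_of_le hm.1
      · intro x hx
        have hx' : x ∈ Icc 0 T := ⟨hx.1, hx.2.trans hm.2⟩
        exact (hvar x hx').continuousWithinAt.mono (Icc_subset_Icc_right hm.2)
      · intro x hx
        have hx' : x ∈ Icc 0 T := ⟨hx.1.le, hx.2.le.trans hm.2⟩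
        have h2 := (hvar x hx').hasDerivAt (Icc_mem_nhds hx.1 (hx.2.trans_le hm.2))
        simp only [hdc, ktClamp_eq hx']
        exact h2
      · exact hdcc.intervalIntegrable _ _
    rw [h1]; simp [hμna]
  have key : μ.restrict (Icc 0 T) = ν := by
    apply Measure.ext_of_Iic
    intro a
    rw [hν, withDensity_apply _ measurableSet_Iic, Measure.restrict_restrict measurableSet_Iic,
      Measure.restrict_apply measurableSet_Iic]
    have e : Iic a ∩ Icc 0 T = Icc 0 (min a T) := by
      ext x; simp only [mem_inter_iff, mem_Iic, mem_Icc, le_min_iff]; tauto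
    rw [e]
    rcases lt_or_ge (min a T) 0 with h | h
    · rw [Icc_eq_empty (not_le.2 h)]; simp
    · have h1 := hF (min a T) ⟨h, min_le_right _ _⟩
      rw [← ofReal_integral_eq_lintegral_ofReal
        (hdcc.continuousOn.integrableOn_compact isCompact_Icc)
        (Eventually.of_forall hnn'), integral_Icc_eq_integral_Ioc,
        ← intervalIntegral.integral_of_le h, ← h1, ENNReal.ofReal_toReal (measure_ne_top _ _)]
  have hsub : Icc s u ⊆ Icc 0 T := Icc_subset_Icc hs hu
  rw [← Measure.restrict_restrict_of_subset hsub, key, hν,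
    setIntegral_withDensity_eq_setIntegral_toReal_smul (by fun_prop)
      (Eventually.of_forall fun x => ENNReal.ofReal_lt_top) _ measurableSet_Icc,
    Measure.restrict_restrict_of_subset hsub, integral_Icc_eq_integral_Ioc,
    ← intervalIntegral.integral_of_le hsu]
  apply intervalIntegral.integral_congr
  intro r hr
  rw [uIcc_of_le hsu] at hr
  have e : dc r = dvar r := by simp only [hdc, ktClamp_eq (hsub hr)]
  change (ENNReal.ofReal (dc r)).toReal • b r = dvar r • b r
  rw [ENNReal.toReal_ofReal (hnn' r), e]

theorem kt_approx {V : Type*} [NormedAddCommGroup V] [NormedSpace ℝ V] {s u : ℝ} (hsu : s < u)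
    (b : ℝ → V) (hb : Continuous b) {ε : ℝ} (hε : 0 < ε) :
    ∃ (m : ℕ) (φ : Fin m → ℝ → ℝ) (v : Fin m → V), (∀ k, Continuous (φ k)) ∧
      ∀ r ∈ Icc s u, ‖∑ k, φ k r • v k - b r‖ ≤ ε := by
  let h : C(unitInterval, V) := ⟨fun x => b (s + (u - s) * x), by fun_prop⟩
  have h1 := (Metric.tendsto_nhds.1 (bernsteinApproximation_uniform h)) ε hε
  obtain ⟨n, hn⟩ := h1.exists
  let q : ℝ → unitInterval := fun r => projIcc 0 1 zero_le_one ((r - s) / (u - s))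
  have hq : Continuous q := continuous_projIcc.comp (by fun_prop)
  refine ⟨n + 1, fun k r => bernstein n k (q r), fun k => h (bernstein.z k),
    fun k => (bernstein n k).continuous.comp hq, fun r hr => ?_⟩
  have hus : 0 < u - s := by linarith
  have hr' : (r - s) / (u - s) ∈ Icc (0:ℝ) 1 :=
    ⟨div_nonneg (by linarith [hr.1]) hus.le, (div_le_one hus).2 (by linarith [hr.2])⟩
  have e : b r = h (q r) := by
    change b r = b (s + (u - s) * (q r : ℝ))
    simp only [q, projIcc_of_mem zero_le_one hr']
    congr 1
    field_simp
    ring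
  rw [e, ← bernsteinApproximation.apply, ← dist_eq_norm]
  exact (ContinuousMap.dist_apply_le_dist _).trans hn.le

theorem kt_vector {V : Type*} [NormedAddCommGroup V] [NormedSpace ℝ V] [CompleteSpace V]
    (μ : Measure ℝ) [IsFiniteMeasure μ]
    {N : ℕ → ℕ} {a τ : ℕ → ℕ → ℝ} {s u : ℝ} (hsu : s < u)
    (ha : ∀ n j, 0 ≤ a n j) (hτ : ∀ n j, τ n j ∈ Icc s u)
    (hsc : ∀ b : ℝ → ℝ, Continuous b →
      Tendsto (fun n => ∑ j ∈ Finset.range (N n), a n j * b (τ n j)) atTop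
        (𝓝 (∫ x in Icc s u, b x ∂μ))) (b : ℝ → V) (hb : Continuous b) :
    Tendsto (fun n => ∑ j ∈ Finset.range (N n), a n j • b (τ n j)) atTop
        (𝓝 (∫ x in Icc s u, b x ∂μ)) := by
  have h1 := hsc (fun _ => 1) continuous_const
  simp only [mul_one] at h1
  set K : ℝ := ∫ x in Icc s u, (1:ℝ) ∂μ with hK
  have hK0 : 0 ≤ K := integral_nonneg fun _ => zero_le_one
  rw [Metric.tendsto_nhds]
  intro ε hε
  set ε' := ε / (4 * (K + 1)) with hε'
  have hε'0 : 0 < ε' := by positivity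
  have hε'K : (K + 1) * ε' = ε / 4 := by rw [hε']; field_simp
  obtain ⟨m, φ, v, hφ, hφb⟩ := kt_approx hsu b hb hε'0
  have iir : ∀ (f : ℝ → ℝ), Continuous f →
      IntegrableOn f (Icc s u) μ := fun f hf =>
    hf.continuousOn.integrableOn_compact isCompact_Icc
  have ii : ∀ (f : ℝ → V), Continuous f →
      IntegrableOn f (Icc s u) μ := fun f hf =>
    hf.continuousOn.integrableOn_compact isCompact_Icc
  have t2 : Tendsto (fun n => ∑ j ∈ Finset.range (N n), a n j • ∑ k, φ k (τ n j) • v k) atTop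
      (𝓝 (∫ x in Icc s u, ∑ k, φ k x • v k ∂μ)) := by
    have e1 : ∫ x in Icc s u, ∑ k, φ k x • v k ∂μ = ∑ k, (∫ x in Icc s u, φ k x ∂μ) • v k := by
      rw [integral_finsetSum]
      · simp only [integral_smul_const]
      · intro k _
        exact (iir (φ k) (hφ k)).smul_const _
    rw [e1]
    have e2 : ∀ n, ∑ j ∈ Finset.range (N n), a n j • ∑ k, φ k (τ n j) • v k =
        ∑ k, (∑ j ∈ Finset.range (N n), a n j * φ k (τ n j)) • v k := by
      intro n
      simp only [Finset.smul_sum, Finset.sum_smul, smul_smul]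
      rw [Finset.sum_comm]
    simp only [e2]
    exact tendsto_finsetSum _ fun k _ => (hsc (φ k) (hφ k)).smul_const _
  have hφc : Continuous fun x => ∑ k, φ k x • v k := by
    apply continuous_finsetSum
    intro k _
    exact (hφ k).smul continuous_const
  have hI : ‖(∫ x in Icc s u, ∑ k, φ k x • v k ∂μ) - ∫ x in Icc s u, b x ∂μ‖ ≤ ε' * K := by
    rw [← integral_sub (ii _ hφc) (ii _ hb)]
    calc _ ≤ ∫ x in Icc s u, ε' * 1 ∂μ := by
          apply norm_integral_le_of_norm_le
          · exact integrable_const _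
          · rw [ae_restrict_iff' measurableSet_Icc]
            exact Eventually.of_forall fun r hr => by rw [mul_one]; exact hφb r hr
      _ = ε' * K := integral_const_mul _ _
  filter_upwards [Metric.tendsto_nhds.1 t2 (ε / 4) (by positivity),
    h1.eventually_lt_const (lt_add_one K)] with n hn1 hn2
  rw [dist_eq_norm] at hn1 ⊢
  have hS : ‖(∑ j ∈ Finset.range (N n), a n j • b (τ n j)) -
      ∑ j ∈ Finset.range (N n), a n j • ∑ k, φ k (τ n j) • v k‖ ≤ ε' * (K + 1) := by
    rw [← Finset.sum_sub_distrib]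
    refine (norm_sum_le _ _).trans ?_
    calc _ ≤ ∑ j ∈ Finset.range (N n), ε' * a n j := by
          apply Finset.sum_le_sum
          intro j _
          rw [← smul_sub, norm_smul, Real.norm_eq_abs, abs_of_nonneg (ha n j), mul_comm, norm_sub_rev]
          exact mul_le_mul_of_nonneg_right (hφb _ (hτ n j)) (ha n j)
      _ = ε' * ∑ j ∈ Finset.range (N n), a n j := by rw [Finset.mul_sum]
      _ ≤ _ := by gcongr
  have e3 : (∑ j ∈ Finset.range (N n), a n j • b (τ n j)) - ∫ x in Icc s u, b x ∂μ =
    ((∑ j ∈ Finset.range (N n), a n j • b (τ n j)) -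
      ∑ j ∈ Finset.range (N n), a n j • ∑ k, φ k (τ n j) • v k) +
    ((∑ j ∈ Finset.range (N n), a n j • ∑ k, φ k (τ n j) • v k) -
      ∫ x in Icc s u, ∑ k, φ k x • v k ∂μ) +
    ((∫ x in Icc s u, ∑ k, φ k x • v k ∂μ) - ∫ x in Icc s u, b x ∂μ) := by abel
  rw [e3]
  refine (norm_add₃_le).trans_lt ?_
  nlinarith

theorem kt_taylor {V : Type*} [NormedAddCommGroup V] [NormedSpace ℝ V] (p : ℕ) :
    ∀ (g : ℕ → ℝ → V) (_ : ∀ k, k < p → ∀ x, HasDerivAt (g k) (g (k + 1) x) x) (a b ε : ℝ)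
    (_ : ∀ x ∈ uIcc a b, ‖g p x - g p a‖ ≤ ε),
    ‖g 0 b - ∑ k ∈ Finset.range (p + 1), ((k.factorial : ℝ)⁻¹ * (b - a) ^ k) • g k a‖ ≤
      ε * |b - a| ^ p := by
  induction p with
  | zero =>
    intro g _ a b ε h
    simpa using h b right_mem_uIcc
  | succ p ih =>
    intro g hg a b ε h
    have hε : 0 ≤ ε := (norm_nonneg _).trans (h a left_mem_uIcc)
    set S : ℝ → V := fun x =>
      g 0 x - ∑ k ∈ Finset.range (p + 2), ((k.factorial : ℝ)⁻¹ * (x - a) ^ k) • g k a with hS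
    set S' : ℝ → V := fun x =>
      g 1 x - ∑ k ∈ Finset.range (p + 1), ((k.factorial : ℝ)⁻¹ * (x - a) ^ k) • g (k + 1) a
      with hS'
    have hd : ∀ x, HasDerivAt S (S' x) x := by
      intro x
      refine (hg 0 (by omega) x).sub ?_
      have e : (fun x : ℝ => ∑ k ∈ Finset.range (p + 2),
          ((k.factorial : ℝ)⁻¹ * (x - a) ^ k) • g k a) = fun x : ℝ =>
          (∑ k ∈ Finset.range (p + 1),
          (((k + 1).factorial : ℝ)⁻¹ * (x - a) ^ (k + 1)) • g (k + 1) a) + g 0 a := by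
        funext x
        rw [Finset.sum_range_succ']
        simp
      rw [e]
      apply HasDerivAt.add_const
      apply HasDerivAt.fun_sum
      intro k _
      have h1 : HasDerivAt (fun x : ℝ => (x - a) ^ (k + 1)) (((k + 1 : ℕ) : ℝ) * (x - a) ^ k * 1) x := by
        exact ((hasDerivAt_id x).sub_const a).pow (k + 1)
      have h2 := (h1.const_mul (((k + 1).factorial : ℝ)⁻¹)).smul_const (g (k + 1) a)
      convert h2 using 2
      rw [Nat.factorial_succ]
      push_cast
      have : (k.factorial : ℝ) ≠ 0 := by positivity
      have : (k : ℝ) + 1 ≠ 0 := by positivity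
      field_simp
    have hb' : ∀ x ∈ uIcc a b, ‖S' x‖ ≤ ε * |b - a| ^ p := by
      intro x hx
      have hsub : uIcc a x ⊆ uIcc a b := uIcc_subset_uIcc_left hx
      have h1 := ih (fun k => g (k + 1)) (fun k hk => hg (k + 1) (by omega)) a x ε
        (fun y hy => h y (hsub hy))
      refine h1.trans ?_
      exact mul_le_mul_of_nonneg_left
        (pow_le_pow_left₀ (abs_nonneg _) (abs_sub_left_of_mem_uIcc hx) p) hε
    have h3 := (convex_uIcc a b).norm_image_sub_le_of_norm_hasDerivWithin_le
      (fun x _ => (hd x).hasDerivWithinAt) hb' left_mem_uIcc right_mem_uIcc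
    have h4 : S a = 0 := by
      simp only [hS]
      rw [Finset.sum_range_succ']
      simp
    rw [h4, sub_zero, Real.norm_eq_abs, mul_assoc, ← pow_succ] at h3
    exact h3

open MeasureTheory Filter Set Topology

theorem kt_sum_split {V : Type*} [AddCommGroup V] {p : ℕ} (hp : 0 < p) (F : ℕ → V) :
    ∑ k ∈ Finset.range (p + 1), F k = F 0 + ∑ k ∈ Finset.Icc 1 (p - 1), F k + F p := by
  rw [Finset.sum_range_succ, Finset.range_eq_Ico, Finset.sum_eq_sum_Ico_succ_bot hp]
  congr 3

theorem kt_ito {V : Type*} [NormedAddCommGroup V] [NormedSpace ℝ V] [CompleteSpace V]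
    {p : ℕ} (hp : 0 < p) (hpe : Even p) {ω : ℝ → ℝ} (hω : Continuous ω)
    {N : ℕ → ℕ} {t : ℕ → ℕ → ℝ}
    (hmono : ∀ n i, i < N n → t n i < t n (i + 1))
    (hmesh : ∀ ε > 0, ∃ n₀ : ℕ, ∀ n ≥ n₀, ∀ i < N n, t n (i + 1) - t n i < ε)
    (μ : Measure ℝ) [IsFiniteMeasure μ] (hμna : ∀ x : ℝ, μ {x} = 0)
    (hweak : ∀ g : ℝ → ℝ, Continuous g → (∃ M : ℝ, ∀ x, |g x| ≤ M) →
      Tendsto (fun n => ∑ j ∈ Finset.range (N n),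
          |ω (t n (j + 1)) - ω (t n j)| ^ p * g (t n j)) atTop (𝓝 (∫ x, g x ∂μ)))
    {s u : ℝ} (hsu : s < u) (ht0 : ∀ n, t n 0 ≤ s) (htN : ∀ n, u ≤ t n (N n))
    (f2 : ℕ → ℝ → ℝ → V) (f1 : ℝ → ℝ → V)
    (hf2 : ∀ k, k < p → ∀ r x : ℝ, HasDerivAt (f2 k r) (f2 (k + 1) r x) x)
    (hf2c : Continuous fun q : ℝ × ℝ => f2 p q.1 q.2)
    (hf1c : Continuous fun q : ℝ × ℝ => f1 q.1 q.2)
    (htime : ∀ a b : ℝ, s ≤ a → a ≤ b → b ≤ u → ∀ x,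
      f2 0 b x - f2 0 a x = ∫ r in a..b, f1 r x) :
    Tendsto (fun n => ∑ j ∈ Finset.range (N n), ∑ k ∈ Finset.Icc 1 (p - 1),
      ((k.factorial : ℝ)⁻¹ *
        (ω (ktClamp s u (t n (j + 1))) - ω (ktClamp s u (t n j))) ^ k) •
          f2 k (ktClamp s u (t n j)) (ω (ktClamp s u (t n j)))) atTop
      (𝓝 (f2 0 u (ω u) - f2 0 s (ω s) - (∫ r in s..u, f1 r (ω r)) -
        (p.factorial : ℝ)⁻¹ • ∫ x in Icc s u, f2 p x (ω x) ∂μ - 0)) := by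
  set τ : ℕ → ℕ → ℝ := fun n j => ktClamp s u (t n j) with hτ
  have hτm : ∀ n j, τ n j ∈ Icc s u := fun n j => ktClamp_mem hsu.le _
  have hτ0 : ∀ n, τ n 0 = s := fun n => ktClamp_left hsu.le (ht0 n)
  have hτN : ∀ n, τ n (N n) = u := fun n => ktClamp_right hsu.le (htN n)
  have hτmono : ∀ n j, j < N n → τ n j ≤ τ n (j + 1) := fun n j hj =>
    ktClamp_mono _ _ (hmono n j hj).le
  set a : ℕ → ℕ → ℝ := fun n j => |ω (τ n (j + 1)) - ω (τ n j)| ^ p with ha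
  have ha0 : ∀ n j, 0 ≤ a n j := fun n j => by positivity
  have hsc : ∀ b : ℝ → ℝ, Continuous b →
      Tendsto (fun n => ∑ j ∈ Finset.range (N n), a n j * b (τ n j)) atTop
        (𝓝 (∫ x in Icc s u, b x ∂μ)) := fun b hb =>
    kt_scalar hp hω hmono hmesh μ hμna hweak hsu b hb
  have hvec := kt_vector μ hsu ha0 hτm hsc (fun r => f2 p r (ω r))
    (hf2c.comp (continuous_id.prodMk hω))
  have hone := hsc (fun _ => 1) continuous_const
  simp only [mul_one] at hone
  set K : ℝ := ∫ x in Icc s u, (1:ℝ) ∂μ with hK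
  have hK0 : 0 ≤ K := integral_nonneg fun _ => zero_le_one
  -- the time part
  have htm : Tendsto (fun n => ∑ j ∈ Finset.range (N n),
      ∫ r in (τ n j)..(τ n (j + 1)), f1 r (ω (τ n (j + 1)))) atTop
      (𝓝 (∫ r in s..u, f1 r (ω r))) := by
    have hΦ : Continuous fun q : ℝ × ℝ => f1 q.1 (ω q.2) :=
      hf1c.comp (continuous_fst.prodMk (hω.comp continuous_snd))
    have hU := (isCompact_Icc.prod isCompact_Icc :
      IsCompact (Icc s u ×ˢ Icc s u)).uniformContinuousOn_of_continuous hΦ.continuousOn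
    rw [Metric.uniformContinuousOn_iff] at hU
    rw [Metric.tendsto_nhds]
    intro ε hε
    set ε' := ε / (2 * (u - s)) with hε'
    have hus : 0 < u - s := by linarith
    have hε'0 : 0 < ε' := by positivity
    have hε'u : ε' * (u - s) = ε / 2 := by rw [hε']; field_simp
    obtain ⟨δ, hδ, hU⟩ := hU ε' hε'0
    obtain ⟨n₀, hn₀⟩ := hmesh δ hδ
    filter_upwards [eventually_ge_atTop n₀] with n hn
    have hc1 : Continuous fun r => f1 r (ω r) := hf1c.comp (continuous_id.prodMk hω)
    have hc2 : ∀ x, Continuous fun r => f1 r x := fun x =>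
      hf1c.comp (continuous_id.prodMk continuous_const)
    have e1 := intervalIntegral.sum_integral_adjacent_intervals (f := fun r => f1 r (ω r))
      (μ := volume) (a := τ n) (n := N n) (fun k _ => hc1.intervalIntegrable _ _)
    rw [hτ0, hτN] at e1
    rw [← e1, dist_eq_norm, ← Finset.sum_sub_distrib]
    refine (norm_sum_le _ _).trans_lt ?_
    calc _ ≤ ∑ j ∈ Finset.range (N n), ε' * (τ n (j + 1) - τ n j) := by
          apply Finset.sum_le_sum
          intro j hj
          have hj := Finset.mem_range.1 hj
          rw [← intervalIntegral.integral_sub ((hc2 _).intervalIntegrable _ _)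
            (hc1.intervalIntegrable _ _)]
          have h0 := hτmono n j hj
          rw [← abs_of_nonneg (sub_nonneg.2 h0)]
          apply intervalIntegral.norm_integral_le_of_norm_le_const
          intro r hr
          rw [uIoc_of_le h0] at hr
          have hr' : r ∈ Icc s u := ⟨(hτm n j).1.trans hr.1.le, hr.2.trans (hτm n (j+1)).2⟩
          rw [← dist_eq_norm]
          refine (hU (r, τ n (j + 1)) ⟨hr', hτm n _⟩ (r, r) ⟨hr', hr'⟩ ?_).le
          rw [Prod.dist_eq, dist_self, Real.dist_eq]
          apply max_lt hδ
          rw [abs_of_nonneg (by linarith [hr.2])]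
          have := ktClamp_lip s u _ _ (hmono n j hj).le
          have := hn₀ n hn j hj
          have := hr.1
          simp only [hτ] at *
          linarith
      _ = ε' * (u - s) := by
          rw [← Finset.mul_sum, Finset.sum_range_sub (τ n), hτ0, hτN]
      _ < ε := by linarith
  -- the remainder
  set rem : ℕ → ℕ → V := fun n j => f2 0 (τ n j) (ω (τ n (j + 1))) -
    ∑ k ∈ Finset.range (p + 1), ((k.factorial : ℝ)⁻¹ *
        (ω (τ n (j + 1)) - ω (τ n j)) ^ k) • f2 k (τ n j) (ω (τ n j)) with hrem
  have hrm : Tendsto (fun n => ∑ j ∈ Finset.range (N n), rem n j) atTop (𝓝 0) := by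
    obtain ⟨Kω, hKω⟩ := (isCompact_Icc (a := s) (b := u)).exists_bound_of_continuousOn
      hω.continuousOn
    have hU := (isCompact_Icc.prod isCompact_Icc :
      IsCompact (Icc s u ×ˢ Icc (-Kω) Kω)).uniformContinuousOn_of_continuous hf2c.continuousOn
    rw [Metric.uniformContinuousOn_iff] at hU
    rw [Metric.tendsto_nhds]
    intro ε hε
    set ε' := ε / (2 * (K + 1)) with hε'
    have hε'0 : 0 < ε' := by positivity
    have hε'u : ε' * (K + 1) = ε / 2 := by rw [hε']; field_simp
    obtain ⟨δ, hδ, hU⟩ := hU ε' hε'0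
    filter_upwards [kt_osc hω hsu.le hmono hmesh hδ, hone.eventually_lt_const (lt_add_one K)]
      with n hn1 hn2
    rw [dist_zero_right]
    refine (norm_sum_le _ _).trans_lt ?_
    calc _ ≤ ∑ j ∈ Finset.range (N n), ε' * a n j := by
          apply Finset.sum_le_sum
          intro j hj
          have hj := Finset.mem_range.1 hj
          apply kt_taylor p (fun k => f2 k (τ n j)) (fun k hk x => hf2 k hk _ x)
          intro x hx
          have h1 : |x - ω (τ n j)| < δ :=
            (abs_sub_left_of_mem_uIcc hx).trans_lt (hn1 j hj)
          have m1 : ω (τ n j) ∈ Icc (-Kω) Kω := abs_le.1 (hKω _ (hτm n j))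
          have m2 : ω (τ n (j+1)) ∈ Icc (-Kω) Kω := abs_le.1 (hKω _ (hτm n (j+1)))
          have m3 : x ∈ Icc (-Kω) Kω := uIcc_subset_Icc m1 m2 hx
          rw [← dist_eq_norm]
          refine (hU (τ n j, x) ⟨hτm n j, m3⟩ (τ n j, ω (τ n j)) ⟨hτm n j, m1⟩ ?_).le
          rw [Prod.dist_eq, dist_self, Real.dist_eq]
          exact max_lt hδ h1
      _ = ε' * ∑ j ∈ Finset.range (N n), a n j := by rw [Finset.mul_sum]
      _ ≤ ε' * (K + 1) := by gcongr
      _ < ε := by linarith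
  have hfin := (((tendsto_const_nhds (x := f2 0 u (ω u) - f2 0 s (ω s))
    (f := (atTop : Filter ℕ))).sub htm).sub (hvec.const_smul ((p.factorial : ℝ)⁻¹))).sub hrm
  refine hfin.congr fun n => ?_
  have etel : f2 0 u (ω u) - f2 0 s (ω s) = ∑ j ∈ Finset.range (N n),
      (f2 0 (τ n (j + 1)) (ω (τ n (j + 1))) - f2 0 (τ n j) (ω (τ n j))) := by
    rw [Finset.sum_range_sub (fun j => f2 0 (τ n j) (ω (τ n j))), hτ0, hτN]
  rw [etel, Finset.smul_sum, ← Finset.sum_sub_distrib, ← Finset.sum_sub_distrib,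
    ← Finset.sum_sub_distrib]
  apply Finset.sum_congr rfl
  intro j hj
  have hj := Finset.mem_range.1 hj
  rw [← htime _ _ (hτm n j).1 (hτmono n j hj) (hτm n (j+1)).2]
  simp only [hrem]
  rw [kt_sum_split hp]
  have e5 : (ω (τ n (j + 1)) - ω (τ n j)) ^ p = a n j := by rw [ha]; exact (hpe.pow_abs _).symm
  rw [e5]
  simp only [Nat.factorial_zero, Nat.cast_one, inv_one, pow_zero, mul_one, one_smul, smul_smul]
  abel

/-- the hyperbolic non-commutative case: under hypotheses (h1)–(h8), for every
`s ∈ [0,T)` and `x₀ ∈ Y` there is a strong solution of `dX = AX dt + BX d^π ω`, `X(s) = x₀`,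
taking values in `Y`. -/
theorem statement4
    {V : Type*} [NormedAddCommGroup V] [InnerProductSpace ℝ V] [CompleteSpace V]
    {Y : Type*} [NormedAddCommGroup Y] [InnerProductSpace ℝ Y] [CompleteSpace Y]
    (p : ℕ) (hp : 0 < p) (hpeven : Even p)
    (T : ℝ) (hT : 0 < T)
    (π : ℕ → IntervalPartition 0 T)
    (hmesh : ∀ ε > 0, ∃ n₀ : ℕ, ∀ n ≥ n₀, ∀ i < (π n).N, (π n).t (i + 1) - (π n).t i < ε)
    (ω : ℝ → ℝ) (hω : ContinuousOn ω (Icc 0 T))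
    -- `ω` has finite `p`-th variation along `π`, with non-atomic limit measure `μ`:
    (μ : Measure ℝ) [IsFiniteMeasure μ] (hμna : ∀ x : ℝ, μ {x} = 0)
    (hweak : ∀ g : ℝ → ℝ, Continuous g → (∃ M : ℝ, ∀ x, |g x| ≤ M) →
      Tendsto (fun n => ∑ j ∈ Finset.range (π n).N,
          |ω ((π n).t (j + 1)) - ω ((π n).t j)| ^ p * g ((π n).t j)) atTop
        (𝓝 (∫ x, g x ∂μ)))
    -- (h1): `[ω]_p^π` is continuously differentiable with derivative `dvar`:
    (dvar : ℝ → ℝ)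
    (hvar : ∀ t ∈ Icc (0 : ℝ) T,
      HasDerivWithinAt (fun u => (μ (Icc 0 u)).toReal) (dvar t) (Icc (0 : ℝ) T) t)
    (hdvarc : ContinuousOn dvar (Icc (0 : ℝ) T))
    -- (h2): the strongly continuous group `G` and its infinitesimal generator `B`:
    (G : ℝ → V →L[ℝ] V)
    (hG0 : G 0 = ContinuousLinearMap.id ℝ V)
    (hGadd : ∀ x y : ℝ, G (x + y) = (G x).comp (G y))
    (hGcont : ∀ v : V, Continuous fun x : ℝ => G x v)
    (domB : Set V) (B : V → V)
    (hdomB : ∀ v : V, v ∈ domB ↔ ∃ w : V, HasDerivAt (fun τ : ℝ => G τ v) w 0)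
    (hBgen : ∀ v ∈ domB, HasDerivAt (fun τ : ℝ => G τ v) (B v) 0)
    -- (h3): `‖G_B(x)‖ ≤ 1` on `V`:
    (hGnorm : ∀ x : ℝ, ‖G x‖ ≤ 1)
    -- `Y` continuously and densely embedded in `V`:
    (ι : Y →L[ℝ] V) (hι_inj : Function.Injective ι) (hι_dense : DenseRange ι)
    -- (h4), (h5): `G_B(x) Y ⊆ Y` with induced operators `GY` of norm `≤ 1`:
    (GY : ℝ → Y →L[ℝ] Y)
    (hGY : ∀ (x : ℝ) (y : Y), ι (GY x y) = G x (ι y))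
    (hGYnorm : ∀ x : ℝ, ‖GY x‖ ≤ 1)
    -- the linear operator `A` on `domA`:
    (domA : Set V) (A : V → V)
    (hdomA_add : ∀ x ∈ domA, ∀ y ∈ domA, x + y ∈ domA)
    (hdomA_smul : ∀ (a : ℝ), ∀ x ∈ domA, a • x ∈ domA)
    (hA_add : ∀ x ∈ domA, ∀ y ∈ domA, A (x + y) = A x + A y)
    (hA_smul : ∀ (a : ℝ), ∀ x ∈ domA, A (a • x) = a • A x)
    -- (h6): `Y ⊆ Dom C = Dom A ∩ Dom B^p` and `C(t) = A − (1/p!)·dvar(t)·B^p` is closed: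
    (hYsub : ∀ y : Y, ι y ∈ domA ∩ iterDom B domB p)
    (hCclosed : ∀ t ∈ Icc (0 : ℝ) T, ∀ (u : ℕ → V) (x w : V),
      (∀ n, u n ∈ domA ∩ iterDom B domB p) →
      Tendsto u atTop (𝓝 x) →
      Tendsto (fun n => A (u n) - ((p.factorial : ℝ)⁻¹ * dvar t) • B^[p] (u n)) atTop (𝓝 w) →
      x ∈ domA ∩ iterDom B domB p ∧ A x - ((p.factorial : ℝ)⁻¹ * dvar t) • B^[p] x = w)
    -- (h7): resolvent estimate `‖(λ − C(t))⁻¹‖ ≤ 1/(λ − λ₁)` for `λ > λ₁`: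
    (lam₁ : ℝ)
    (hres : ∀ t ∈ Icc (0 : ℝ) T, ∀ lam : ℝ, lam₁ < lam →
      ∃ R : V →L[ℝ] V, ‖R‖ ≤ (lam - lam₁)⁻¹ ∧
        (∀ x ∈ domA ∩ iterDom B domB p,
          R (lam • x - (A x - ((p.factorial : ℝ)⁻¹ * dvar t) • B^[p] x)) = x) ∧
        ∀ w : V, R w ∈ domA ∩ iterDom B domB p ∧
          lam • R w - (A (R w) - ((p.factorial : ℝ)⁻¹ * dvar t) • B^[p] (R w)) = w)
    -- (h8): the isomorphism `Q : Y → V`: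
    (Q : Y ≃L[ℝ] V)
    -- (h8)(a): `C(t) Q⁻¹ (Dom C) ⊆ Y`:
    (hQa : ∀ t ∈ Icc (0 : ℝ) T, ∀ x ∈ domA ∩ iterDom B domB p,
      A (ι (Q.symm x)) - ((p.factorial : ℝ)⁻¹ * dvar t) • B^[p] (ι (Q.symm x)) ∈ Set.range ι)
    -- (h8)(b): `Q G_B(x) = G_B(x) Q` on `Y`:
    (hQb : ∀ (x : ℝ) (y : Y), Q (GY x y) = G x (Q y))
    -- (h8)(c): `Q C(t) Q⁻¹ = C(t) + L(t)` on `Dom C`, `L` strongly continuous and bounded: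
    (L : ℝ → V →L[ℝ] V)
    (hLcont : ∀ w : V, ContinuousOn (fun t : ℝ => L t w) (Icc (0 : ℝ) T))
    (hQc : ∀ t ∈ Icc (0 : ℝ) T, ∀ x ∈ domA ∩ iterDom B domB p,
      ∃ w : Y, ι w = A (ι (Q.symm x)) - ((p.factorial : ℝ)⁻¹ * dvar t) • B^[p] (ι (Q.symm x)) ∧
        Q w = (A x - ((p.factorial : ℝ)⁻¹ * dvar t) • B^[p] x) + L t x) :
    ∀ s ∈ Ico (0 : ℝ) T, ∀ x₀ : Y,
      ∃ X : ℝ → V,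
        X s = ι x₀ ∧
        (∀ t ∈ Icc s T, X t ∈ Set.range ι) ∧
        (∀ t ∈ Icc s T, X t ∈ domA ∧ X t ∈ domB) ∧
        IntervalIntegrable (fun r => A (X r)) volume s T ∧
        ∃ F : C1p s T p V,
          (∀ r ∈ Icc s T, F.f2 1 r (ω r) = B (X r)) ∧
          ∀ t ∈ Ioc s T, ∃ I : V,
            Tendsto (fun n => ∑ j ∈ Finset.range (π n).N, ∑ k ∈ Finset.Icc 1 (p - 1),
                ((k.factorial : ℝ)⁻¹ *
                  (ω (min (max ((π n).t (j + 1)) s) t)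
                    - ω (min (max ((π n).t j) s) t)) ^ k) •
                  F.f2 k (max ((π n).t j) s) (ω (max ((π n).t j) s))) atTop (𝓝 I) ∧
            X t = ι x₀ + (∫ r in s..t, A (X r)) + I := by
  intro s hs x₀
  have hs0 : 0 ≤ s := hs.1
  have hsT : s < T := hs.2
  set o : ℝ → ℝ := fun r => ω (ktClamp 0 T r) with ho
  have hoc : Continuous o := hω.comp_continuous (ktClamp_cont 0 T) (ktClamp_mem hT.le)
  have hoeq : ∀ r ∈ Icc (0:ℝ) T, o r = ω r := fun r hr => by simp only [ho, ktClamp_eq hr]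
  have hsub : ∀ r ∈ Icc s T, r ∈ Icc (0:ℝ) T := fun r hr => ⟨hs0.trans hr.1, hr.2⟩
  set cc : ℝ → ℝ := fun r => (p.factorial : ℝ)⁻¹ * dvar (ktClamp 0 T r) with hcc
  have hccc : Continuous cc := continuous_const.mul
    (hdvarc.comp_continuous (ktClamp_cont 0 T) (ktClamp_mem hT.le))
  have hcceq : ∀ r ∈ Icc (0:ℝ) T, cc r = (p.factorial : ℝ)⁻¹ * dvar r := fun r hr => by
    simp only [hcc, ktClamp_eq hr]
  obtain ⟨Bk, hBk⟩ := kt_Bk p G hG0 domB B hBgen ι (fun y k hk => (hYsub y).2 k hk)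
  obtain ⟨AY, hAY⟩ := kt_AY ι (domA ∩ iterDom B domB p) domA inter_subset_left A (B^[p])
    ((p.factorial : ℝ)⁻¹ * dvar 0) hA_add hA_smul hYsub (Bk p) (hBk p le_rfl)
    (hCclosed 0 ⟨le_rfl, hT.le⟩)
  obtain ⟨y, hyc, hy⟩ := kt_build T hT o hoc.continuousOn cc hccc.continuousOn G hG0 hGadd hGcont
    hGnorm ι hι_dense GY hGY hGYnorm (domA ∩ iterDom B domB p) A (B^[p]) hYsub AY (Bk p) hAY
    (hBk p le_rfl) lam₁ (by
      intro t ht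
      rw [hcceq t ht]
      exact hres t ht) Q hQb L hLcont (by
      intro t ht
      rw [hcceq t ht]
      exact hQc t ht) s hs x₀
  have hGjoint : ∀ {α : Type} [TopologicalSpace α] (h : α → ℝ) (f : α → V), Continuous h →
      Continuous f → Continuous fun a => G (h a) (f a) := by
    intro α _ h f hh hf
    exact kt_strong_apply (fun a => G (h a)) 1 (fun a v => kt_G_le G hGnorm (h a) v)
      (fun v => (hGcont v).comp hh) hf
  have hGYc : Continuous fun r => GY (o r) (y r) := by
    have h1 : (fun r => GY (o r) (y r)) = fun r => Q.symm (G (o r) (Q (y r))) := by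
      funext r
      rw [← hQb, Q.symm_apply_apply]
    rw [h1]
    exact Q.symm.continuous.comp (hGjoint o _ hoc (Q.continuous.comp hyc))
  set g : ℝ → V := fun r => AY (GY (o r) (y r)) - cc r • Bk p (GY (o r) (y r)) with hg
  have hgc : Continuous g :=
    (AY.continuous.comp hGYc).sub (hccc.smul ((Bk p).continuous.comp hGYc))
  set f1 : ℝ → ℝ → V := fun r x => G x (G (-o r) (g r)) with hf1
  set f2 : ℕ → ℝ → ℝ → V := fun k r x => G x (Bk k (y r)) with hf2
  have hGgc : Continuous fun r => G (-o r) (g r) := hGjoint (fun r => -o r) _ hoc.neg hgc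
  have hf1c : Continuous fun q : ℝ × ℝ => f1 q.1 q.2 :=
    hGjoint (fun q : ℝ × ℝ => q.2) (fun q => G (-o q.1) (g q.1)) continuous_snd
      (hGgc.comp continuous_fst)
  have hf2c : Continuous fun q : ℝ × ℝ => f2 p q.1 q.2 :=
    hGjoint (fun q : ℝ × ℝ => q.2) (fun q => Bk p (y q.1)) continuous_snd
      ((Bk p).continuous.comp (hyc.comp continuous_fst))
  have hB0 : ∀ z, Bk 0 z = ι z := fun z => hBk 0 (Nat.zero_le _) z
  have hBs : ∀ k < p, ∀ z, Bk (k + 1) z = B (Bk k z) := by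
    intro k hk z
    rw [hBk (k + 1) hk, hBk k hk.le, Function.iterate_succ_apply']
  have hBd : ∀ k < p, ∀ z, Bk k z ∈ domB := by
    intro k hk z
    rw [hBk k hk.le]
    exact (hYsub z).2 k hk
  have hf2d : ∀ k, k < p → ∀ r x : ℝ, HasDerivAt (f2 k r) (f2 (k + 1) r x) x := by
    intro k hk r x
    have h1 := kt_G_deriv G hGadd (hBgen _ (hBd k hk (y r))) x
    rw [← hBs k hk] at h1
    exact h1
  have hBG : ∀ k ≤ p, ∀ x z, Bk k (GY x z) = G x (Bk k z) := by
    intro k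
    induction k with
    | zero => intro _ x z; rw [hB0, hB0, hGY]
    | succ k ih =>
      intro hk x z
      rw [hBs k hk, hBs k hk, ih (by omega)]
      exact (kt_B_comm G hGadd domB B hdomB hBgen x _ (hBd k hk z)).2
  have hIntg : ∀ a b : ℝ, IntervalIntegrable (fun r => G (-o r) (g r)) volume a b :=
    fun a b => hGgc.intervalIntegrable a b
  have hyI : ∀ t ∈ Icc s T, ι (y t) = G (-o s) (ι x₀) + ∫ r in s..t, G (-o r) (g r) := hy
  have hf20 : ∀ t ∈ Icc s T, ∀ x, f2 0 t x = G x (G (-o s) (ι x₀)) + ∫ r in s..t, f1 r x := by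
    intro t ht x
    simp only [hf2, hf1]
    rw [hB0, hyI t ht, map_add, ContinuousLinearMap.intervalIntegral_comp_comm _ (hIntg s t)]
  have hf1i : ∀ x a b, IntervalIntegrable (fun r => f1 r x) volume a b := by
    intro x a b
    exact (hf1c.comp (continuous_id.prodMk continuous_const)).intervalIntegrable a b
  have htime : ∀ a b : ℝ, s ≤ a → a ≤ b → b ≤ T → ∀ x,
      f2 0 b x - f2 0 a x = ∫ r in a..b, f1 r x := by
    intro a b ha hab hb x
    rw [hf20 b ⟨ha.trans hab, hb⟩, hf20 a ⟨ha, hab.trans hb⟩, add_sub_add_left_eq_sub,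
      intervalIntegral.integral_interval_sub_left (hf1i x s b) (hf1i x s a)]
  have hf1d : ∀ t ∈ Ioo s T, ∀ x : ℝ, HasDerivAt (fun r => f2 0 r x) (f1 t x) t := by
    intro t ht x
    have hc1 : Continuous fun r => f1 r x := hf1c.comp (continuous_id.prodMk continuous_const)
    have h1 := (intervalIntegral.integral_hasDerivAt_right (hf1i x s t)
      (hc1.stronglyMeasurableAtFilter _ _) hc1.continuousAt).const_add (G x (G (-o s) (ι x₀)))
    refine h1.congr_of_eventuallyEq ?_
    filter_upwards [Icc_mem_nhds ht.1 ht.2] with r hr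
    exact hf20 r hr x
  let F : C1p s T p V :=
    { f := f2 0
      f1 := f1
      f2 := f2
      f2_zero := rfl
      hf1 := hf1d
      hf1c := hf1c.continuousOn
      hf2 := fun k hk t _ x => hf2d k hk t x
      hf2c := hf2c.continuousOn }
  have hX : ∀ r, G (o r) (ι (y r)) = ι (GY (o r) (y r)) := fun r => (hGY _ _).symm
  have hAX : ∀ r, A (G (o r) (ι (y r))) = AY (GY (o r) (y r)) := fun r => by rw [hX, hAY]
  have hAc : Continuous fun r => A (G (o r) (ι (y r))) := by
    simp only [hAX]
    exact AY.continuous.comp hGYc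
  have hXs : G (o s) (ι (y s)) = ι x₀ := by
    rw [hyI s ⟨le_rfl, hsT.le⟩, intervalIntegral.integral_same, add_zero]
    have := kt_G_neg G hG0 hGadd (-o s) (ι x₀)
    rwa [neg_neg] at this
  refine ⟨fun r => G (o r) (ι (y r)), hXs, fun t _ => ⟨_, (hX t).symm⟩, fun t _ => ?_,
    hAc.intervalIntegrable _ _, F, ?_, ?_⟩
  · simp only [hX]
    exact ⟨(hYsub _).1, (hYsub (GY (o t) (y t))).2 0 hp⟩
  · intro r hr
    change G (ω r) (Bk 1 (y r)) = B (G (o r) (ι (y r)))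
    rw [← hoeq r (hsub r hr), ← hBG 1 hp, hBs 0 hp, hB0, hGY]
  · intro t ht
    have htT : t ∈ Icc (0:ℝ) T := ⟨hs0.trans ht.1.le, ht.2⟩
    have htmem : ∀ n j, j ≤ (π n).N → (π n).t j ∈ Icc (0:ℝ) T := by
      intro n j hj
      have hm : ∀ i k, i + k ≤ (π n).N → (π n).t i ≤ (π n).t (i + k) := by
        intro i k
        induction k with
        | zero => intro _; exact le_rfl
        | succ k ih =>
          intro hk
          exact (ih (by omega)).trans ((π n).mono (i + k) (by omega)).le
      constructor
      · have := hm 0 j (by omega)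
        rwa [(π n).first, zero_add] at this
      · have := hm j ((π n).N - j) (by omega)
        rwa [Nat.add_sub_cancel' hj, (π n).last] at this
    have hito := kt_ito (p := p) hp hpeven (ω := o) hoc (N := fun n => (π n).N)
      (t := fun n => (π n).t) (fun n i hi => (π n).mono i hi) hmesh μ hμna (by
        intro w hw hwb
        refine (hweak w hw hwb).congr fun n => Finset.sum_congr rfl fun j hj => ?_
        have hj' := Finset.mem_range.1 hj
        rw [hoeq _ (htmem n (j + 1) hj'), hoeq _ (htmem n j hj'.le)])
      ht.1 (fun n => by rw [(π n).first]; exact hs0) (fun n => by rw [(π n).last]; exact ht.2)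
      f2 f1 hf2d hf2c hf1c (fun a b ha hab hb => htime a b ha hab (hb.trans ht.2))
    refine ⟨_, hito.congr fun n => ?_, ?_⟩
    · refine Finset.sum_congr rfl fun j hj => Finset.sum_congr rfl fun k hk => ?_
      have hj' := Finset.mem_range.1 hj
      have hk1 : 1 ≤ k := (Finset.mem_Icc.1 hk).1
      have hcl : ∀ a, min (max a s) t = ktClamp s t a := by
        intro a
        have := ht.1.le
        simp only [ktClamp]
        rcases le_total a s with h | h <;> rcases le_total a t with h' | h' <;>
          simp [h, h', this]
        exact absurd h' (by intro h''; linarith [ht.1])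
      have hcm : ∀ a, ktClamp s t a ∈ Icc (0:ℝ) T := fun a =>
        ⟨hs0.trans (ktClamp_mem ht.1.le a).1, (ktClamp_mem ht.1.le a).2.trans ht.2⟩
      rw [hcl, hcl, ← hoeq _ (hcm _), ← hoeq _ (hcm _)]
      have hmm : max ((π n).t j) s ∈ Icc (0:ℝ) T :=
        ⟨hs0.trans (le_max_right _ _), max_le (htmem n j hj'.le).2 hsT.le⟩
      rcases le_total ((π n).t j) t with h | h
      · have h1 : ktClamp s t ((π n).t j) = max ((π n).t j) s := by
          rw [← hcl, min_eq_left (max_le h ht.1.le)]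
        rw [← hoeq _ hmm, h1]
      · have h1 : ∀ a, t ≤ a → ktClamp s t a = t := by
          intro a ha
          rw [← hcl, min_eq_right (ha.trans (le_max_left _ _))]
        have h2 := ((π n).mono j hj').le
        simp only [h1 _ h, h1 _ (h.trans h2), sub_self]
        rw [zero_pow (by omega), mul_zero, zero_smul, zero_smul]
    · rw [kt_density hT μ hμna dvar hvar hdvarc hs0 ht.1.le ht.2]
      have e1 : (∫ r in s..t, f1 r (o r)) = (∫ r in s..t, A (G (o r) (ι (y r)))) -
          ∫ r in s..t, cc r • Bk p (GY (o r) (y r)) := by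
        have hi2 : IntervalIntegrable (fun r => cc r • Bk p (GY (o r) (y r))) volume s t :=
          (hccc.smul ((Bk p).continuous.comp hGYc)).intervalIntegrable s t
        rw [← intervalIntegral.integral_sub (hAc.intervalIntegrable _ _) hi2]
        refine intervalIntegral.integral_congr fun r _ => ?_
        have := kt_G_neg G hG0 hGadd (-o r) (g r)
        rw [neg_neg] at this
        simp only [hf1, hg, hAX]
        exact this
      have e2 : (p.factorial : ℝ)⁻¹ • (∫ r in s..t, dvar r • f2 p r (o r)) =
          ∫ r in s..t, cc r • Bk p (GY (o r) (y r)) := by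
        rw [← intervalIntegral.integral_smul]
        refine intervalIntegral.integral_congr fun r hr => ?_
        rw [uIcc_of_le ht.1.le] at hr
        simp only [hf2]
        rw [hcceq r ⟨hs0.trans hr.1, hr.2.trans ht.2⟩, hBG p le_rfl, mul_smul]
      have e3 : f2 0 t (o t) = G (o t) (ι (y t)) := by simp only [hf2, hB0]
      have e4 : f2 0 s (o s) = ι x₀ := by simp only [hf2, hB0]; exact hXs
      rw [e1, e2, e3, e4]
      abel
end

section
/- Let g : ℝ → ℝ be continuous with 0 < c₁ ≤ g(x) ≤ c₂ < ∞ for all x ∈ ℝ, fix c ∈ ℝ, and set h(x) := ∫_c^x dr/g(r), which is a continuously differentiable increasing bijection of ℝ onto ℝ. Then for every t ∈ ℝ and every f ∈ L²(ℝ): ∫_ℝ |f(h^{-1}(h(x)+t))|² dx = ∫_ℝ |f(x)|² · g(h^{-1}(h(x)−t))/g(x) dx ≤ (c₂/c₁) ∫_ℝ |f(x)|² dx. -/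
open MeasureTheory Filter Set Topology Function

/-- the change-of-variables identity and the `L²` bound for the composition
operator `f ↦ f ∘ (x ↦ h⁻¹(h(x)+t))`, where `h(x) = ∫_c^x dr/g(r)` and `0 < c₁ ≤ g ≤ c₂`. -/
theorem statement9
    (g : ℝ → ℝ) (hg : Continuous g)
    (c₁ c₂ : ℝ) (hc₁ : 0 < c₁) (hbound : ∀ x : ℝ, c₁ ≤ g x ∧ g x ≤ c₂)
    (c : ℝ) (h : ℝ → ℝ) (hh : ∀ x : ℝ, h x = ∫ r in c..x, (g r)⁻¹)
    (t : ℝ) (f : ℝ → ℝ) (hf : MemLp f 2 (volume : Measure ℝ)) :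
    (∫ x : ℝ, |f (invFun h (h x + t))| ^ 2)
        = ∫ x : ℝ, |f x| ^ 2 * (g (invFun h (h x - t)) / g x) ∧
      (∫ x : ℝ, |f x| ^ 2 * (g (invFun h (h x - t)) / g x))
        ≤ (c₂ / c₁) * ∫ x : ℝ, |f x| ^ 2 := by
  have gpos : ∀ x, 0 < g x := fun x => hc₁.trans_le (hbound x).1
  have hc₂ : 0 < c₂ := (gpos 0).trans_le (hbound 0).2
  have hginv : Continuous (fun x => (g x)⁻¹) := hg.inv₀ (fun x => (gpos x).ne')
  have hd : ∀ x, HasDerivAt h (g x)⁻¹ x := by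
    intro x
    have h1 : h = fun x => ∫ r in c..x, (g r)⁻¹ := funext hh
    rw [h1]
    exact intervalIntegral.integral_hasDerivAt_right (hginv.intervalIntegrable _ _)
      (hginv.stronglyMeasurableAtFilter _ _) hginv.continuousAt
  have hcont : Continuous h := continuous_iff_continuousAt.2 fun x => (hd x).continuousAt
  have hmono : StrictMono h := strictMono_of_hasDerivAt_pos hd (fun x => inv_pos.2 (gpos x))
  have hm2 : Monotone (fun x => h x - c₂⁻¹ * x) := by
    have hd2 : ∀ x, HasDerivAt (fun x => h x - c₂⁻¹ * x) ((g x)⁻¹ - c₂⁻¹ * 1) x :=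
      fun x => (hd x).sub ((hasDerivAt_id x).const_mul _)
    apply monotone_of_hasDerivAt_nonneg hd2
    intro x
    have := inv_anti₀ (gpos x) (hbound x).2
    simp only [Pi.zero_apply]
    linarith
  have hci : 0 < c₂⁻¹ := inv_pos.2 hc₂
  have hsurj : Surjective h := by
    apply hcont.surjective
    · apply tendsto_atTop_mono' _ (f₁ := fun x => h 0 + c₂⁻¹ * x)
      · filter_upwards [eventually_ge_atTop 0] with x hx
        have := hm2 hx
        simp only [mul_zero] at this
        linarith
      · exact tendsto_atTop_add_const_left _ _ (tendsto_id.const_mul_atTop hci)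
    · apply tendsto_atBot_mono' _ (f₁ := fun x => h 0 + c₂⁻¹ * x)
      · filter_upwards [eventually_le_atBot 0] with x hx
        have := hm2 hx
        simp only [mul_zero] at this
        linarith
      · exact tendsto_atBot_add_const_left _ _ (tendsto_id.const_mul_atBot hci)
  have hl : ∀ x, invFun h (h x) = x := leftInverse_invFun hmono.injective
  have hr : ∀ x, h (invFun h x) = x := rightInverse_invFun hsurj
  have kmono : Monotone (invFun h) := by
    intro a b hab
    rw [← hmono.le_iff_le, hr, hr]
    exact hab
  have kcont : Continuous (invFun h) :=
    kmono.continuous_of_surjective (fun x => ⟨h x, hl x⟩)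
  have kd : ∀ y, HasDerivAt (invFun h) (g (invFun h y)) y := by
    intro y
    have := HasDerivAt.of_local_left_inverse kcont.continuousAt (hd (invFun h y))
      (inv_pos.2 (gpos _)).ne' (Eventually.of_forall hr)
    rwa [inv_inv] at this
  have pd : ∀ x, HasDerivAt (fun x => invFun h (h x - t))
      (g (invFun h (h x - t)) * (g x)⁻¹) x := by
    intro x
    exact (kd (h x - t)).comp x ((hd x).sub_const t)
  have pinj : Injective (fun x => invFun h (h x - t)) := by
    intro a b hab
    have := congrArg h hab
    simp only [hr] at this
    exact hmono.injective (by linarith)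
  have psurj : Surjective (fun x => invFun h (h x - t)) := by
    intro y
    refine ⟨invFun h (h y + t), ?_⟩
    simp only [hr, add_sub_cancel_right, hl]
  constructor
  · have := integral_image_eq_integral_abs_deriv_smul MeasurableSet.univ
      (fun x _ => (pd x).hasDerivWithinAt) pinj.injOn
      (fun x => |f (invFun h (h x + t))| ^ 2)
    rw [image_univ, psurj.range_eq, setIntegral_univ, setIntegral_univ] at this
    rw [this]
    congr 1
    funext x
    have hp : 0 < g (invFun h (h x - t)) * (g x)⁻¹ := mul_pos (gpos _) (inv_pos.2 (gpos x))
    rw [abs_of_pos hp, hr, sub_add_cancel, hl, smul_eq_mul, div_eq_mul_inv, mul_comm]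
  · have hint : Integrable (fun x => |f x| ^ 2) := by
      simpa only [sq_abs] using hf.integrable_sq
    rw [← integral_const_mul]
    apply integral_mono_of_nonneg
    · exact Eventually.of_forall fun x =>
        mul_nonneg (sq_nonneg _) (div_pos (gpos _) (gpos x)).le
    · exact hint.const_mul _
    · refine Eventually.of_forall fun x => ?_
      have : g (invFun h (h x - t)) / g x ≤ c₂ / c₁ :=
        div_le_div₀ hc₂.le (hbound _).2 hc₁ (hbound x).1
      show _ * _ ≤ _ * _
      rw [mul_comm]
      exact mul_le_mul_of_nonneg_right this (sq_nonneg _)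
end

section
/- Let g : ℝ → ℝ be continuous with 0 < c₁ ≤ g(x) ≤ c₂ < ∞ for all x ∈ ℝ, fix c ∈ ℝ, set h(x) := ∫_c^x dr/g(r), and for t ∈ ℝ define G_{g∂}(t) on L²(ℝ) by (G_{g∂}(t)f)(x) := f(h^{-1}(h(x)+t)). Suppose u, z ∈ L²(ℝ) are such that ‖(G_{g∂}(s)u − u)/s − z‖_{L²(ℝ)} → 0 as s ↓ 0. Then for every a ∈ ℝ, the identity u(h^{-1}(h(x)+a)) − u(x) = ∫_x^{h^{-1}(h(x)+a)} z(r)/g(r) dr holds for Lebesgue-almost every x ∈ ℝ. -/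
open MeasureTheory Filter Set Topology Function

lemma s10_map_le {f : ℝ → ℝ} {K : NNReal} (hf : AntilipschitzWith K f) (hm : Measurable f) :
    Measure.map f (volume : Measure ℝ) ≤ (K : ENNReal) • (volume : Measure ℝ) := by
  refine Measure.le_iff.2 fun s hs => ?_
  rw [Measure.map_apply hm hs]
  have := hf.hausdorffMeasure_preimage_le (d := 1) zero_le_one s
  simpa [hausdorffMeasure_real] using this

lemma s10_flat (v w : ℝ → ℝ) (hv : MemLp v 2 (volume : Measure ℝ))
    (hw : MemLp w 2 (volume : Measure ℝ))
    (hconv : Tendsto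
      (fun s : ℝ => eLpNorm (fun y : ℝ => s⁻¹ * (v (y + s) - v y) - w y) 2
        (volume : Measure ℝ)) (𝓝[>] 0) (𝓝 0)) :
    ∃ E : Set ℝ, (∀ᵐ y ∂(volume : Measure ℝ), y ∈ E) ∧
      ∀ p ∈ E, ∀ q ∈ E, v q - v p = ∫ y in p..q, w y := by
  have hvl : LocallyIntegrable v volume := hv.locallyIntegrable (by norm_num)
  have hwl : LocallyIntegrable w volume := hw.locallyIntegrable (by norm_num)
  have iv : ∀ a b, IntervalIntegrable v volume a b := fun a b => intervalIntegrable_iff.mpr <|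
    (hvl.integrableOn_isCompact isCompact_uIcc).mono_set uIoc_subset_uIcc
  have iw : ∀ a b, IntervalIntegrable w volume a b := fun a b => intervalIntegrable_iff.mpr <|
    (hwl.integrableOn_isCompact isCompact_uIcc).mono_set uIoc_subset_uIcc
  refine ⟨{y | HasDerivAt (fun x => ∫ t in (0:ℝ)..x, v t) (v y) y}, ?_, ?_⟩
  · filter_upwards [LocallyIntegrable.ae_hasDerivAt_integral hvl] with y hy using hy 0
  intro p hp q hq
  have h1 := (hq.tendsto_slope_zero_right.sub hp.tendsto_slope_zero_right).sub_const
    (∫ y in p..q, w y)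
  have ivs : ∀ s, IntervalIntegrable (fun y => v (y + s)) volume p q := fun s => by
    simpa using (iv (p + s) (q + s)).comp_add_right s
  have key : ∀ s : ℝ, s⁻¹ • ((∫ t in (0:ℝ)..(q + s), v t) - ∫ t in (0:ℝ)..q, v t)
      - s⁻¹ • ((∫ t in (0:ℝ)..(p + s), v t) - ∫ t in (0:ℝ)..p, v t) - (∫ y in p..q, w y)
      = ∫ y in p..q, (s⁻¹ * (v (y + s) - v y) - w y) := by
    intro s
    rw [intervalIntegral.integral_sub (((ivs s).sub (iv p q)).const_mul _) (iw p q),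
      intervalIntegral.integral_const_mul, intervalIntegral.integral_sub (ivs s) (iv p q),
      intervalIntegral.integral_comp_add_right (f := v),
      ← intervalIntegral.integral_interval_sub_left (iv 0 (q + s)) (iv 0 (p + s)),
      ← intervalIntegral.integral_interval_sub_left (iv 0 q) (iv 0 p)]
    simp only [smul_eq_mul]
    ring
  have h2 : Tendsto (fun s : ℝ => ∫ y in p..q, (s⁻¹ * (v (y + s) - v y) - w y))
      (𝓝[>] 0) (𝓝 0) := by
    rw [tendsto_zero_iff_enorm_tendsto_zero]
    set C : ENNReal := (volume.restrict (uIoc p q)) univ ^ ((1:ℝ) / (1:ENNReal).toReal - 1 / (2:ENNReal).toReal)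
      with hC
    have hCt : C ≠ ⊤ := by
      refine ENNReal.rpow_ne_top_of_nonneg (by norm_num) ?_
      simp [uIoc]
    have h3 := ENNReal.Tendsto.mul_const hconv (Or.inr hCt)
    rw [zero_mul] at h3
    refine tendsto_of_tendsto_of_tendsto_of_le_of_le tendsto_const_nhds h3
      (fun _ => zero_le) fun s => ?_
    have hm : AEStronglyMeasurable (fun y : ℝ => s⁻¹ * (v (y + s) - v y) - w y) volume := by
      have : AEStronglyMeasurable (fun y => v (y + s)) volume :=
        hv.1.comp_measurePreserving (measurePreserving_add_right volume s)
      exact ((this.sub hv.1).const_mul _).sub hw.1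
    calc ‖∫ y in p..q, (s⁻¹ * (v (y + s) - v y) - w y)‖ₑ
        = ‖∫ y in uIoc p q, (s⁻¹ * (v (y + s) - v y) - w y)‖ₑ := by
          rw [enorm_eq_iff_norm_eq]
          exact intervalIntegral.norm_intervalIntegral_eq _ _ _ _
      _ ≤ eLpNorm (fun y => s⁻¹ * (v (y + s) - v y) - w y) 1 (volume.restrict (uIoc p q)) := by
          rw [eLpNorm_one_eq_lintegral_enorm]
          exact enorm_integral_le_lintegral_enorm _
      _ ≤ eLpNorm (fun y => s⁻¹ * (v (y + s) - v y) - w y) 2 (volume.restrict (uIoc p q)) * C :=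
          eLpNorm_le_eLpNorm_mul_rpow_measure_univ (by norm_num) hm.restrict
      _ ≤ _ := by
          gcongr
          exact Measure.restrict_le_self
  have h4 := tendsto_nhds_unique (h1.congr key) h2
  linarith

/-- if `(G_{g∂}(s)u − u)/s → z` in `L²(ℝ)` as `s ↓ 0`, where
`(G_{g∂}(s)u)(x) = u(h⁻¹(h(x)+s))` and `h(x) = ∫_c^x dr/g(r)`, then for every `a ∈ ℝ`,
`u(h⁻¹(h(x)+a)) − u(x) = ∫_x^{h⁻¹(h(x)+a)} z(r)/g(r) dr` for a.e. `x`. -/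
theorem statement10
    (g : ℝ → ℝ) (hg : Continuous g)
    (c₁ c₂ : ℝ) (hc₁ : 0 < c₁) (hbound : ∀ x : ℝ, c₁ ≤ g x ∧ g x ≤ c₂)
    (c : ℝ) (h : ℝ → ℝ) (hh : ∀ x : ℝ, h x = ∫ r in c..x, (g r)⁻¹)
    (u z : ℝ → ℝ)
    (hu : MemLp u 2 (volume : Measure ℝ)) (hz : MemLp z 2 (volume : Measure ℝ))
    (hconv : Tendsto
      (fun s : ℝ => eLpNorm (fun x : ℝ => s⁻¹ * (u (invFun h (h x + s)) - u x) - z x) 2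
        (volume : Measure ℝ))
      (𝓝[>] 0) (𝓝 0)) :
    ∀ a : ℝ, ∀ᵐ x : ℝ ∂(volume : Measure ℝ),
      u (invFun h (h x + a)) - u x = ∫ r in x..(invFun h (h x + a)), z r / g r := by
  have gpos : ∀ x, 0 < g x := fun x => hc₁.trans_le (hbound x).1
  have hc₂ : 0 < c₂ := (gpos 0).trans_le (hbound 0).2
  have gic : Continuous fun r => (g r)⁻¹ := hg.inv₀ fun x => (gpos x).ne'
  have hd : ∀ x, HasDerivAt h (g x)⁻¹ x := by
    intro x
    rw [show h = fun x => ∫ r in c..x, (g r)⁻¹ from funext hh]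
    exact gic.integral_hasStrictDerivAt c x |>.hasDerivAt
  have hdiff : Differentiable ℝ h := fun x => (hd x).differentiableAt
  have hderiv : ∀ x, deriv h x = (g x)⁻¹ := fun x => (hd x).deriv
  have hmono : StrictMono h := strictMono_of_deriv_pos fun x => by
    rw [hderiv]; exact inv_pos.2 (gpos x)
  have hlow : ∀ x y, x ≤ y → c₂⁻¹ * (y - x) ≤ h y - h x := fun x y hxy =>
    mul_sub_le_image_sub_of_le_deriv hdiff
      (fun x => by rw [hderiv]; exact inv_anti₀ (gpos x) (hbound x).2) hxy
  have hlip : LipschitzWith (Real.toNNReal c₁⁻¹) h := by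
    refine lipschitzWith_of_nnnorm_deriv_le hdiff fun x => ?_
    rw [← NNReal.coe_le_coe, coe_nnnorm, Real.coe_toNNReal _ (by positivity), hderiv,
      Real.norm_of_nonneg (inv_pos.2 (gpos x)).le]
    exact inv_anti₀ hc₁ (hbound x).1
  have hanti : AntilipschitzWith (Real.toNNReal c₂) h := by
    refine AntilipschitzWith.of_le_mul_dist fun x y => ?_
    rw [Real.coe_toNNReal _ hc₂.le]
    wlog hxy : x ≤ y generalizing x y
    · rw [dist_comm, dist_comm (h x)]
      exact this y x (le_of_not_ge hxy)
    have := hlow x y hxy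
    rw [dist_comm, dist_comm (h x), Real.dist_eq, Real.dist_eq, abs_of_nonneg (sub_nonneg.2 hxy),
      abs_of_nonneg (sub_nonneg.2 (hmono.monotone hxy))]
    rwa [inv_mul_le_iff₀ hc₂] at this
  have hsurj : Surjective h := by
    refine hdiff.continuous.surjective ?_ ?_
    · refine tendsto_atTop_mono' _ (f₁ := fun y => h 0 + c₂⁻¹ * y) ?_ ?_
      · filter_upwards [eventually_ge_atTop 0] with y hy
        have := hlow 0 y hy
        simp only [sub_zero] at this
        linarith
      · exact tendsto_atTop_add_const_left _ _ (tendsto_id.const_mul_atTop (inv_pos.2 hc₂))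
    · refine tendsto_atBot_mono' _ (f₁ := fun y => h 0 + c₂⁻¹ * y) ?_ ?_
      · filter_upwards [eventually_le_atBot 0] with y hy
        have := hlow y 0 hy
        simp only [zero_sub] at this
        linarith
      · exact tendsto_atBot_add_const_left _ _ (tendsto_id.const_mul_atBot (inv_pos.2 hc₂))
  set k := invFun h with hk
  have kl : LeftInverse k h := leftInverse_invFun hmono.injective
  have kr : RightInverse k h := rightInverse_invFun hsurj
  have klip := hanti.to_rightInverse kr
  have kanti := hlip.to_rightInverse kr
  have hme := hdiff.continuous.measurable
  have kme := klip.continuous.measurable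
  have mh := s10_map_le hanti hme
  have mk := s10_map_le kanti kme
  have qh : Measure.QuasiMeasurePreserving h volume volume :=
    ⟨hme, Measure.absolutelyContinuous_of_le_smul mh⟩
  have qk : Measure.QuasiMeasurePreserving k volume volume :=
    ⟨kme, Measure.absolutelyContinuous_of_le_smul mk⟩
  have qs : ∀ s : ℝ, Measure.QuasiMeasurePreserving (fun y : ℝ => y + s) volume volume :=
    fun s => (measurePreserving_add_right volume s).quasiMeasurePreserving
  have hv : MemLp (u ∘ k) 2 volume :=
    (hu.of_measure_le_smul ENNReal.coe_ne_top mk).comp_of_map kme.aemeasurable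
  have hw : MemLp (z ∘ k) 2 volume :=
    (hz.of_measure_le_smul ENNReal.coe_ne_top mk).comp_of_map kme.aemeasurable
  have hconv' : Tendsto
      (fun s : ℝ => eLpNorm (fun y : ℝ => s⁻¹ * ((u ∘ k) (y + s) - (u ∘ k) y) - (z ∘ k) y) 2
        (volume : Measure ℝ)) (𝓝[>] 0) (𝓝 0) := by
    set C : ENNReal := ((Real.toNNReal c₁⁻¹ : NNReal) : ENNReal) ^ ((1:ENNReal) / 2).toReal
    have hCt : C ≠ ⊤ := ENNReal.rpow_ne_top_of_nonneg (by positivity) ENNReal.coe_ne_top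
    have h3 := ENNReal.Tendsto.const_mul (a := C) hconv (Or.inr hCt)
    rw [mul_zero] at h3
    refine tendsto_of_tendsto_of_tendsto_of_le_of_le tendsto_const_nhds h3
      (fun _ => zero_le) fun s => ?_
    have hm : AEStronglyMeasurable (fun x : ℝ => s⁻¹ * (u (k (h x + s)) - u x) - z x) volume := by
      have : AEStronglyMeasurable (fun x => u (k (h x + s))) volume :=
        hu.1.comp_quasiMeasurePreserving (qk.comp ((qs s).comp qh))
      exact ((this.sub hu.1).const_mul _).sub hz.1
    have e : (fun y : ℝ => s⁻¹ * ((u ∘ k) (y + s) - (u ∘ k) y) - (z ∘ k) y)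
        = (fun x : ℝ => s⁻¹ * (u (k (h x + s)) - u x) - z x) ∘ k := by
      funext y
      simp [kr y]
    simp only [e]
    rw [← eLpNorm_map_measure (hm.mono_ac qk.absolutelyContinuous) kme.aemeasurable]
    refine (eLpNorm_mono_measure _ mk).trans ?_
    rw [eLpNorm_smul_measure_of_ne_top (by norm_num), smul_eq_mul]
  obtain ⟨E, hE, hEq⟩ := s10_flat _ _ hv hw hconv'
  have cv' : ∀ p q, p ≤ q → ∫ y in (h p)..(h q), (z ∘ k) y = ∫ r in p..q, z r / g r := by
    intro p q hpq
    rw [intervalIntegral.integral_of_le hpq, intervalIntegral.integral_of_le (hmono.monotone hpq)]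
    have im : h '' Ioc p q = Ioc (h p) (h q) := by
      ext y
      constructor
      · rintro ⟨x, hx, rfl⟩
        exact ⟨hmono hx.1, hmono.monotone hx.2⟩
      · intro hy
        obtain ⟨x, rfl⟩ := hsurj y
        exact ⟨x, ⟨hmono.lt_iff_lt.1 hy.1, hmono.le_iff_le.1 hy.2⟩, rfl⟩
    rw [← im, integral_image_eq_integral_abs_deriv_smul measurableSet_Ioc
      (fun x _ => (hd x).hasDerivWithinAt) hmono.injective.injOn]
    congr 1
    funext x
    rw [abs_of_pos (inv_pos.2 (gpos x)), comp_apply, kl x, smul_eq_mul, div_eq_inv_mul]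
  have cv : ∀ p q, ∫ y in (h p)..(h q), (z ∘ k) y = ∫ r in p..q, z r / g r := by
    intro p q
    rcases le_total p q with hpq | hpq
    · exact cv' p q hpq
    · rw [intervalIntegral.integral_symm, cv' q p hpq, ← intervalIntegral.integral_symm]
  intro a
  filter_upwards [qh.ae hE, ((qs a).comp qh).ae hE] with x h1 h2
  have := hEq _ h1 _ h2
  rw [← cv, kr]
  simpa [kl x] using this
end

section
/- Let g : ℝ → ℝ be continuous with 0 < c₁ ≤ g(x) ≤ c₂ < ∞ for all x ∈ ℝ, fix c ∈ ℝ, set h(x) := ∫_c^x dr/g(r), and for t ∈ ℝ define the strongly continuous group G_{g∂} on L²(ℝ) by (G_{g∂}(t)f)(x) := f(h^{-1}(h(x)+t)). Then the infinitesimal generator of G_{g∂} is the operator g∂ with domain W^{1,2}(ℝ): for u, z ∈ L²(ℝ), one has ‖(G_{g∂}(s)u − u)/s − z‖_{L²(ℝ)} → 0 as s ↓ 0 if and only if there exists w ∈ L²(ℝ) such that u has a representative ũ satisfying ũ(y) − ũ(x) = ∫_x^y w(r) dr for all x, y ∈ ℝ (i.e. u ∈ W^{1,2}(ℝ) with weak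 derivative u′ = w) and z = g·w almost everywhere. -/
open MeasureTheory Filter Set Topology Function
open scoped ENNReal

lemma trans_cont (ζ : ℝ → ℝ) (hζ : MemLp ζ 2 (volume : Measure ℝ)) :
    Tendsto (fun r : ℝ => eLpNorm (fun x => ζ (x + r) - ζ x) 2 volume) (𝓝 0) (𝓝 0) := by
  let G : ℝ → C(ℝ, ℝ) := (ContinuousMap.mk (fun a : ℝ × ℝ ↦ a.2 + a.1) (by fun_prop)).curry
  have hG : Continuous G := (ContinuousMap.mk (fun a : ℝ × ℝ ↦ a.2 + a.1) (by fun_prop)).curry.continuous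
  have hm : ∀ r, MeasurePreserving (G r) (volume : Measure ℝ) volume := fun r =>
    measurePreserving_add_right volume r
  have h1 := Continuous.compMeasurePreservingLp (f := fun _ : ℝ => hζ.toLp ζ) continuous_const hG hm
    (by simp)
  have h2 : Tendsto (fun r => ‖Lp.compMeasurePreserving (G r) (hm r) (hζ.toLp ζ) - hζ.toLp ζ‖ₑ)
     (𝓝 0) (𝓝 0) := by
    have h3 := ((h1.sub (continuous_const (y := hζ.toLp ζ))).enorm).tendsto 0
    have h4 : Lp.compMeasurePreserving (G 0) (hm 0) (hζ.toLp ζ) = hζ.toLp ζ := by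
      rw [Lp.toLp_compMeasurePreserving]
      congr 1
      ext x; simp [G]
    simpa [h4] using h3
  refine h2.congr fun r => ?_
  rw [Lp.toLp_compMeasurePreserving, ← MemLp.toLp_sub, Lp.enorm_toLp]
  rfl

lemma jensen_sq (s : ℝ) (hs : 0 < s) (f : ℝ → ℝ) (hf : Measurable f) :
    ‖s⁻¹ * ∫ r in (0:ℝ)..s, f r‖ₑ ^ 2 ≤ ENNReal.ofReal s⁻¹ * ∫⁻ r in Ioc 0 s, ‖f r‖ₑ ^ 2 := by
  have h1 : ‖∫ r in (0:ℝ)..s, f r‖ₑ ≤ ∫⁻ r in Ioc 0 s, ‖f r‖ₑ := by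
    rw [intervalIntegral.integral_of_le hs.le]
    exact enorm_integral_le_lintegral_enorm _
  have h2 := eLpNorm_le_eLpNorm_mul_rpow_measure_univ (p := 1) (q := 2)
    (μ := volume.restrict (Ioc 0 s)) (f := f) (by norm_num) hf.aestronglyMeasurable
  rw [eLpNorm_one_eq_lintegral_enorm] at h2
  have h3 : (∫⁻ r in Ioc 0 s, ‖f r‖ₑ) ^ 2 ≤ (∫⁻ r in Ioc 0 s, ‖f r‖ₑ ^ 2) * ENNReal.ofReal s := by
    refine (pow_le_pow_left' h2 2).trans (le_of_eq ?_)
    rw [mul_pow, eLpNorm_eq_lintegral_rpow_enorm_toReal (by simp) (by simp)]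
    simp only [← ENNReal.rpow_natCast, ← ENNReal.rpow_mul]
    norm_num
  have h4 : ENNReal.ofReal s⁻¹ * ENNReal.ofReal s = 1 := by
    rw [← ENNReal.ofReal_mul (by positivity), inv_mul_cancel₀ hs.ne']; simp
  rw [enorm_mul, mul_pow, Real.enorm_eq_ofReal (by positivity : 0 ≤ s⁻¹)]
  calc _ ≤ ENNReal.ofReal s⁻¹ ^ 2 * ((∫⁻ r in Ioc 0 s, ‖f r‖ₑ ^ 2) * ENNReal.ofReal s) := by
        gcongr
        exact (pow_le_pow_left' h1 2).trans h3
    _ = (ENNReal.ofReal s⁻¹ * ENNReal.ofReal s) * (ENNReal.ofReal s⁻¹ * ∫⁻ r in Ioc 0 s, ‖f r‖ₑ ^ 2) := by ring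
    _ = _ := by rw [h4, one_mul]

lemma sq_eLpNorm (f : ℝ → ℝ) : eLpNorm f 2 volume ^ 2 = ∫⁻ x, ‖f x‖ₑ ^ 2 := by
  rw [eLpNorm_eq_lintegral_rpow_enorm_toReal (by simp) (by simp)]
  simp only [← ENNReal.rpow_natCast, ← ENNReal.rpow_mul]
  norm_num

lemma memLp_ii {f : ℝ → ℝ} (hf : MemLp f 2 (volume : Measure ℝ)) (a b : ℝ) :
    IntervalIntegrable f volume a b :=
  intervalIntegrable_iff.mpr <| (LocallyIntegrable.integrableOn_isCompact
    (hf.locallyIntegrable (by norm_num)) isCompact_uIcc).mono_set uIoc_subset_uIcc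

lemma avg_tendsto (ζ : ℝ → ℝ) (hζ : MemLp ζ 2 (volume : Measure ℝ)) (hm : Measurable ζ) :
    Tendsto (fun s : ℝ => eLpNorm (fun x => s⁻¹ * (∫ r in x..(x+s), ζ r) - ζ x) 2 volume)
      (𝓝[>] 0) (𝓝 0) := by
  rw [ENNReal.tendsto_nhds_zero]
  intro ε hε
  have h1 := (ENNReal.tendsto_nhds_zero.1 (trans_cont ζ hζ)) ε hε
  obtain ⟨δ, hδ, h2⟩ := Metric.eventually_nhds_iff.1 h1
  filter_upwards [Ioo_mem_nhdsGT hδ] with s hs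
  have hs0 : 0 < s := hs.1
  rw [← ENNReal.pow_le_pow_left_iff (n := 2) (by norm_num), sq_eLpNorm]
  have h3 : ∀ x, s⁻¹ * (∫ r in x..(x+s), ζ r) - ζ x = s⁻¹ * ∫ r in (0:ℝ)..s, (ζ (x + r) - ζ x) := by
    intro x
    have hi : IntervalIntegrable (fun r => ζ (x + r)) volume 0 s := by
      have := (memLp_ii hζ x (x+s)).comp_add_left x
      simpa using this
    rw [intervalIntegral.integral_sub hi (by simp), intervalIntegral.integral_comp_add_left]
    simp
    field_simp
  calc ∫⁻ x, ‖s⁻¹ * (∫ r in x..(x+s), ζ r) - ζ x‖ₑ ^ 2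
      ≤ ∫⁻ x, ENNReal.ofReal s⁻¹ * ∫⁻ r in Ioc 0 s, ‖ζ (x + r) - ζ x‖ₑ ^ 2 := by
        refine lintegral_mono fun x => ?_
        rw [h3]
        exact jensen_sq s hs0 _ (by fun_prop)
    _ = ENNReal.ofReal s⁻¹ * ∫⁻ r in Ioc 0 s, ∫⁻ x, ‖ζ (x + r) - ζ x‖ₑ ^ 2 := by
        rw [lintegral_const_mul', lintegral_lintegral_swap]
        · exact Measurable.aemeasurable (by unfold Function.uncurry; fun_prop)
        · simp
    _ ≤ ENNReal.ofReal s⁻¹ * ∫⁻ r in Ioc 0 s, ε ^ 2 := by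
        gcongr 1
        refine setLIntegral_mono (by fun_prop) fun r hr => ?_
        rw [← sq_eLpNorm]
        refine pow_le_pow_left' (h2 ?_) 2
        simp [abs_of_pos hr.1]
        exact hr.2.trans_lt hs.2
    _ = ε ^ 2 := by
        simp
        rw [mul_left_comm, ← ENNReal.ofReal_mul (by positivity), inv_mul_cancel₀ hs0.ne']; simp

lemma trans_bwd (v ζ V : ℝ → ℝ) (hζ : MemLp ζ 2 (volume : Measure ℝ))
    (hV : V =ᵐ[volume] v) (hV2 : ∀ x y, V y - V x = ∫ r in x..y, ζ r) :
    Tendsto (fun s : ℝ => eLpNorm (fun x => s⁻¹ * (v (x + s) - v x) - ζ x) 2 volume)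
      (𝓝[>] 0) (𝓝 0) := by
  have ha := hζ.aestronglyMeasurable
  have he : ζ =ᵐ[volume] ha.mk ζ := ha.ae_eq_mk
  have h1 := avg_tendsto (ha.mk ζ) (hζ.ae_eq he) ha.stronglyMeasurable_mk.measurable
  refine h1.congr fun s => eLpNorm_congr_ae ?_
  have h2 := (measurePreserving_add_right (volume : Measure ℝ) s).quasiMeasurePreserving.ae_eq_comp hV
  filter_upwards [he, hV, h2] with x hx1 hx2 hx3
  simp only [Function.comp_apply] at hx3
  rw [← hx1, ← hx2, ← hx3, hV2]
  congr 2
  exact intervalIntegral.integral_congr_ae (by filter_upwards [he] with y hy _ using hy.symm)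

lemma trans_fwd (v ζ : ℝ → ℝ) (hv : MemLp v 2 (volume : Measure ℝ))
    (hζ : MemLp ζ 2 (volume : Measure ℝ))
    (hT : Tendsto (fun s : ℝ => eLpNorm (fun x => s⁻¹ * (v (x + s) - v x) - ζ x) 2 volume)
      (𝓝[>] 0) (𝓝 0)) :
    ∃ V : ℝ → ℝ, V =ᵐ[volume] v ∧ ∀ x y, V y - V x = ∫ r in x..y, ζ r := by
  have hvs : ∀ s : ℝ, MemLp (fun x => v (x + s)) 2 volume := fun s =>
    hv.comp_measurePreserving (measurePreserving_add_right volume s)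
  have hD : ∀ s : ℝ, MemLp (fun x => s⁻¹ * (v (x + s) - v x)) 2 volume := fun s =>
    ((hvs s).sub hv).const_mul _
  have hleb := LocallyIntegrable.ae_hasDerivAt_integral (hv.locallyIntegrable (by norm_num))
  -- convergence of integrals
  have key : ∀ a b : ℝ, Tendsto (fun s : ℝ => ∫ x in a..b, s⁻¹ * (v (x + s) - v x)) (𝓝[>] 0)
      (𝓝 (∫ x in a..b, ζ x)) := by
    intro a b
    rw [intervalIntegral.intervalIntegral_eq_integral_uIoc]
    simp_rw [intervalIntegral.intervalIntegral_eq_integral_uIoc]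
    refine Tendsto.const_smul ?_ _
    refine tendsto_integral_of_L1 _ (memLp_ii hζ a b).def'.aestronglyMeasurable (.of_forall fun s => (memLp_ii (hD s) a b).def') ?_
    have hb : Tendsto (fun s : ℝ => eLpNorm (fun x => s⁻¹ * (v (x + s) - v x) - ζ x) 2 volume *
      (volume.restrict (uIoc a b)) univ ^ (1 / (1:ℝ≥0∞).toReal - 1 / (2:ℝ≥0∞).toReal)) (𝓝[>] 0) (𝓝 0) := by
      have := ENNReal.Tendsto.mul_const (b := (volume.restrict (uIoc a b)) univ ^ (1 / (1:ℝ≥0∞).toReal - 1 / (2:ℝ≥0∞).toReal)) hT (Or.inr (by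
        refine ENNReal.rpow_ne_top_of_nonneg (by norm_num) ?_
        simp [uIoc]))
      simpa using this
    refine tendsto_of_tendsto_of_tendsto_of_le_of_le tendsto_const_nhds hb (fun s => zero_le) fun s => ?_
    simp only
    rw [← eLpNorm_one_eq_lintegral_enorm]
    refine (eLpNorm_le_eLpNorm_mul_rpow_measure_univ (p := 1) (q := 2) (by norm_num)
      ((hD s).sub hζ).aestronglyMeasurable.restrict).trans ?_
    gcongr
    exact eLpNorm_mono_measure _ Measure.restrict_le_self
  have hq : ∀ a : ℝ, HasDerivAt (fun x => ∫ t in (0:ℝ)..x, v t) (v a) a →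
      Tendsto (fun s : ℝ => s⁻¹ * ∫ t in a..(a+s), v t) (𝓝[>] 0) (𝓝 (v a)) := by
    intro a ha
    have := (hasDerivAt_iff_tendsto_slope_zero.1 ha).mono_left
      (nhdsWithin_mono (0:ℝ) (fun x (hx : 0 < x) => (ne_of_gt hx : x ≠ 0)))
    refine this.congr fun s => ?_
    rw [smul_eq_mul, intervalIntegral.integral_interval_sub_left (memLp_ii hv _ _) (memLp_ii hv _ _)]
  have main : ∀ a b, HasDerivAt (fun x => ∫ t in (0:ℝ)..x, v t) (v a) a →
      HasDerivAt (fun x => ∫ t in (0:ℝ)..x, v t) (v b) b → v b - v a = ∫ x in a..b, ζ x := by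
    intro a b ha hb
    refine tendsto_nhds_unique ((hq b hb).sub (hq a ha)) ((key a b).congr fun s => ?_)
    rw [intervalIntegral.integral_const_mul, intervalIntegral.integral_sub (memLp_ii (hvs s) a b) (memLp_ii hv a b),
      intervalIntegral.integral_comp_add_right, ← mul_sub]
    congr 1
    have i := memLp_ii hv
    have e1 := intervalIntegral.integral_add_adjacent_intervals (i a (a+s)) (i (a+s) (b+s))
    have e2 := intervalIntegral.integral_add_adjacent_intervals (i a b) (i b (b+s))
    linarith
  have hleb' : ∀ᵐ x, HasDerivAt (fun x => ∫ t in (0:ℝ)..x, v t) (v x) x := hleb.mono fun x hx => hx 0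
  obtain ⟨a, ha⟩ := hleb'.exists
  refine ⟨fun x => v a + ∫ r in a..x, ζ r, ?_, fun x y => ?_⟩
  · filter_upwards [hleb'] with x hx
    rw [← main a x ha hx]; ring
  · rw [add_sub_add_left_eq_sub, intervalIntegral.integral_interval_sub_left (memLp_ii hζ _ _) (memLp_ii hζ _ _)]


lemma comp_lintegral_le (φ φ' : ℝ → ℝ) (m : ℝ) (hm : 0 < m) (hφ : ∀ x, HasDerivAt φ (φ' x) x)
    (hmφ : ∀ x, m ≤ φ' x) (hb : Bijective φ) (F : ℝ → ℝ≥0∞) :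
    ∫⁻ x, F (φ x) ≤ ENNReal.ofReal m⁻¹ * ∫⁻ x, F x := by
  have h1 := lintegral_image_eq_lintegral_abs_deriv_mul (s := univ) (f := φ) (f' := φ') MeasurableSet.univ
    (fun x _ => (hφ x).hasDerivWithinAt) hb.1.injOn F
  rw [image_univ, hb.2.range_eq] at h1
  simp only [Measure.restrict_univ] at h1
  have h4 : ENNReal.ofReal m⁻¹ * ENNReal.ofReal m = 1 := by
    rw [← ENNReal.ofReal_mul (by positivity), inv_mul_cancel₀ hm.ne']; simp
  rw [h1, ← lintegral_const_mul' _ _ (by simp)]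
  refine lintegral_mono fun x => ?_
  calc F (φ x) = ENNReal.ofReal m⁻¹ * (ENNReal.ofReal m * F (φ x)) := by
        rw [← mul_assoc, h4, one_mul]
    _ ≤ _ := by
        gcongr
        exact (hmφ x).trans (le_abs_self _)

lemma comp_eLpNorm_le (φ φ' : ℝ → ℝ) (m : ℝ) (hm : 0 < m) (hφ : ∀ x, HasDerivAt φ (φ' x) x)
    (hmφ : ∀ x, m ≤ φ' x) (hb : Bijective φ) (F : ℝ → ℝ) :
    eLpNorm (fun x => F (φ x)) 2 volume ≤
      ENNReal.ofReal m⁻¹ ^ (1 / 2 : ℝ) * eLpNorm F 2 volume := by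
  rw [← ENNReal.pow_le_pow_left_iff (n := 2) (by norm_num), mul_pow, sq_eLpNorm, sq_eLpNorm]
  have : (ENNReal.ofReal m⁻¹ ^ (1 / 2 : ℝ)) ^ 2 = ENNReal.ofReal m⁻¹ := by
    simp only [← ENNReal.rpow_natCast, ← ENNReal.rpow_mul]
    norm_num
  rw [this]
  exact comp_lintegral_le φ φ' m hm hφ hmφ hb (fun x => ‖F x‖ₑ ^ 2)

lemma comp_qmp (φ φ' : ℝ → ℝ) (m : ℝ) (hm : 0 < m) (hφ : ∀ x, HasDerivAt φ (φ' x) x)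
    (hmφ : ∀ x, m ≤ φ' x) (hb : Bijective φ) :
    Measure.QuasiMeasurePreserving φ (volume : Measure ℝ) volume := by
  have hc : Continuous φ := continuous_iff_continuousAt.2 fun x => (hφ x).continuousAt
  refine ⟨hc.measurable, Measure.AbsolutelyContinuous.mk fun s hs h0 => ?_⟩
  rw [Measure.map_apply hc.measurable hs]
  have := comp_lintegral_le φ φ' m hm hφ hmφ hb (s.indicator 1)
  rw [lintegral_indicator_one hs, h0, mul_zero] at this
  have h2 : ∫⁻ x, s.indicator (1 : ℝ → ℝ≥0∞) (φ x) = volume (φ ⁻¹' s) := by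
    rw [← lintegral_indicator_one (hc.measurable hs)]
    rfl
  rw [← h2]
  exact le_antisymm this (zero_le)

lemma comp_memLp (φ φ' : ℝ → ℝ) (m : ℝ) (hm : 0 < m) (hφ : ∀ x, HasDerivAt φ (φ' x) x)
    (hmφ : ∀ x, m ≤ φ' x) (hb : Bijective φ) (F : ℝ → ℝ) (hF : MemLp F 2 (volume : Measure ℝ)) :
    MemLp (fun x => F (φ x)) 2 (volume : Measure ℝ) := by
  refine ⟨hF.1.comp_quasiMeasurePreserving (comp_qmp φ φ' m hm hφ hmφ hb), ?_⟩
  refine (comp_eLpNorm_le φ φ' m hm hφ hmφ hb F).trans_lt ?_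
  refine ENNReal.mul_lt_top ?_ hF.2
  exact (ENNReal.rpow_ne_top_of_nonneg (by norm_num) (by simp)).lt_top

lemma comp_tendsto (φ φ' : ℝ → ℝ) (m : ℝ) (hm : 0 < m) (hφ : ∀ x, HasDerivAt φ (φ' x) x)
    (hmφ : ∀ x, m ≤ φ' x) (hb : Bijective φ) (F : ℝ → ℝ → ℝ) (l : Filter ℝ)
    (hF : Tendsto (fun s => eLpNorm (F s) 2 (volume : Measure ℝ)) l (𝓝 0)) :
    Tendsto (fun s => eLpNorm (fun x => F s (φ x)) 2 (volume : Measure ℝ)) l (𝓝 0) := by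
  have h1 := ENNReal.Tendsto.const_mul (a := ENNReal.ofReal m⁻¹ ^ (1 / 2 : ℝ)) hF
    (Or.inr (ENNReal.rpow_ne_top_of_nonneg (by norm_num) (by simp)))
  rw [mul_zero] at h1
  exact tendsto_of_tendsto_of_tendsto_of_le_of_le tendsto_const_nhds h1 (fun s => zero_le)
    fun s => comp_eLpNorm_le φ φ' m hm hφ hmφ hb (F s)

lemma comp_integral (φ φ' : ℝ → ℝ) (m : ℝ) (hm : 0 < m) (hφ : ∀ x, HasDerivAt φ (φ' x) x)
    (hmφ : ∀ x, m ≤ φ' x) (F : ℝ → ℝ) (a b : ℝ) :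
    ∫ x in a..b, F (φ x) * φ' x = ∫ x in (φ a)..(φ b), F x :=
  intervalIntegral.integral_comp_mul_deriv_of_deriv_nonneg
    (fun x _ => (hφ x).continuousAt.continuousWithinAt)
    (fun x _ => hφ x) (fun x _ => hm.le.trans (hmφ x))

/-- the infinitesimal generator of the group
`(G_{g∂}(t)f)(x) = f(h⁻¹(h(x)+t))` on `L²(ℝ)` is `g∂` with domain `W^{1,2}(ℝ)`:
the difference quotients `(G_{g∂}(s)u − u)/s` converge to `z` in `L²` as `s ↓ 0` iff
`u` has an absolutely continuous representative `ũ` with `L²` weak derivative `w`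
(`ũ(y) − ũ(x) = ∫_x^y w`) and `z = g·w` a.e. -/
theorem statement11
    (g : ℝ → ℝ) (hg : Continuous g)
    (c₁ c₂ : ℝ) (hc₁ : 0 < c₁) (hbound : ∀ x : ℝ, c₁ ≤ g x ∧ g x ≤ c₂)
    (c : ℝ) (h : ℝ → ℝ) (hh : ∀ x : ℝ, h x = ∫ r in c..x, (g r)⁻¹)
    (u z : ℝ → ℝ)
    (hu : MemLp u 2 (volume : Measure ℝ)) (hz : MemLp z 2 (volume : Measure ℝ)) :
    Tendsto
      (fun s : ℝ => eLpNorm (fun x : ℝ => s⁻¹ * (u (invFun h (h x + s)) - u x) - z x) 2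
        (volume : Measure ℝ))
      (𝓝[>] 0) (𝓝 0)
    ↔ ∃ w : ℝ → ℝ, MemLp w 2 (volume : Measure ℝ) ∧
        (∃ utilde : ℝ → ℝ, utilde =ᵐ[(volume : Measure ℝ)] u ∧
          ∀ x y : ℝ, utilde y - utilde x = ∫ r in x..y, w r) ∧
        z =ᵐ[(volume : Measure ℝ)] fun x => g x * w x := by
  have hgpos : ∀ x, 0 < g x := fun x => hc₁.trans_le (hbound x).1
  have hc₂ : 0 < c₂ := (hgpos 0).trans_le (hbound 0).2
  have hgi : Continuous fun r => (g r)⁻¹ := hg.inv₀ fun x => (hgpos x).ne'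
  have hd : ∀ x, HasDerivAt h (g x)⁻¹ x := by
    intro x
    have e : h = fun x => ∫ r in c..x, (g r)⁻¹ := funext hh
    rw [e]
    exact intervalIntegral.integral_hasDerivAt_right (hgi.intervalIntegrable _ _)
      (hgi.stronglyMeasurableAtFilter _ _) hgi.continuousAt
  have hm : ∀ x, c₂⁻¹ ≤ (g x)⁻¹ := fun x => inv_anti₀ (hgpos x) (hbound x).2
  have hcont : Continuous h := continuous_iff_continuousAt.2 fun x => (hd x).continuousAt
  have hmono : StrictMono h := strictMono_of_deriv_pos fun x => by
    rw [(hd x).deriv]; exact inv_pos.2 (hgpos x)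
  have hgrow : Monotone fun x => h x - c₂⁻¹ * x := by
    have hd' : ∀ x, HasDerivAt (fun x => h x - c₂⁻¹ * x) ((g x)⁻¹ - c₂⁻¹ * 1) x := fun x =>
      (hd x).sub ((hasDerivAt_id x).const_mul _)
    refine monotone_of_deriv_nonneg (fun x => (hd' x).differentiableAt) fun x => ?_
    rw [(hd' x).deriv]
    have := hm x
    linarith
  have hsurj : Surjective h := by
    refine hcont.surjective ?_ ?_
    · refine tendsto_atTop_mono' _ (f₁ := fun x => (h 0) + c₂⁻¹ * x) ?_
        (tendsto_atTop_add_const_left _ _ (tendsto_id.const_mul_atTop (inv_pos.2 hc₂)))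
      filter_upwards [eventually_ge_atTop 0] with x hx
      have := hgrow hx
      simp at this
      linarith
    · refine tendsto_atBot_mono' _ (f₁ := fun x => (h 0) + c₂⁻¹ * x) ?_
        (tendsto_atBot_add_const_left _ _ (tendsto_id.const_mul_atBot (inv_pos.2 hc₂)))
      filter_upwards [eventually_le_atBot 0] with x hx
      have := hgrow hx
      simp at this
      linarith
  have hb : Bijective h := ⟨hmono.injective, hsurj⟩
  set k := invFun h with hk
  have hkh : ∀ x, k (h x) = x := leftInverse_invFun hb.1
  have hhk : ∀ x, h (k x) = x := rightInverse_invFun hb.2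
  have hkb : Bijective k := ⟨LeftInverse.injective hhk, LeftInverse.surjective hkh⟩
  have hkcont : Continuous k := by
    have : k = (hmono.orderIsoOfSurjective h hsurj).symm := by
      ext x
      apply hmono.injective
      rw [hhk]
      exact ((hmono.orderIsoOfSurjective h hsurj).apply_symm_apply x).symm
    rw [this]
    exact (hmono.orderIsoOfSurjective h hsurj).symm.continuous
  have hkd : ∀ y, HasDerivAt k (g (k y)) y := by
    intro y
    have := HasDerivAt.of_local_left_inverse hkcont.continuousAt (hd (k y))
      (inv_ne_zero (hgpos _).ne') (.of_forall hhk)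
    simpa using this
  have hkm : ∀ y, c₁ ≤ g (k y) := fun y => (hbound _).1
  have hi := inv_pos.2 hc₂
  have hv := comp_memLp k _ c₁ hc₁ hkd hkm hkb u hu
  have hζ := comp_memLp k _ c₁ hc₁ hkd hkm hkb z hz
  constructor
  · intro hT
    have hT2 := comp_tendsto k _ c₁ hc₁ hkd hkm hkb _ _ hT
    simp only [hhk] at hT2
    obtain ⟨V, hV1, hV2⟩ := trans_fwd (fun x => u (k x)) (fun x => z (k x)) hv hζ hT2
    refine ⟨fun x => z x * (g x)⁻¹, ?_, ⟨fun x => V (h x), ?_, fun x y => ?_⟩, ?_⟩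
    · refine MemLp.of_le_mul (c := c₁⁻¹) hz (hz.1.mul hgi.aestronglyMeasurable) (.of_forall fun x => ?_)
      rw [norm_mul, mul_comm]
      gcongr
      rw [Real.norm_of_nonneg (inv_pos.2 (hgpos x)).le]
      exact inv_anti₀ hc₁ (hbound x).1
    · have := (comp_qmp h _ _ hi hd hm hb).ae_eq_comp hV1
      filter_upwards [this] with x hx
      simpa [hkh] using hx
    · rw [hV2, ← comp_integral h _ _ hi hd hm]
      simp only [hkh]
    · refine .of_forall fun x => ?_
      have := (hgpos x).ne'
      simp only
      field_simp
  · rintro ⟨w, hw, ⟨U, hU1, hU2⟩, hzw⟩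
    have hq := comp_qmp k _ c₁ hc₁ hkd hkm hkb
    have hT := trans_bwd (fun x => u (k x)) (fun x => z (k x)) (fun x => U (k x)) hζ
      (hq.ae_eq_comp hU1) (fun x y => by
        rw [hU2, ← comp_integral k _ _ hc₁ hkd hkm]
        refine intervalIntegral.integral_congr_ae ?_
        filter_upwards [hq.ae_eq_comp hzw] with r hr _
        simp only [Function.comp_apply] at hr
        rw [hr, mul_comm])
    have hT2 := comp_tendsto h _ _ hi hd hm hb _ _ hT
    simpa only [hkh] using hT2
end
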